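/- Let p, r ∈ (0,1) and let S, T ∈ TOEC(p,r). Then the self-similar sets E_S and E_T are Lipschitz equivalent if and only if the ideals I_S and I_T belong to the same ideal class of Z[p]. -/

import Mathlib

open MeasureTheory Metric Set Pointwise

noncomputable section

/-- An iterated function system (IFS) of contracting similarities on `ℝ^d`. -/
structure IFS (d : ℕ) : Type 1 where
  ι : Type
  fin : Fintype ι
  f : ι → EuclideanSpace ℝ (Fin d) → EuclideanSpace ℝ (Fin d)
  r : ι → ℝ
  r_pos : ∀ i, 0 < r i
  r_lt_one : ∀ i, r i < 1
  sim : ∀ i x y, dist (f i x) (f i y) = r i * dist x y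

attribute [instance] IFS.fin

namespace IFS

variable {d : ℕ}

/-- `E` is the self-similar set (attractor) of `S`: the unique nonempty compact set
with `E = ⋃ i, S.f i '' E`. -/
def IsAttractor (S : IFS d) (E : Set (EuclideanSpace ℝ (Fin d))) : Prop :=
  E.Nonempty ∧ IsCompact E ∧ E = ⋃ i, S.f i '' E

open scoped Classical in
/-- The self-similar set generated by `S`. -/
def attractor (S : IFS d) : Set (EuclideanSpace ℝ (Fin d)) :=
  if h : ∃ E, S.IsAttractor E then h.choose else ∅

/-- `O` is an open set witnessing the open set condition for `S`. -/
def OSCSet (S : IFS d) (O : Set (EuclideanSpace ℝ (Fin d))) : Prop :=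
  O.Nonempty ∧ IsOpen O ∧ Bornology.IsBounded O ∧
    (∀ i, S.f i '' O ⊆ O) ∧ ∀ i j, i ≠ j → Disjoint (S.f i '' O) (S.f j '' O)

/-- The open set condition. -/
def OSC (S : IFS d) : Prop := ∃ O, S.OSCSet O

/-- The strong separation condition. -/
def SSC (S : IFS d) : Prop :=
  ∀ i j : S.ι, i ≠ j → Disjoint (S.f i '' S.attractor) (S.f j '' S.attractor)

/-- `r` is the ratio root of `S`: the ratios are commensurable with common root `r`. -/
def IsRatioRoot (S : IFS d) (r : ℝ) : Prop :=
  0 < r ∧ r < 1 ∧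
    ∃ lam : S.ι → ℕ, (∀ i, 0 < lam i) ∧ (∀ i, S.r i = r ^ lam i) ∧ Finset.univ.gcd lam = 1

/-- The Hausdorff dimension of the attractor of `S`, as a real number. -/
def hdim (S : IFS d) : ℝ := (dimH S.attractor).toReal

/-- Membership in the class TOEC: OSC, commensurable ratios, totally disconnected attractor. -/
def MemTOEC (S : IFS d) : Prop :=
  S.OSC ∧ (∃ r, S.IsRatioRoot r) ∧ IsTotallyDisconnected S.attractor

/-- Membership in TOEC(p, r): measure root `p` and ratio root `r`. -/
def MemTOECpr (S : IFS d) (p r : ℝ) : Prop :=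
  S.MemTOEC ∧ S.IsRatioRoot r ∧ p = r ^ S.hdim

/-- The natural measure of a set: normalized `s`-dimensional Hausdorff measure, `s = dimH E_S`. -/
def natMeasure (S : IFS d) (F : Set (EuclideanSpace ℝ (Fin d))) : ℝ :=
  (μH[S.hdim] F / μH[S.hdim] S.attractor).toReal

/-- `F` is an interior separated set of `E_S`. -/
def IsIntSep (S : IFS d) (F : Set (EuclideanSpace ℝ (Fin d))) : Prop :=
  IsCompact F ∧ F ⊆ S.attractor ∧ IsCompact (S.attractor \ F) ∧ ∃ O, S.OSCSet O ∧ F ⊆ O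

end IFS

/-- The subring `ℤ[p]` of `ℝ` generated by `ℤ` and `p`. -/
def Zring (p : ℝ) : Subring ℝ := Subring.closure {p}

/-- The underlying set of reals of an ideal of a subring of `ℝ`. -/
def idealSet {R : Subring ℝ} (I : Ideal R) : Set ℝ := (fun x : R => (x : ℝ)) '' (I : Set R)

/-- The ideal `I_S` of `ℤ[p]` generated by the natural measures of interior separated sets. -/
def IFS.idealOf {d : ℕ} (S : IFS d) (p : ℝ) : Ideal (Zring p) :=
  Ideal.span {x : Zring p | ∃ F, S.IsIntSep F ∧ (x : ℝ) = S.natMeasure F}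

/-- Two ideals of a subring `R` of `ℝ` lie in the same ideal class: `a·I = b·J`
for some nonzero `a, b ∈ R`. -/
def SameIdealClass {R : Subring ℝ} (I J : Ideal R) : Prop :=
  ∃ a b : R, a ≠ 0 ∧ b ≠ 0 ∧ (a : ℝ) • idealSet I = (b : ℝ) • idealSet J

/-- Lipschitz equivalence of subsets of (possibly different) metric spaces. -/
def LipEquiv {X Y : Type*} [MetricSpace X] [MetricSpace Y] (A : Set X) (B : Set Y) : Prop :=
  ∃ (f : X → Y) (L : ℝ), 1 ≤ L ∧ Set.BijOn f A B ∧
    ∀ x ∈ A, ∀ y ∈ A, L⁻¹ * dist x y ≤ dist (f x) (f y) ∧ dist (f x) (f y) ≤ L * dist x y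

section

/-- A decreasing sequence of finite partitions of `X`; `N k x` is the cell of level `k` at `x`. -/
structure IsTree {X : Type*} (N : ℕ → X → Set X) : Prop where
  self : ∀ k x, x ∈ N k x
  eq : ∀ k x y, y ∈ N k x → N k y = N k x
  anti : ∀ k x, N (k + 1) x ⊆ N k x
  fin : ∀ k, (range (N k)).Finite

/-- A set which is a union of cells of level `k`. -/
def Sat {X : Type*} (N : ℕ → X → Set X) (k : ℕ) (A : Set X) : Prop := ∀ x ∈ A, N k x ⊆ A

namespace IsTree

variable {X : Type*} {N : ℕ → X → Set X} (h : IsTree N)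
include h

lemma mono {k l : ℕ} (hkl : k ≤ l) (x : X) : N l x ⊆ N k x := by
  induction l, hkl using Nat.le_induction with
  | base => exact subset_rfl
  | succ n _ ih => exact (h.anti n x).trans ih

lemma sat_node (k : ℕ) (x : X) : Sat N k (N k x) := fun y hy => (h.eq k x y hy).subset

lemma sat_mono {k l : ℕ} (hkl : k ≤ l) {A : Set X} (hA : Sat N k A) : Sat N l A :=
  fun x hx => (h.mono hkl x).trans (hA x hx)

omit h in
lemma sat_union {k : ℕ} {A B : Set X} (hA : Sat N k A) (hB : Sat N k B) : Sat N k (A ∪ B) := by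
  rintro x (hx | hx)
  · exact (hA x hx).trans subset_union_left
  · exact (hB x hx).trans subset_union_right

omit h in
lemma sat_inter {k : ℕ} {A B : Set X} (hA : Sat N k A) (hB : Sat N k B) : Sat N k (A ∩ B) :=
  fun x hx => subset_inter (hA x hx.1) (hB x hx.2)

omit h in
lemma sat_sUnion {k : ℕ} {S : Set (Set X)} (hS : ∀ A ∈ S, Sat N k A) : Sat N k (⋃₀ S) := by
  rintro x ⟨A, hA, hx⟩
  exact (hS A hA x hx).trans (subset_sUnion_of_mem hA)

lemma sat_compl {k : ℕ} {A : Set X} (hA : Sat N k A) : Sat N k Aᶜ := by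
  intro x hx y hy hyA
  apply hx
  apply hA y hyA
  rw [h.eq k x y hy]
  exact h.self k x

lemma sat_diff {k : ℕ} {A B : Set X} (hA : Sat N k A) (hB : Sat N k B) : Sat N k (A \ B) :=
  sat_inter hA (h.sat_compl hB)

omit h in
lemma sat_empty (k : ℕ) : Sat N k ∅ := fun _ hx => hx.elim

omit h in
lemma sat_univ (k : ℕ) : Sat N k univ := fun _ _ => subset_univ _

lemma node_eq_or_disjoint (k : ℕ) (x y : X) : N k x = N k y ∨ Disjoint (N k x) (N k y) := by
  by_cases hd : Disjoint (N k x) (N k y)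
  · exact Or.inr hd
  · left
    obtain ⟨z, hz1, hz2⟩ := Set.not_disjoint_iff.1 hd
    rw [← h.eq k x z hz1, ← h.eq k y z hz2]

/-- The finite set of cells of level `k` meeting `A`. -/
def cells (k : ℕ) (A : Set X) : Finset (Set X) :=
  ((h.fin k).subset (image_subset_range (N k) A)).toFinset

lemma mem_cells {k : ℕ} {A c : Set X} : c ∈ h.cells k A ↔ ∃ x ∈ A, N k x = c := by
  simp [cells]

lemma sat_of_mem_cells {k : ℕ} {A c : Set X} (hc : c ∈ h.cells k A) : Sat N k c := by
  obtain ⟨x, _, rfl⟩ := h.mem_cells.1 hc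
  exact h.sat_node k x

lemma subset_of_mem_cells {k : ℕ} {A c : Set X} (hA : Sat N k A) (hc : c ∈ h.cells k A) :
    c ⊆ A := by
  obtain ⟨x, hx, rfl⟩ := h.mem_cells.1 hc
  exact hA x hx

lemma sUnion_cells {k : ℕ} {A : Set X} (hA : Sat N k A) : ⋃₀ (h.cells k A : Set (Set X)) = A := by
  ext y
  constructor
  · rintro ⟨c, hc, hy⟩
    exact h.subset_of_mem_cells hA hc hy
  · intro hy
    exact ⟨N k y, h.mem_cells.2 ⟨y, hy, rfl⟩, h.self k y⟩

lemma cells_disjoint {k : ℕ} {A : Set X} :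
    (h.cells k A : Set (Set X)).PairwiseDisjoint id := by
  intro c hc d hd hcd
  obtain ⟨x, _, rfl⟩ := h.mem_cells.1 hc
  obtain ⟨y, _, rfl⟩ := h.mem_cells.1 hd
  exact (h.node_eq_or_disjoint k x y).resolve_left hcd

end IsTree

/-- Finite additivity of `m` on the algebra of saturated sets. -/
def SatAdd {X : Type*} (N : ℕ → X → Set X) (m : Set X → ℝ) : Prop :=
  ∀ k A B, Sat N k A → Sat N k B → Disjoint A B → m (A ∪ B) = m A + m B

namespace SatAdd

variable {X : Type*} {N : ℕ → X → Set X} {m : Set X → ℝ} (hm : SatAdd N m)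
include hm

lemma empty : m ∅ = 0 := by
  have := hm 0 ∅ ∅ (IsTree.sat_empty 0) (IsTree.sat_empty 0) (disjoint_empty _)
  rw [union_self] at this
  linarith

lemma sUnion {k : ℕ} (s : Finset (Set X)) (hs : ∀ c ∈ s, Sat N k c)
    (hd : (s : Set (Set X)).PairwiseDisjoint id) :
    m (⋃₀ (s : Set (Set X))) = ∑ c ∈ s, m c := by
  classical
  induction s using Finset.induction_on with
  | empty => simp [hm.empty]
  | insert a s ha ih =>
    rw [Finset.sum_insert ha, Finset.coe_insert, sUnion_insert, hm k, ih]
    · exact fun c hc => hs c (Finset.mem_insert_of_mem hc)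
    · exact hd.subset (by simp)
    · exact hs a (Finset.mem_insert_self _ _)
    · exact IsTree.sat_sUnion fun c hc => hs c (Finset.mem_insert_of_mem hc)
    · rw [disjoint_sUnion_right]
      intro c hc
      exact hd (by simp) (by simp [Finset.mem_coe.1 hc]) (by rintro rfl; exact ha hc)

lemma diff (h : IsTree N) {k : ℕ} {A B : Set X} (hA : Sat N k A) (hB : Sat N k B) (hBA : B ⊆ A) :
    m (A \ B) = m A - m B := by
  have := hm k B (A \ B) hB (h.sat_diff hA hB) disjoint_sdiff_right
  rw [union_sdiff_cancel hBA] at this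
  linarith

lemma cells (h : IsTree N) {k : ℕ} {A : Set X} (hA : Sat N k A) :
    m A = ∑ c ∈ h.cells k A, m c := by
  rw [← hm.sUnion (k := k) _ (fun c hc => h.sat_of_mem_cells hc) h.cells_disjoint,
    h.sUnion_cells hA]

end SatAdd

/-- The nonnegative integer combinations of the elements of `W`. -/
def natCombs (W : Finset ℝ) : Set ℝ := {s | ∃ n : ℝ → ℕ, s = ∑ w ∈ W, (n w : ℝ) * w}

lemma finite_natCombs_le (W : Finset ℝ) (hW : ∀ w ∈ W, 0 < w) (B : ℝ) :
    {s ∈ natCombs W | s ≤ B}.Finite := by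
  classical
  obtain ⟨M, hM⟩ : ∃ M : ℕ, ∀ w ∈ W, B < M * w := by
    have : ∀ w ∈ W, ∃ M : ℕ, B < M * w := fun w hw => by
      obtain ⟨M, hM⟩ := exists_nat_gt (B / w)
      exact ⟨M, (div_lt_iff₀ (hW w hw)).1 hM⟩
    choose! M hM using this
    refine ⟨W.sup M, fun w hw => (hM w hw).trans_le ?_⟩
    have := Finset.le_sup (f := M) hw
    have := hW w hw
    gcongr
  refine (Set.finite_range (fun n : W → Fin (M + 1) => ∑ w : W, ((n w : ℕ) : ℝ) * (w : ℝ))).subset ?_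
  rintro s ⟨⟨n, rfl⟩, hs⟩
  have hn : ∀ w ∈ W, n w < M + 1 := by
    intro w hw
    by_contra hcon
    have h1 : (n w : ℝ) * w ≤ B := (Finset.single_le_sum (f := fun w => (n w : ℝ) * w)
      (fun w hw => mul_nonneg (Nat.cast_nonneg _) (hW w hw).le) hw).trans hs
    have h2 : (M : ℝ) * w ≤ n w * w := by
      have := (hW w hw).le
      have : M ≤ n w := by omega
      gcongr
    linarith [hM w hw]
  refine ⟨fun w => ⟨n w, hn w w.2⟩, ?_⟩
  exact Finset.sum_coe_sort W (fun w => (n w : ℝ) * w)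

lemma exists_greedy {α : Type*} [DecidableEq α] (s : Finset α) (w : α → ℝ) {η t : ℝ}
    (hw : ∀ a ∈ s, w a ≤ η) (ht : 0 < t) (hs : t ≤ ∑ a ∈ s, w a) :
    ∃ s' ⊆ s, ∑ a ∈ s', w a < t ∧ t ≤ ∑ a ∈ s', w a + η := by
  induction s using Finset.induction_on with
  | empty => simp at hs; linarith
  | insert a s ha ih =>
    by_cases h : t ≤ ∑ a ∈ s, w a
    · obtain ⟨s', h1, h2⟩ := ih (fun b hb => hw b (Finset.mem_insert_of_mem hb)) h
      exact ⟨s', h1.trans (Finset.subset_insert _ _), h2⟩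
    · refine ⟨s, Finset.subset_insert _ _, not_le.1 h, ?_⟩
      rw [Finset.sum_insert ha] at hs
      linarith [hw a (Finset.mem_insert_self _ _)]

/-- A tree with a finitely additive weight `m` whose cells of level `k` have weights in `p ^ k • W`
and contain saturated sets of all small weights in `p ^ k • I`. -/
structure Base {X : Type*} (N : ℕ → X → Set X) (p : ℝ) (m : Set X → ℝ) (I : AddSubgroup ℝ)
    (W : Finset ℝ) (σ : ℝ) : Prop where
  tree : IsTree N
  p_pos : 0 < p
  p_lt : p < 1
  add : SatAdd N m
  W_pos : ∀ w ∈ W, 0 < w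
  wt : ∀ k x, ∃ w ∈ W, m (N k x) = p ^ k * w
  mul_p : ∀ y ∈ I, p * y ∈ I
  mul_p_inv : ∀ y ∈ I, p⁻¹ * y ∈ I
  σ_pos : 0 < σ
  rich : ∀ y ∈ I, 0 < y → y < σ → ∃ K, ∀ k x, ∃ A ⊆ N k x, Sat N (k + K) A ∧ m A = p ^ k * y

namespace Base

variable {X : Type*} {N : ℕ → X → Set X} {p : ℝ} {m : Set X → ℝ} {I : AddSubgroup ℝ}
  {W : Finset ℝ} {σ : ℝ} (b : Base N p m I W σ)
include b

lemma pow_mul_mem (k : ℕ) {y : ℝ} (hy : y ∈ I) : p ^ k * y ∈ I := by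
  induction k with
  | zero => simpa
  | succ k ih => rw [pow_succ', mul_assoc]; exact b.mul_p _ ih

lemma mem_of_pow_mul (k : ℕ) {y : ℝ} (hy : p ^ k * y ∈ I) : y ∈ I := by
  induction k with
  | zero => simpa using hy
  | succ k ih =>
    apply ih
    have := b.mul_p_inv _ hy
    rwa [pow_succ', mul_assoc, inv_mul_cancel_left₀ b.p_pos.ne'] at this

lemma node_pos (k : ℕ) (x : X) : 0 < m (N k x) := by
  obtain ⟨w, hw, h⟩ := b.wt k x
  rw [h]
  exact mul_pos (pow_pos b.p_pos _) (b.W_pos w hw)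

lemma exists_bound : ∃ M, 0 < M ∧ ∀ w ∈ W, w ≤ M :=
  ⟨1 + ∑ w ∈ W, w, by linarith [Finset.sum_nonneg fun w hw => (b.W_pos w hw).le], fun w hw => by
    linarith [Finset.single_le_sum (f := fun w => w) (fun w hw => (b.W_pos w hw).le) hw]⟩

lemma exists_count {k : ℕ} (s : Finset (Set X)) (hs : ∀ c ∈ s, ∃ x, N k x = c) :
    ∃ v ∈ natCombs W, ∑ c ∈ s, m c = p ^ k * v := by
  classical
  refine ⟨_, ⟨fun w => (s.filter fun c => m c = p ^ k * w).card, rfl⟩, ?_⟩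
  have hpk := pow_pos b.p_pos k
  rw [← Finset.sum_fiberwise_of_maps_to (s := s) (t := W.image fun w => p ^ k * w) (g := m)
    (fun c hc => by
      obtain ⟨x, rfl⟩ := hs c hc
      obtain ⟨w, hw, h⟩ := b.wt k x
      exact Finset.mem_image.2 ⟨w, hw, h.symm⟩),
    Finset.sum_image (fun a _ b _ hab => mul_left_cancel₀ hpk.ne' hab), Finset.mul_sum]
  refine Finset.sum_congr rfl fun w hw => ?_
  rw [Finset.sum_congr rfl (fun c hc => (Finset.mem_filter.1 hc).2), Finset.sum_const, nsmul_eq_mul]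
  ring

lemma exists_val {k : ℕ} {A : Set X} (hA : Sat N k A) : ∃ v ∈ natCombs W, m A = p ^ k * v := by
  rw [b.add.cells b.tree hA]
  exact b.exists_count _ fun c hc => by
    obtain ⟨x, _, h⟩ := b.tree.mem_cells.1 hc
    exact ⟨x, h⟩

lemma nonneg {k : ℕ} {A : Set X} (hA : Sat N k A) : 0 ≤ m A := by
  rw [b.add.cells b.tree hA]
  refine Finset.sum_nonneg fun c hc => ?_
  obtain ⟨x, _, rfl⟩ := b.tree.mem_cells.1 hc
  exact (b.node_pos k x).le

lemma mono {k : ℕ} {A B : Set X} (hA : Sat N k A) (hB : Sat N k B) (hBA : B ⊆ A) : m B ≤ m A := by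
  have := b.add.diff b.tree hA hB hBA
  linarith [b.nonneg (b.tree.sat_diff hA hB)]

lemma pos {k : ℕ} {A : Set X} (hA : Sat N k A) (hne : A.Nonempty) : 0 < m A := by
  obtain ⟨x, hx⟩ := hne
  exact (b.node_pos k x).trans_le (b.mono hA (b.tree.sat_node k x) (hA x hx))

/-- Values of saturated sets are separated. -/
lemma exists_gap (K : ℕ) (x : ℝ) : ∃ ε > 0, ∀ k A, Sat N (k + K) A → p ^ k * x < m A →
    p ^ k * (x + ε) ≤ m A := by
  have hfin := (finite_natCombs_le W b.W_pos ((x + 1) / p ^ K))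
  have hK := pow_pos b.p_pos K
  obtain ⟨ε, hε, h⟩ : ∃ ε > 0, ∀ s ∈ {s ∈ natCombs W | s ≤ (x + 1) / p ^ K}, x < p ^ K * s →
      x + ε ≤ p ^ K * s := by
    generalize {s ∈ natCombs W | s ≤ (x + 1) / p ^ K} = F at hfin
    induction F, hfin using Set.Finite.induction_on with
    | empty => exact ⟨1, one_pos, by simp⟩
    | @insert a s _ _ ih =>
      obtain ⟨ε, hε, h⟩ := ih
      by_cases ha : x < p ^ K * a
      · refine ⟨min ε (p ^ K * a - x), lt_min hε (by linarith), ?_⟩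
        rintro s (rfl | hs) hx
        · linarith [min_le_right ε (p ^ K * s - x)]
        · linarith [h s hs hx, min_le_left ε (p ^ K * a - x)]
      · refine ⟨ε, hε, ?_⟩
        rintro s (rfl | hs) hx
        · exact absurd hx ha
        · exact h s hs hx
  refine ⟨min ε 1, lt_min hε one_pos, fun k A hA hlt => ?_⟩
  obtain ⟨v, hv, hmA⟩ := b.exists_val hA
  have hk := pow_pos b.p_pos k
  rw [hmA, pow_add, mul_assoc] at hlt ⊢
  have hlt' := lt_of_mul_lt_mul_left hlt hk.le
  refine mul_le_mul_of_nonneg_left ?_ hk.le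
  by_cases hle : v ≤ (x + 1) / p ^ K
  · linarith [h v ⟨hv, hle⟩ hlt', min_le_left ε 1]
  · rw [not_le, div_lt_iff₀ hK] at hle
    linarith [min_le_right ε 1]

lemma exists_pow_mul_lt (M : ℝ) {ε : ℝ} (hε : 0 < ε) (K0 : ℕ) : ∃ K ≥ K0, M * p ^ K < ε := by
  have h1 : Filter.Tendsto (fun K => M * p ^ K) Filter.atTop (nhds (M * 0)) :=
    (tendsto_pow_atTop_nhds_zero_of_lt_one b.p_pos.le b.p_lt).const_mul M
  rw [mul_zero] at h1
  exact ((Filter.eventually_ge_atTop K0).and (h1.eventually_lt_const hε)).exists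

lemma rich_finite {Y : Set ℝ} (hY : Y.Finite) : ∃ K, ∀ y ∈ Y, y ∈ I → 0 < y → y < σ →
    ∀ k x, ∃ A ⊆ N k x, Sat N (k + K) A ∧ m A = p ^ k * y := by
  have : ∀ y, ∃ K, y ∈ I → 0 < y → y < σ →
    ∀ k x, ∃ A ⊆ N k x, Sat N (k + K) A ∧ m A = p ^ k * y := by
    intro y
    by_cases h : y ∈ I ∧ 0 < y ∧ y < σ
    · obtain ⟨K, hK⟩ := b.rich y h.1 h.2.1 h.2.2
      exact ⟨K, fun _ _ _ => hK⟩
    · exact ⟨0, fun h1 h2 h3 => absurd ⟨h1, h2, h3⟩ h⟩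
  choose K hK using this
  refine ⟨hY.toFinset.sup K, fun y hy h1 h2 h3 k x => ?_⟩
  obtain ⟨A, hA, hs, hm⟩ := hK y h1 h2 h3 k x
  refine ⟨A, hA, b.tree.sat_mono ?_ hs, hm⟩
  have := Finset.le_sup (f := K) (hY.mem_toFinset.2 hy)
  omega

/-- A saturated set all of whose saturated subsets have weight in `I` can be cut at any
value in `I`. -/
lemma exists_cut {x : ℝ} (hxI : x ∈ I) (hx : 0 < x) (K0 : ℕ) :
    ∃ K ≥ K0, ∀ k A, Sat N (k + K0) A → (∀ n D, D ⊆ A → Sat N n D → m D ∈ I) →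
      p ^ k * x < m A → ∃ A' ⊆ A, Sat N (k + K) A' ∧ m A' = p ^ k * x := by
  classical
  obtain ⟨ε, hε, hgap⟩ := b.exists_gap K0 x
  obtain ⟨M, hM, hWM⟩ := b.exists_bound
  have hp := b.p_pos
  obtain ⟨K1, hK1, hK1'⟩ := b.exists_pow_mul_lt M hε K0
  obtain ⟨K2, hK2, hK2'⟩ := b.exists_pow_mul_lt M (mul_pos b.σ_pos (pow_pos hp K1)) K1
  have hfin : ((fun s => (x - p ^ K2 * s) / p ^ K1) ''
      {s ∈ natCombs W | s ≤ x / p ^ K2}).Finite := (finite_natCombs_le W b.W_pos _).image _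
  obtain ⟨K3, hK3⟩ := b.rich_finite hfin
  refine ⟨max K2 (K1 + K3), by omega, fun k A hA hI hlt => ?_⟩
  have hpk := pow_pos hp k
  have hnode : ∀ n y, m (N n y) ≤ p ^ n * M := fun n y => by
    obtain ⟨w, hw, h⟩ := b.wt n y
    rw [h]
    exact mul_le_mul_of_nonneg_left (hWM w hw) (pow_pos hp n).le
  have hne : A.Nonempty := by
    rw [nonempty_iff_ne_empty]
    rintro rfl
    rw [b.add.empty] at hlt
    exact absurd hlt (not_lt.2 (mul_pos hpk hx).le)
  obtain ⟨x0, hx0⟩ := hne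
  have hA1 : Sat N (k + K1) A := b.tree.sat_mono (by omega) hA
  set D0 := N (k + K1) x0 with hD0
  have hD0A : D0 ⊆ A := hA1 x0 hx0
  have hD0s : Sat N (k + K1) D0 := b.tree.sat_node _ _
  have hR : Sat N (k + K2) (A \ D0) :=
    b.tree.sat_mono (by omega) (b.tree.sat_diff hA1 hD0s)
  have hmR : p ^ k * x ≤ m (A \ D0) := by
    rw [b.add.diff b.tree hA1 hD0s hD0A]
    have h1 := hgap k A hA hlt
    have h2 := hnode (k + K1) x0
    rw [pow_add] at h2
    have h3 : p ^ k * (M * p ^ K1) < p ^ k * ε := mul_lt_mul_of_pos_left hK1' hpk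
    have h4 : p ^ k * (x + ε) = p ^ k * x + p ^ k * ε := by ring
    have h5 : p ^ k * p ^ K1 * M = p ^ k * (M * p ^ K1) := by ring
    linarith
  obtain ⟨s', hs', hlt', hle'⟩ := exists_greedy (b.tree.cells (k + K2) (A \ D0)) m
    (η := p ^ (k + K2) * M)
    (fun c hc => by
      obtain ⟨y, _, rfl⟩ := b.tree.mem_cells.1 hc
      exact hnode _ _) (mul_pos hpk hx) (by rwa [← b.add.cells b.tree hR])
  set A1 := ⋃₀ (s' : Set (Set X)) with hA1def
  have hsat1 : Sat N (k + K2) A1 :=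
    IsTree.sat_sUnion fun c hc => b.tree.sat_of_mem_cells (hs' hc)
  have hA1sub : A1 ⊆ A \ D0 := sUnion_subset fun c hc => b.tree.subset_of_mem_cells hR (hs' hc)
  have hmA1 : m A1 = ∑ c ∈ s', m c :=
    b.add.sUnion (k := k + K2) _ (fun c hc => b.tree.sat_of_mem_cells (hs' hc))
      (b.tree.cells_disjoint.subset (by exact_mod_cast hs'))
  obtain ⟨v, hv, hval⟩ := b.exists_val hsat1
  rw [← hmA1] at hlt' hle'
  set y := (x - p ^ K2 * v) / p ^ K1 with hy
  have hK1pos := pow_pos hp K1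
  have hK2pos := pow_pos hp K2
  have hy1 : p ^ (k + K1) * y = p ^ k * x - m A1 := by
    rw [hval, hy, pow_add, pow_add]
    field_simp
  have hy0 : 0 < y := by
    have : 0 < p ^ (k + K1) * y := by rw [hy1]; linarith
    exact pos_of_mul_pos_right this (pow_pos hp _).le
  have hyσ : y < σ := by
    have h1 : p ^ (k + K1) * y ≤ p ^ (k + K2) * M := by rw [hy1]; linarith
    have h2 : p ^ (k + K2) * M < p ^ (k + K1) * σ := by
      have := mul_lt_mul_of_pos_left hK2' hpk
      rw [pow_add, pow_add]
      linarith
    exact lt_of_mul_lt_mul_left (h1.trans_lt h2) (pow_pos hp _).le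
  have hyI : y ∈ I := by
    apply b.mem_of_pow_mul (k + K1)
    rw [hy1]
    exact I.sub_mem (b.pow_mul_mem k hxI) (hI _ _ (hA1sub.trans sdiff_subset) hsat1)
  have hymem : y ∈ (fun s => (x - p ^ K2 * s) / p ^ K1) ''
      {s ∈ natCombs W | s ≤ x / p ^ K2} := by
    refine ⟨v, ⟨hv, ?_⟩, rfl⟩
    rw [le_div_iff₀ hK2pos]
    have : 0 < (x - p ^ K2 * v) / p ^ K1 := hy0
    rw [div_pos_iff_of_pos_right hK1pos] at this
    linarith
  obtain ⟨A2, hA2, hsat2, hm2⟩ := hK3 y hymem hyI hy0 hyσ (k + K1) x0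
  have hsat1' : Sat N (k + max K2 (K1 + K3)) A1 := b.tree.sat_mono (by omega) hsat1
  have hsat2' : Sat N (k + max K2 (K1 + K3)) A2 := b.tree.sat_mono (by omega) hsat2
  refine ⟨A1 ∪ A2, union_subset (hA1sub.trans sdiff_subset) (hA2.trans hD0A),
    IsTree.sat_union hsat1' hsat2', ?_⟩
  rw [b.add _ _ _ hsat1' hsat2', hm2, hy1]
  · ring
  · exact (disjoint_sdiff_left (s := D0) (t := A)).mono hA1sub hA2

end Base

end

section

/-- A `Base` all of whose saturated sets have weight in `I`. -/
structure Full {X : Type*} (N : ℕ → X → Set X) (p : ℝ) (m : Set X → ℝ) (I : AddSubgroup ℝ)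
    (W : Finset ℝ) (σ : ℝ) : Prop extends Base N p m I W σ where
  mem : ∀ k A, Sat N k A → m A ∈ I

lemma Full.exists_cut_finset {X : Type*} {N : ℕ → X → Set X} {p : ℝ} {m : Set X → ℝ}
    {I : AddSubgroup ℝ} {W : Finset ℝ} {σ : ℝ} (b : Full N p m I W σ)
    (Y : Finset ℝ) (hY : ∀ y ∈ Y, 0 < y) (K0 : ℕ) :
    ∃ K ≥ K0, ∀ y ∈ Y, y ∈ I → ∀ k A, Sat N (k + K0) A → p ^ k * y < m A →
      ∃ A' ⊆ A, Sat N (k + K) A' ∧ m A' = p ^ k * y := by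
  have : ∀ y, ∃ K, K ≥ K0 ∧ (y ∈ Y → y ∈ I → ∀ k A, Sat N (k + K0) A → p ^ k * y < m A →
      ∃ A' ⊆ A, Sat N (k + K) A' ∧ m A' = p ^ k * y) := by
    intro y
    by_cases h : y ∈ Y ∧ y ∈ I
    · obtain ⟨K, hK, h'⟩ := b.toBase.exists_cut h.2 (hY y h.1) K0
      exact ⟨K, hK, fun _ _ k A hA => h' k A hA fun n D _ hD => b.mem n D hD⟩
    · exact ⟨K0, le_rfl, fun h1 h2 => absurd ⟨h1, h2⟩ h⟩
  choose K hK0 hK using this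
  refine ⟨max K0 (Y.sup K), le_max_left _ _, fun y hy hyI k A hA hlt => ?_⟩
  obtain ⟨A', h1, h2, h3⟩ := hK y hy hyI k A hA hlt
  have := Finset.le_sup (f := K) hy
  exact ⟨A', h1, b.tree.sat_mono (by omega) h2, h3⟩

/-- A nonempty finite zero-sum family with values in a fixed finite set contains a nonempty
zero-sum subfamily of bounded size. -/
lemma exists_zero_sum_bound (F : Finset ℝ) (α : Type*) : ∃ n : ℕ, ∀ (s : Finset α) (g : α → ℝ),
    (∀ a ∈ s, g a ∈ F) → ∑ a ∈ s, g a = 0 → s.Nonempty →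
    ∃ s' ⊆ s, s'.Nonempty ∧ s'.card ≤ n ∧ ∑ a ∈ s', g a = 0 := by
  classical
  let P : (F → ℕ) → Prop := fun v => v ≠ 0 ∧ ∑ f, (v f : ℝ) * (f : ℝ) = 0
  have hfin : {v | Minimal P v}.Finite :=
    WellQuasiOrderedLE.finite_of_isAntichain (setOfPred_minimal_antichain P)
  refine ⟨hfin.toFinset.sup fun v => ∑ f, v f, fun s g hg h0 hne => ?_⟩
  let v : F → ℕ := fun f => (s.filter fun a => g a = f).card
  have hv : P v := by
    refine ⟨?_, ?_⟩
    · obtain ⟨a, ha⟩ := hne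
      intro h
      have := congrFun h ⟨g a, hg a ha⟩
      simp only [v, Pi.zero_apply, Finset.card_eq_zero] at this
      exact Finset.notMem_empty a (this ▸ Finset.mem_filter.2 ⟨ha, rfl⟩)
    · rw [← h0, ← Finset.sum_fiberwise_of_maps_to (s := s) (t := F) (g := g) hg,
        ← Finset.sum_coe_sort F]
      refine Finset.sum_congr rfl fun f _ => ?_
      rw [Finset.sum_congr rfl (fun c hc => (Finset.mem_filter.1 hc).2), Finset.sum_const,
        nsmul_eq_mul]
  obtain ⟨u, huv, hu⟩ := exists_minimal_le_of_wellFoundedLT P v hv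
  have hex : ∀ f : F, ∃ t ⊆ s.filter (fun a => g a = f), t.card = u f := fun f =>
    Finset.exists_subset_card_eq (huv f)
  choose t ht htc using hex
  have hdisj : (((Finset.univ : Finset F) : Set F)).PairwiseDisjoint t := by
    intro f _ f' _ hff'
    rw [Function.onFun, Finset.disjoint_left]
    intro a ha ha'
    have h1 := (Finset.mem_filter.1 (ht f ha)).2
    have h2 := (Finset.mem_filter.1 (ht f' ha')).2
    exact hff' (Subtype.ext (h1.symm.trans h2))
  have hcard : (Finset.univ.biUnion t).card = ∑ f, u f := by
    rw [Finset.card_biUnion hdisj]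
    exact Finset.sum_congr rfl fun f _ => htc f
  refine ⟨Finset.univ.biUnion t, ?_, ?_, ?_, ?_⟩
  · exact Finset.biUnion_subset.2 fun f _ => (ht f).trans (Finset.filter_subset _ _)
  · rw [← Finset.card_pos, hcard]
    obtain ⟨f, hf⟩ := Function.ne_iff.1 hu.prop.1
    exact (Nat.pos_of_ne_zero hf).trans_le (Finset.single_le_sum (fun _ _ => Nat.zero_le _)
      (Finset.mem_univ f))
  · rw [hcard]
    exact Finset.le_sup (f := fun v : F → ℕ => ∑ f, v f) (hfin.mem_toFinset.2 hu)
  · rw [Finset.sum_biUnion hdisj, ← hu.prop.2]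
    refine Finset.sum_congr rfl fun f _ => ?_
    rw [Finset.sum_congr rfl (fun c hc => (Finset.mem_filter.1 (ht f hc)).2), Finset.sum_const,
      nsmul_eq_mul, htc]

section Matching

variable {X X' : Type*} {N : ℕ → X → Set X} {N' : ℕ → X' → Set X'} {m : Set X → ℝ}
  {m' : Set X' → ℝ}

/-- `Q` partitions `A` and `B` simultaneously into matched pieces of equal weight, saturated at
level `k + K` and contained in cells of level `k`. -/
structure IsMatching (N : ℕ → X → Set X) (N' : ℕ → X' → Set X') (m : Set X → ℝ) (m' : Set X' → ℝ)
    (k K : ℕ) (A : Set X) (B : Set X') (Q : Set (Set X × Set X')) : Prop where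
  ne1 : ∀ q ∈ Q, q.1.Nonempty
  ne2 : ∀ q ∈ Q, q.2.Nonempty
  sat1 : ∀ q ∈ Q, Sat N (k + K) q.1
  sat2 : ∀ q ∈ Q, Sat N' (k + K) q.2
  small1 : ∀ q ∈ Q, ∃ x, q.1 ⊆ N k x
  small2 : ∀ q ∈ Q, ∃ x, q.2 ⊆ N' k x
  weight : ∀ q ∈ Q, m q.1 = m' q.2
  sub1 : ∀ q ∈ Q, q.1 ⊆ A
  sub2 : ∀ q ∈ Q, q.2 ⊆ B
  cov1 : ∀ x ∈ A, ∃ q ∈ Q, x ∈ q.1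
  cov2 : ∀ x ∈ B, ∃ q ∈ Q, x ∈ q.2
  disj1 : ∀ q ∈ Q, ∀ q₂ ∈ Q, ∀ x, x ∈ q.1 → x ∈ q₂.1 → q = q₂
  disj2 : ∀ q ∈ Q, ∀ q₂ ∈ Q, ∀ x, x ∈ q.2 → x ∈ q₂.2 → q = q₂

/-- There is a matching of `A` and `B`. -/
def Matchable (N : ℕ → X → Set X) (N' : ℕ → X' → Set X') (m : Set X → ℝ) (m' : Set X' → ℝ)
    (k K : ℕ) (A : Set X) (B : Set X') : Prop := ∃ Q, IsMatching N N' m m' k K A B Q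

namespace Matchable

lemma empty (k K : ℕ) : Matchable N N' m m' k K ∅ ∅ := ⟨∅, by constructor <;> simp⟩

lemma single {k K : ℕ} {A : Set X} {B : Set X'} (hA : A.Nonempty) (hB : B.Nonempty)
    (hsA : Sat N (k + K) A) (hsB : Sat N' (k + K) B) (hxA : ∃ x, A ⊆ N k x)
    (hxB : ∃ x, B ⊆ N' k x) (hm : m A = m' B) : Matchable N N' m m' k K A B :=
  ⟨{(A, B)}, by constructor <;> simp_all⟩

lemma union {k K : ℕ} {A C : Set X} {B D : Set X'} (h1 : Matchable N N' m m' k K A B)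
    (h2 : Matchable N N' m m' k K C D) (hAC : Disjoint A C) (hBD : Disjoint B D) :
    Matchable N N' m m' k K (A ∪ C) (B ∪ D) := by
  obtain ⟨Q, hQ⟩ := h1
  obtain ⟨R, hR⟩ := h2
  refine ⟨Q ∪ R, ⟨?_, ?_, ?_, ?_, ?_, ?_, ?_, ?_, ?_, ?_, ?_, ?_, ?_⟩⟩
  · exact fun q hq => hq.elim (hQ.ne1 q) (hR.ne1 q)
  · exact fun q hq => hq.elim (hQ.ne2 q) (hR.ne2 q)
  · exact fun q hq => hq.elim (hQ.sat1 q) (hR.sat1 q)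
  · exact fun q hq => hq.elim (hQ.sat2 q) (hR.sat2 q)
  · exact fun q hq => hq.elim (hQ.small1 q) (hR.small1 q)
  · exact fun q hq => hq.elim (hQ.small2 q) (hR.small2 q)
  · exact fun q hq => hq.elim (hQ.weight q) (hR.weight q)
  · exact fun q hq => hq.elim (fun h => (hQ.sub1 q h).trans subset_union_left)
      (fun h => (hR.sub1 q h).trans subset_union_right)
  · exact fun q hq => hq.elim (fun h => (hQ.sub2 q h).trans subset_union_left)
      (fun h => (hR.sub2 q h).trans subset_union_right)
  · rintro x (hx | hx)
    · obtain ⟨q, hq, h⟩ := hQ.cov1 x hx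
      exact ⟨q, Or.inl hq, h⟩
    · obtain ⟨q, hq, h⟩ := hR.cov1 x hx
      exact ⟨q, Or.inr hq, h⟩
  · rintro x (hx | hx)
    · obtain ⟨q, hq, h⟩ := hQ.cov2 x hx
      exact ⟨q, Or.inl hq, h⟩
    · obtain ⟨q, hq, h⟩ := hR.cov2 x hx
      exact ⟨q, Or.inr hq, h⟩
  · rintro q (hq | hq) q' (hq' | hq') x hx hx'
    · exact hQ.disj1 q hq q' hq' x hx hx'
    · exact (disjoint_left.1 hAC (hQ.sub1 q hq hx) (hR.sub1 q' hq' hx')).elim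
    · exact (disjoint_left.1 hAC (hQ.sub1 q' hq' hx') (hR.sub1 q hq hx)).elim
    · exact hR.disj1 q hq q' hq' x hx hx'
  · rintro q (hq | hq) q' (hq' | hq') x hx hx'
    · exact hQ.disj2 q hq q' hq' x hx hx'
    · exact (disjoint_left.1 hBD (hQ.sub2 q hq hx) (hR.sub2 q' hq' hx')).elim
    · exact (disjoint_left.1 hBD (hQ.sub2 q' hq' hx') (hR.sub2 q hq hx)).elim
    · exact hR.disj2 q hq q' hq' x hx hx'

lemma mono (hN : IsTree N) (hN' : IsTree N') {k K L : ℕ} (hKL : K ≤ L) {A : Set X} {B : Set X'}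
    (h : Matchable N N' m m' k K A B) : Matchable N N' m m' k L A B := by
  obtain ⟨Q, hQ⟩ := h
  exact ⟨Q, { hQ with
    sat1 := fun q hq => hN.sat_mono (by omega) (hQ.sat1 q hq)
    sat2 := fun q hq => hN'.sat_mono (by omega) (hQ.sat2 q hq) }⟩

end Matchable

/-- A list of pairwise disjoint pieces of cells of level `k`, with weights in `p ^ k • Y`. -/
structure Pieces (N : ℕ → X → Set X) (m : Set X → ℝ) (p : ℝ) (k K : ℕ) (Y : Finset ℝ)
    (l : List (Set X)) : Prop where
  sat : ∀ A ∈ l, Sat N (k + K) A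
  small : ∀ A ∈ l, ∃ x, A ⊆ N k x
  val : ∀ A ∈ l, ∃ y ∈ Y, m A = p ^ k * y
  disj : l.Pairwise Disjoint

/-- The union of a list of sets. -/
def lunion (l : List (Set X)) : Set X := l.foldr (· ∪ ·) ∅

lemma disjoint_lunion {A : Set X} {l : List (Set X)} (h : ∀ B ∈ l, Disjoint A B) :
    Disjoint A (lunion l) := by
  induction l with
  | nil => simp [lunion]
  | cons B l ih =>
    exact (h B (by simp)).union_right (ih fun C hC => h C (by simp [hC]))

lemma lunion_eq_sUnion (l : List (Set X)) : lunion l = ⋃₀ {A | A ∈ l} := by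
  induction l with
  | nil => simp [lunion]
  | cons B l ih =>
    have : lunion (B :: l) = B ∪ lunion l := rfl
    rw [this, ih]
    ext x
    simp

variable {p : ℝ} {I : AddSubgroup ℝ} {W W' : Finset ℝ} {σ σ' : ℝ}

lemma Pieces.tail {k K : ℕ} {Y : Finset ℝ} {A : Set X} {l : List (Set X)}
    (h : Pieces N m p k K Y (A :: l)) : Pieces N m p k K Y l :=
  ⟨fun B hB => h.sat B (by simp [hB]), fun B hB => h.small B (by simp [hB]),
    fun B hB => h.val B (by simp [hB]), h.disj.of_cons⟩

lemma Pieces.mono (hN : IsTree N) {k K L : ℕ} (hKL : K ≤ L) {Y Z : Finset ℝ} (hYZ : Y ⊆ Z)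
    {l : List (Set X)} (h : Pieces N m p k K Y l) : Pieces N m p k L Z l :=
  ⟨fun B hB => hN.sat_mono (by omega) (h.sat B hB), h.small,
    fun B hB => by
      obtain ⟨y, hy, h'⟩ := h.val B hB
      exact ⟨y, hYZ hy, h'⟩, h.disj⟩

lemma Pieces.sum_nonneg {k K : ℕ} {Y : Finset ℝ} {l : List (Set X)} (hp : 0 < p)
    (hY : ∀ y ∈ Y, 0 < y) (h : Pieces N m p k K Y l) : 0 ≤ (l.map m).sum := by
  refine List.sum_nonneg fun x hx => ?_
  obtain ⟨A, hA, rfl⟩ := List.mem_map.1 hx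
  obtain ⟨y, hy, h'⟩ := h.val A hA
  rw [h']
  exact (mul_pos (pow_pos hp _) (hY y hy)).le

lemma Pieces.head_pos {k K : ℕ} {Y : Finset ℝ} {A : Set X} {l : List (Set X)} (hp : 0 < p)
    (hY : ∀ y ∈ Y, 0 < y) (h : Pieces N m p k K Y (A :: l)) : 0 < m A := by
  obtain ⟨y, hy, h'⟩ := h.val A (by simp)
  rw [h']
  exact mul_pos (pow_pos hp _) (hY y hy)

lemma Full.nonempty_of_pos (b : Full N p m I W σ) {A : Set X} (h : 0 < m A) : A.Nonempty := by
  rw [nonempty_iff_ne_empty]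
  rintro rfl
  rw [b.add.empty] at h
  exact lt_irrefl _ h

/-- Cutting off a part of the head of a list of pieces. -/
lemma Pieces.cut_head (b : Full N p m I W σ) {k K0 K1 : ℕ} (hK : K0 ≤ K1) {Y : Finset ℝ}
    {A A' : Set X} {l : List (Set X)}
    (h : Pieces N m p k K0 Y (A :: l)) (hA' : A' ⊆ A) (hs : Sat N (k + K1) A') {y : ℝ}
    (hy : y ∈ Y) (hm : m A' = p ^ k * y) (hlt : m A' < m A) :
    Pieces N m p k K1 (Y ∪ ((Y ×ˢ Y).image fun z => z.1 - z.2).filter (0 < ·))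
      ((A \ A') :: l) := by
  have hsA : Sat N (k + K1) A := b.tree.sat_mono (by omega) (h.sat A (by simp))
  have ht := h.tail.mono b.tree hK
    (Finset.subset_union_left : Y ⊆ (Y ∪ ((Y ×ˢ Y).image fun z => z.1 - z.2).filter (0 < ·)))
  refine ⟨?_, ?_, ?_, ?_⟩
  · intro B hB
    rcases List.mem_cons.1 hB with rfl | hB
    · exact b.tree.sat_diff hsA hs
    · exact ht.sat B hB
  · intro B hB
    rcases List.mem_cons.1 hB with rfl | hB
    · obtain ⟨x, hx⟩ := h.small A (by simp)
      exact ⟨x, sdiff_subset.trans hx⟩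
    · exact ht.small B hB
  · intro B hB
    rcases List.mem_cons.1 hB with rfl | hB
    · obtain ⟨z, hz, hzA⟩ := h.val A (by simp)
      refine ⟨z - y, ?_, ?_⟩
      · refine Finset.mem_union_right _ (Finset.mem_filter.2 ⟨?_, ?_⟩)
        · exact Finset.mem_image.2 ⟨(z, y), Finset.mem_product.2 ⟨hz, hy⟩, rfl⟩
        · rw [hm, hzA] at hlt
          have := lt_of_mul_lt_mul_left hlt (pow_pos b.p_pos k).le
          linarith
      · rw [b.add.diff b.tree hsA hs hA', hm, hzA]
        ring
    · exact ht.val B hB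
  · refine List.pairwise_cons.2 ⟨fun B hB => ?_, ht.disj⟩
    exact (List.rel_of_pairwise_cons h.disj hB).mono_left sdiff_subset

lemma match_lists (b : Full N p m I W σ) (b' : Full N' p m' I W' σ') (n : ℕ) :
    ∀ (Y : Finset ℝ) (_ : ∀ y ∈ Y, 0 < y) (K0 : ℕ), ∃ K ≥ K0, ∀ k (l : List (Set X))
      (l' : List (Set X')), Pieces N m p k K0 Y l → Pieces N' m' p k K0 Y l' →
      l.length + l'.length ≤ n → (l.map m).sum = (l'.map m').sum →
      Matchable N N' m m' k K (lunion l) (lunion l') := by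
  induction n with
  | zero =>
    intro Y _ K0
    refine ⟨K0, le_rfl, fun k l l' _ _ hlen _ => ?_⟩
    have h1 : l = [] := List.length_eq_zero_iff.1 (by omega)
    have h2 : l' = [] := List.length_eq_zero_iff.1 (by omega)
    subst h1 h2
    exact Matchable.empty k K0
  | succ n ih =>
    intro Y hY K0
    obtain ⟨K1, hK1, hcut⟩ := b.exists_cut_finset Y hY K0
    obtain ⟨K1', hK1', hcut'⟩ := b'.exists_cut_finset Y hY K0
    set Z := Y ∪ ((Y ×ˢ Y).image fun z => z.1 - z.2).filter (0 < ·) with hZdef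
    have hYZ : Y ⊆ Z := Finset.subset_union_left
    have hZ : ∀ y ∈ Z, 0 < y := by
      intro y hy
      rcases Finset.mem_union.1 hy with hy | hy
      · exact hY y hy
      · exact (Finset.mem_filter.1 hy).2
    obtain ⟨K, hK, hIH⟩ := ih Z hZ (max K1 K1')
    have hp := b.p_pos
    refine ⟨K, by omega, fun k l l' hl hl' hlen hsum => ?_⟩
    rcases l with _ | ⟨A, l⟩
    · rcases l' with _ | ⟨B, l'⟩
      · exact Matchable.empty k K
      · have := hl'.head_pos hp hY
        have := hl'.tail.sum_nonneg hp hY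
        simp only [List.map_nil, List.sum_nil, List.map_cons, List.sum_cons] at hsum
        linarith
    rcases l' with _ | ⟨B, l'⟩
    · have := hl.head_pos hp hY
      have := hl.tail.sum_nonneg hp hY
      simp only [List.map_nil, List.sum_nil, List.map_cons, List.sum_cons] at hsum
      linarith
    simp only [List.map_cons, List.sum_cons, List.length_cons] at hsum hlen
    have hApos := hl.head_pos hp hY
    have hBpos := hl'.head_pos hp hY
    have hdA : Disjoint A (lunion l) := disjoint_lunion fun C hC => List.rel_of_pairwise_cons hl.disj hC
    have hdB : Disjoint B (lunion l') :=
      disjoint_lunion fun C hC => List.rel_of_pairwise_cons hl'.disj hC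
    have hsA := hl.sat A (by simp)
    have hsB := hl'.sat B (by simp)
    obtain ⟨xA, hxA⟩ := hl.small A (by simp)
    obtain ⟨xB, hxB⟩ := hl'.small B (by simp)
    change Matchable N N' m m' k K (A ∪ lunion l) (B ∪ lunion l')
    rcases lt_trichotomy (m A) (m' B) with hlt | heq | hlt
    · obtain ⟨y, hy, hval⟩ := hl.val A (by simp)
      have hyI : y ∈ I := b.mem_of_pow_mul k (by rw [← hval]; exact b.mem _ _ hsA)
      obtain ⟨B', hB', hs, hm⟩ := hcut' y hy hyI k B hsB (by rw [← hval]; exact hlt)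
      have h1 : Matchable N N' m m' k K A B' := Matchable.single (b.nonempty_of_pos hApos)
        (b'.nonempty_of_pos (by rw [hm, ← hval]; exact hApos))
        (b.tree.sat_mono (by omega) hsA) (b'.tree.sat_mono (by omega) hs) ⟨xA, hxA⟩
        ⟨xB, hB'.trans hxB⟩ (hval.trans hm.symm)
      have hl2 := hl'.cut_head b' hK1' hB' hs hy hm (by rw [hm, ← hval]; exact hlt)
      have h2 := hIH k l ((B \ B') :: l') (hl.tail.mono b.tree (by omega) hYZ)
        (hl2.mono b'.tree (le_max_right _ _) subset_rfl)
        (by simp only [List.length_cons]; omega)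
        (by
          simp only [List.map_cons, List.sum_cons]
          rw [b'.add.diff b'.tree (b'.tree.sat_mono (by omega : k + K0 ≤ k + K1') hsB) hs hB', hm,
            ← hval]
          linarith)
      have h3 := h1.union h2 hdA (by
        change Disjoint B' ((B \ B') ∪ lunion l')
        exact disjoint_sdiff_right.union_right (hdB.mono_left hB'))
      convert h3 using 1
      change _ = B' ∪ ((B \ B') ∪ lunion l')
      rw [← union_assoc, union_sdiff_cancel hB']
    · refine (Matchable.single (b.nonempty_of_pos hApos) (b'.nonempty_of_pos hBpos)
        (b.tree.sat_mono (by omega) hsA) (b'.tree.sat_mono (by omega) hsB) ⟨xA, hxA⟩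
        ⟨xB, hxB⟩ heq).union ?_ hdA hdB
      exact hIH k l l' (hl.tail.mono b.tree (by omega) hYZ) (hl'.tail.mono b'.tree (by omega) hYZ)
        (by omega) (by linarith)
    · obtain ⟨y, hy, hval⟩ := hl'.val B (by simp)
      have hyI : y ∈ I := b'.mem_of_pow_mul k (by rw [← hval]; exact b'.mem _ _ hsB)
      obtain ⟨A', hA', hs, hm⟩ := hcut y hy hyI k A hsA (by rw [← hval]; exact hlt)
      have h1 : Matchable N N' m m' k K A' B := Matchable.single
        (b.nonempty_of_pos (by rw [hm, ← hval]; exact hBpos)) (b'.nonempty_of_pos hBpos)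
        (b.tree.sat_mono (by omega) hs) (b'.tree.sat_mono (by omega) hsB) ⟨xA, hA'.trans hxA⟩
        ⟨xB, hxB⟩ (hm.trans hval.symm)
      have hl2 := hl.cut_head b hK1 hA' hs hy hm (by rw [hm, ← hval]; exact hlt)
      have h2 := hIH k ((A \ A') :: l) l' (hl2.mono b.tree (le_max_left _ _) subset_rfl)
        (hl'.tail.mono b'.tree (by omega) hYZ)
        (by simp only [List.length_cons]; omega)
        (by
          simp only [List.map_cons, List.sum_cons]
          rw [b.add.diff b.tree (b.tree.sat_mono (by omega : k + K0 ≤ k + K1) hsA) hs hA', hm,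
            ← hval]
          linarith)
      have h3 := h1.union h2 (by
        change Disjoint A' ((A \ A') ∪ lunion l)
        exact disjoint_sdiff_right.union_right (hdA.mono_left hA')) hdB
      convert h3 using 1
      change _ = A' ∪ ((A \ A') ∪ lunion l)
      rw [← union_assoc, union_sdiff_cancel hA']

lemma pieces_of_cells (b : Base N p m I W σ) {k : ℕ} {A : Set X} {s : Finset (Set X)}
    (hs : s ⊆ b.tree.cells k A) {Y : Finset ℝ} (hY : W ⊆ Y) : Pieces N m p k 0 Y s.toList := by
  refine ⟨?_, ?_, ?_, ?_⟩
  · exact fun c hc => b.tree.sat_of_mem_cells (hs (Finset.mem_toList.1 hc))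
  · intro c hc
    obtain ⟨x, _, h⟩ := b.tree.mem_cells.1 (hs (Finset.mem_toList.1 hc))
    exact ⟨x, h.superset⟩
  · intro c hc
    obtain ⟨x, _, rfl⟩ := b.tree.mem_cells.1 (hs (Finset.mem_toList.1 hc))
    obtain ⟨w, hw, h⟩ := b.wt k x
    exact ⟨w, hY hw, h⟩
  · have hnd := s.nodup_toList
    rw [List.Nodup] at hnd
    refine hnd.imp_of_mem fun {c d} hc hd hcd => ?_
    exact b.tree.cells_disjoint (hs (Finset.mem_toList.1 hc)) (hs (Finset.mem_toList.1 hd)) hcd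

/-- Saturated sets of level `k` and equal weights are matchable with uniform loss. -/
lemma exists_match (b : Full N p m I W σ) (b' : Full N' p m' I W' σ') :
    ∃ K, 0 < K ∧ ∀ k A B, Sat N k A → Sat N' k B → m A = m' B → Matchable N N' m m' k K A B := by
  classical
  have hp := b.p_pos
  obtain ⟨n, hn⟩ := exists_zero_sum_bound (W ∪ W'.image fun w => -w) (Set X ⊕ Set X')
  obtain ⟨K, -, hK⟩ := match_lists b b' n (W ∪ W') (fun y hy => (Finset.mem_union.1 hy).elim
    (b.W_pos y) (b'.W_pos y)) 0
  suffices H : ∀ M k A B, Sat N k A → Sat N' k B → m A = m' B →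
      (b.tree.cells k A).card + (b'.tree.cells k B).card ≤ M → Matchable N N' m m' k K A B by
    refine ⟨K + 1, Nat.succ_pos _, fun k A B hA hB hAB => ?_⟩
    exact (H _ k A B hA hB hAB le_rfl).mono b.tree b'.tree (Nat.le_succ K)
  intro M
  induction M with
  | zero =>
    intro k A B hA hB _ hc
    have h1 : b.tree.cells k A = ∅ := Finset.card_eq_zero.1 (by omega)
    have h2 : b'.tree.cells k B = ∅ := Finset.card_eq_zero.1 (by omega)
    rw [← b.tree.sUnion_cells hA, ← b'.tree.sUnion_cells hB, h1, h2]
    simpa using Matchable.empty k K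
  | succ M ih =>
    intro k A B hA hB hAB hc
    set s := b.tree.cells k A with hs
    set t := b'.tree.cells k B with ht
    by_cases hne : (s.disjSum t).Nonempty
    swap
    · rw [Finset.not_nonempty_iff_eq_empty] at hne
      have h0 := congrArg Finset.card hne
      rw [Finset.card_disjSum, Finset.card_empty] at h0
      exact ih k A B hA hB hAB (by rw [← hs, ← ht]; omega)
    have hpk := pow_pos hp k
    let g : Set X ⊕ Set X' → ℝ := Sum.elim (fun c => m c / p ^ k) (fun c => -(m' c / p ^ k))
    have hsumg : ∀ (u : Finset (Set X)) (v : Finset (Set X')), ∑ a ∈ u.disjSum v, g a =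
        (∑ c ∈ u, m c - ∑ c ∈ v, m' c) / p ^ k := by
      intro u v
      rw [Finset.sum_disjSum, sub_div, Finset.sum_div, Finset.sum_div, sub_eq_add_neg,
        ← Finset.sum_neg_distrib]
      rfl
    obtain ⟨z, hz, hzne, hzc, hz0⟩ := hn (s.disjSum t) g (by
      rintro (c | c) hc
      · rw [Finset.inl_mem_disjSum] at hc
        obtain ⟨x, _, rfl⟩ := b.tree.mem_cells.1 hc
        obtain ⟨w, hw, h⟩ := b.wt k x
        refine Finset.mem_union_left _ ?_
        have : g (Sum.inl (N k x)) = w := by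
          change m (N k x) / p ^ k = w
          rw [h]; field_simp
        rwa [this]
      · rw [Finset.inr_mem_disjSum] at hc
        obtain ⟨x, _, rfl⟩ := b'.tree.mem_cells.1 hc
        obtain ⟨w, hw, h⟩ := b'.wt k x
        refine Finset.mem_union_right _ (Finset.mem_image.2 ⟨w, hw, ?_⟩)
        change -w = -(m' (N' k x) / p ^ k)
        rw [h]; field_simp)
      (by rw [hsumg, ← b.add.cells b.tree hA, ← b'.add.cells b'.tree hB, hAB, sub_self, zero_div])
      hne
    obtain ⟨u, v, rfl⟩ : ∃ u v, z = Finset.disjSum u v :=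
      ⟨z.toLeft, z.toRight, Finset.toLeft_disjSum_toRight.symm⟩
    have hu : u ⊆ s := fun c hc => by
      simpa using hz (Finset.inl_mem_disjSum.2 hc)
    have hv : v ⊆ t := fun c hc => by
      simpa using hz (Finset.inr_mem_disjSum.2 hc)
    rw [hsumg, div_eq_zero_iff, or_iff_left hpk.ne', sub_eq_zero] at hz0
    rw [Finset.card_disjSum] at hzc
    have hmatch := hK k u.toList v.toList
      (pieces_of_cells b.toBase hu Finset.subset_union_left)
      (pieces_of_cells b'.toBase hv Finset.subset_union_right)
      (by simpa using hzc) (by simpa using hz0)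
    rw [lunion_eq_sUnion, lunion_eq_sUnion] at hmatch
    simp only [Finset.mem_toList] at hmatch
    set U := ⋃₀ {c | c ∈ u} with hU
    set V := ⋃₀ {c | c ∈ v} with hV
    have hUs : Sat N k U := IsTree.sat_sUnion fun c hc => b.tree.sat_of_mem_cells (hu hc)
    have hVs : Sat N' k V := IsTree.sat_sUnion fun c hc => b'.tree.sat_of_mem_cells (hv hc)
    have hUA : U ⊆ A := sUnion_subset fun c hc => b.tree.subset_of_mem_cells hA (hu hc)
    have hVB : V ⊆ B := sUnion_subset fun c hc => b'.tree.subset_of_mem_cells hB (hv hc)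
    have hmU : m U = ∑ c ∈ u, m c := b.add.sUnion (k := k) u
      (fun c hc => b.tree.sat_of_mem_cells (hu hc)) (b.tree.cells_disjoint.subset (by exact_mod_cast hu))
    have hmV : m' V = ∑ c ∈ v, m' c := b'.add.sUnion (k := k) v
      (fun c hc => b'.tree.sat_of_mem_cells (hv hc)) (b'.tree.cells_disjoint.subset (by exact_mod_cast hv))
    have hcu : b.tree.cells k (A \ U) ⊆ s \ u := by
      intro c hc
      obtain ⟨x, hx, rfl⟩ := b.tree.mem_cells.1 hc
      rw [Finset.mem_sdiff]
      exact ⟨b.tree.mem_cells.2 ⟨x, hx.1, rfl⟩, fun h => hx.2 ⟨_, h, b.tree.self k x⟩⟩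
    have hcv : b'.tree.cells k (B \ V) ⊆ t \ v := by
      intro c hc
      obtain ⟨x, hx, rfl⟩ := b'.tree.mem_cells.1 hc
      rw [Finset.mem_sdiff]
      exact ⟨b'.tree.mem_cells.2 ⟨x, hx.1, rfl⟩, fun h => hx.2 ⟨_, h, b'.tree.self k x⟩⟩
    have h1 := Finset.card_le_card hcu
    have h2 := Finset.card_le_card hcv
    rw [Finset.card_sdiff_of_subset hu] at h1
    rw [Finset.card_sdiff_of_subset hv] at h2
    have h3 := Finset.card_le_card hu
    have h4 := Finset.card_le_card hv
    have h5 := Finset.card_pos.2 hzne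
    rw [Finset.card_disjSum] at h5
    have hrest := ih k (A \ U) (B \ V) (b.tree.sat_diff hA hUs) (b'.tree.sat_diff hB hVs)
      (by rw [b.add.diff b.tree hA hUs hUA, b'.add.diff b'.tree hB hVs hVB, hAB, hmU, hmV, hz0])
      (by omega)
    have := hmatch.union hrest disjoint_sdiff_right disjoint_sdiff_right
    rwa [union_sdiff_cancel hUA, union_sdiff_cancel hVB] at this

end Matching

end

section

/-- The cells of level `k` have diameter at most `C * r ^ k` and distance at least `δ * r ^ k`. -/
structure IsMetricTree {X : Type*} [MetricSpace X] (N : ℕ → X → Set X) (r δ C : ℝ) : Prop where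
  r_pos : 0 < r
  r_lt : r < 1
  δ_pos : 0 < δ
  C_pos : 0 < C
  dist_le : ∀ k x y, y ∈ N k x → dist x y ≤ C * r ^ k
  le_dist : ∀ k x y, y ∉ N k x → δ * r ^ k ≤ dist x y

lemma IsMetricTree.isClosed {X : Type*} [MetricSpace X] {N : ℕ → X → Set X} {r δ C : ℝ}
    (h : IsMetricTree N r δ C) {k : ℕ} {A : Set X} (hA : Sat N k A) :
    IsClosed A := by
  rw [← isOpen_compl_iff, Metric.isOpen_iff]
  intro x hx
  refine ⟨δ * r ^ k, mul_pos h.δ_pos (pow_pos h.r_pos k), fun y hy hyA => ?_⟩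
  rw [mem_ball] at hy
  have : x ∉ N k y := fun hxy => hx (hA y hyA hxy)
  exact absurd (h.le_dist k y x this) (not_le.2 hy)

/-- A refining sequence of simultaneous partitions of two spaces. -/
structure IsMatchSys {X X' : Type*} (N : ℕ → X → Set X) (N' : ℕ → X' → Set X') (K : ℕ)
    (Q : ℕ → Set (Set X × Set X')) : Prop where
  sat1 : ∀ j, ∀ q ∈ Q j, Sat N (j * K) q.1
  sat2 : ∀ j, ∀ q ∈ Q j, Sat N' (j * K) q.2
  ne1 : ∀ j, ∀ q ∈ Q j, q.1.Nonempty
  ne2 : ∀ j, ∀ q ∈ Q j, q.2.Nonempty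
  small1 : ∀ j, ∀ q ∈ Q (j + 1), ∃ x, q.1 ⊆ N (j * K) x
  small2 : ∀ j, ∀ q ∈ Q (j + 1), ∃ x, q.2 ⊆ N' (j * K) x
  cov1 : ∀ j x, ∃ q ∈ Q j, x ∈ q.1
  cov2 : ∀ j x, ∃ q ∈ Q j, x ∈ q.2
  disj1 : ∀ j, ∀ q ∈ Q j, ∀ q' ∈ Q j, ∀ x, x ∈ q.1 → x ∈ q'.1 → q = q'
  disj2 : ∀ j, ∀ q ∈ Q j, ∀ q' ∈ Q j, ∀ x, x ∈ q.2 → x ∈ q'.2 → q = q'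
  ref : ∀ j, ∀ q ∈ Q (j + 1), ∃ q' ∈ Q j, q.1 ⊆ q'.1 ∧ q.2 ⊆ q'.2

/-- The points `x` and `y` lie in matched sets at every stage. -/
def MatchRel {X X' : Type*} (Q : ℕ → Set (Set X × Set X')) (x : X) (y : X') : Prop :=
  ∀ j, ∃ q ∈ Q j, x ∈ q.1 ∧ y ∈ q.2

namespace IsMatchSys

variable {X X' : Type*} {N : ℕ → X → Set X} {N' : ℕ → X' → Set X'} {K : ℕ}
  {Q : ℕ → Set (Set X × Set X')} (h : IsMatchSys N N' K Q)
include h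

lemma swap : IsMatchSys N' N K fun j => Prod.swap '' Q j := by
  refine ⟨?_, ?_, ?_, ?_, ?_, ?_, ?_, ?_, ?_, ?_, ?_⟩
  · rintro j _ ⟨q, hq, rfl⟩; exact h.sat2 j q hq
  · rintro j _ ⟨q, hq, rfl⟩; exact h.sat1 j q hq
  · rintro j _ ⟨q, hq, rfl⟩; exact h.ne2 j q hq
  · rintro j _ ⟨q, hq, rfl⟩; exact h.ne1 j q hq
  · rintro j _ ⟨q, hq, rfl⟩; exact h.small2 j q hq
  · rintro j _ ⟨q, hq, rfl⟩; exact h.small1 j q hq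
  · intro j x
    obtain ⟨q, hq, hx⟩ := h.cov2 j x
    exact ⟨_, ⟨q, hq, rfl⟩, hx⟩
  · intro j x
    obtain ⟨q, hq, hx⟩ := h.cov1 j x
    exact ⟨_, ⟨q, hq, rfl⟩, hx⟩
  · rintro j _ ⟨q, hq, rfl⟩ _ ⟨q', hq', rfl⟩ x hx hx'
    rw [h.disj2 j q hq q' hq' x hx hx']
  · rintro j _ ⟨q, hq, rfl⟩ _ ⟨q', hq', rfl⟩ x hx hx'
    rw [h.disj1 j q hq q' hq' x hx hx']
  · rintro j _ ⟨q, hq, rfl⟩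
    obtain ⟨q', hq', h1, h2⟩ := h.ref j q hq
    exact ⟨_, ⟨q', hq', rfl⟩, h2, h1⟩

omit h in
lemma rel_swap {x : X} {y : X'} : MatchRel (fun j => Prod.swap '' Q j) y x ↔ MatchRel Q x y := by
  refine forall_congr' fun j => ⟨?_, ?_⟩
  · rintro ⟨_, ⟨q, hq, rfl⟩, h1, h2⟩
    exact ⟨q, hq, h2, h1⟩
  · rintro ⟨q, hq, h1, h2⟩
    exact ⟨_, ⟨q, hq, rfl⟩, h2, h1⟩

lemma total [MetricSpace X'] [CompactSpace X'] {r δ C : ℝ}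
    (hm : IsMetricTree N' r δ C) (x : X) : ∃ y, MatchRel Q x y := by
  have hc := fun j => h.cov1 j x
  choose q hq hx using hc
  have hmono : ∀ j, (q (j + 1)).2 ⊆ (q j).2 := by
    intro j
    obtain ⟨q', hq', h1, h2⟩ := h.ref j _ (hq (j + 1))
    rw [h.disj1 j (q j) (hq j) q' hq' x (hx j) (h1 (hx (j + 1)))]
    exact h2
  obtain ⟨y, hy⟩ := IsCompact.nonempty_iInter_of_sequence_nonempty_isCompact_isClosed
    (fun j => (q j).2) hmono (fun j => h.ne2 j _ (hq j))
    (hm.isClosed (h.sat2 0 _ (hq 0))).isCompact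
    (fun j => hm.isClosed (h.sat2 j _ (hq j)))
  exact ⟨y, fun j => ⟨q j, hq j, hx j, mem_iInter.1 hy j⟩⟩

lemma dist_le_of_mem [MetricSpace X] {r δ C : ℝ} (hN : IsTree N)
    (hm : IsMetricTree N r δ C) {j : ℕ} {q : Set X × Set X'} (hq : q ∈ Q (j + 1)) {x y : X}
    (hx : x ∈ q.1) (hy : y ∈ q.1) : dist x y ≤ C * r ^ (j * K) := by
  obtain ⟨z, hz⟩ := h.small1 j q hq
  apply hm.dist_le
  rw [hN.eq _ z x (hz hx)]
  exact hz hy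

lemma eq_of_mem [MetricSpace X] {r δ C : ℝ} (hK : 0 < K) (hN : IsTree N)
    (hm : IsMetricTree N r δ C) {x y : X} (hxy : ∀ j, ∃ q ∈ Q j, x ∈ q.1 ∧ y ∈ q.1) : x = y := by
  have hlim : Filter.Tendsto (fun j => C * (r ^ K) ^ j) Filter.atTop (nhds (C * 0)) :=
    (tendsto_pow_atTop_nhds_zero_of_lt_one (pow_pos hm.r_pos K).le
      (pow_lt_one₀ hm.r_pos.le hm.r_lt hK.ne')).const_mul C
  rw [mul_zero] at hlim
  refine dist_le_zero.1 (ge_of_tendsto' hlim fun j => ?_)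
  obtain ⟨q, hq, h1, h2⟩ := hxy (j + 1)
  rw [← pow_mul, mul_comm K j]
  exact h.dist_le_of_mem hN hm hq h1 h2

lemma eq_of_rel [MetricSpace X] {r δ C : ℝ} (hK : 0 < K) (hN : IsTree N)
    (hm : IsMetricTree N r δ C) {x y : X} {z : X'} (hx : MatchRel Q x z) (hy : MatchRel Q y z) :
    x = y := by
  refine h.eq_of_mem hK hN hm fun j => ?_
  obtain ⟨q, hq, h1, h2⟩ := hx j
  obtain ⟨q', hq', h1', h2'⟩ := hy j
  obtain rfl := h.disj2 j q hq q' hq' z h2 h2'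
  exact ⟨q, hq, h1, h1'⟩

lemma dist_le [MetricSpace X] [MetricSpace X'] [CompactSpace X'] {r δ δ' C C' : ℝ} (hK : 0 < K)
    (hN : IsTree N) (hN' : IsTree N') (hm : IsMetricTree N r δ C) (hm' : IsMetricTree N' r δ' C') :
    ∃ L, 0 < L ∧ ∀ x₁ x₂ y₁ y₂, MatchRel Q x₁ y₁ → MatchRel Q x₂ y₂ →
      dist y₁ y₂ ≤ L * dist x₁ x₂ := by
  set D := C' + diam (univ : Set X') with hD
  have hDpos : 0 < D := add_pos_of_pos_of_nonneg hm'.C_pos diam_nonneg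
  have hr := hm.r_pos
  refine ⟨D / (δ * r ^ (2 * K)), div_pos hDpos (mul_pos hm.δ_pos (pow_pos hr _)),
    fun x₁ x₂ y₁ y₂ h1 h2 => ?_⟩
  classical
  by_cases hall : ∀ j, ∃ q ∈ Q j, x₁ ∈ q.1 ∧ x₂ ∈ q.1
  · obtain rfl := h.eq_of_mem hK hN hm hall
    obtain rfl := h.swap.eq_of_rel hK hN' hm' (rel_swap.2 h1) (rel_swap.2 h2)
    simp
  push Not at hall
  have hex : ∃ j, ¬ ∃ q ∈ Q j, x₁ ∈ q.1 ∧ x₂ ∈ q.1 := by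
    obtain ⟨j, hj⟩ := hall
    exact ⟨j, fun ⟨q, hq, ha, hb⟩ => hj q hq ha hb⟩
  set n := Nat.find hex with hn
  have hn1 := Nat.find_spec hex
  rw [← hn] at hn1
  have hlow : δ * r ^ (n * K) ≤ dist x₁ x₂ := by
    obtain ⟨q, hq, hx⟩ := h.cov1 n x₁
    exact hm.le_dist _ _ _ fun hmem => hn1 ⟨q, hq, hx, h.sat1 n q hq x₁ hx hmem⟩
  have hup : dist y₁ y₂ ≤ D * r ^ ((n - 2) * K) := by
    rcases Nat.lt_or_ge n 2 with hlt | hge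
    · have : n - 2 = 0 := by omega
      rw [this, zero_mul, pow_zero, mul_one]
      have := dist_le_diam_of_mem (isCompact_univ (X := X')).isBounded (mem_univ y₁) (mem_univ y₂)
      linarith [hm'.C_pos]
    · obtain ⟨j, hj⟩ : ∃ j, n = j + 2 := ⟨n - 2, by omega⟩
      have hj1 : ∃ q ∈ Q (j + 1), x₁ ∈ q.1 ∧ x₂ ∈ q.1 := by
        by_contra hcon
        have := Nat.find_min' hex hcon
        omega
      obtain ⟨q, hq, ha, hb⟩ := hj1
      obtain ⟨q1, hq1, ha1, hb1⟩ := h1 (j + 1)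
      obtain ⟨q2, hq2, ha2, hb2⟩ := h2 (j + 1)
      obtain rfl := h.disj1 _ q hq q1 hq1 x₁ ha ha1
      obtain rfl := h.disj1 _ q hq q2 hq2 x₂ hb ha2
      have := h.swap.dist_le_of_mem (j := j) hN' hm' ⟨q, hq, rfl⟩ hb1 hb2
      have h3 : n - 2 = j := by omega
      rw [h3]
      refine this.trans (mul_le_mul_of_nonneg_right ?_ (pow_pos hr _).le)
      linarith [diam_nonneg (s := (univ : Set X'))]
  have hpow : r ^ ((n - 2) * K) * r ^ (2 * K) ≤ r ^ (n * K) := by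
    rw [← pow_add]
    apply pow_le_pow_of_le_one hr.le hm.r_lt.le
    rw [← add_mul]
    exact Nat.mul_le_mul_right K (by omega)
  have hδ := hm.δ_pos
  have hr2 := pow_pos hr (2 * K)
  calc dist y₁ y₂ ≤ D * r ^ ((n - 2) * K) := hup
    _ = D / (δ * r ^ (2 * K)) * (δ * (r ^ ((n - 2) * K) * r ^ (2 * K))) := by
      field_simp
    _ ≤ D / (δ * r ^ (2 * K)) * (δ * r ^ (n * K)) := by gcongr
    _ ≤ _ := by gcongr

end IsMatchSys

lemma exists_matchSys {X X' : Type*} [Nonempty X] [Nonempty X'] {N : ℕ → X → Set X}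
    {N' : ℕ → X' → Set X'} {m : Set X → ℝ}
    {m' : Set X' → ℝ} {K : ℕ}
    (hK : ∀ k A B, Sat N k A → Sat N' k B → m A = m' B → Matchable N N' m m' k K A B)
    (htot : m univ = m' univ) : ∃ Q, IsMatchSys N N' K Q := by
  classical
  let G : ℕ → Set X × Set X' → Prop := fun j q =>
    Sat N (j * K) q.1 ∧ Sat N' (j * K) q.2 ∧ m q.1 = m' q.2
  have hM : ∀ j q, ∃ R, G j q → IsMatching N N' m m' (j * K) K q.1 q.2 R := by
    intro j q
    by_cases hG : G j q
    · obtain ⟨R, hR⟩ := hK (j * K) q.1 q.2 hG.1 hG.2.1 hG.2.2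
      exact ⟨R, fun _ => hR⟩
    · exact ⟨∅, fun h => absurd h hG⟩
  choose F hF using hM
  let Q : ℕ → Set (Set X × Set X') := fun j =>
    Nat.rec {(univ, univ)} (fun j P => ⋃ q ∈ P, F j q) j
  have hQ0 : Q 0 = {(univ, univ)} := rfl
  have hQs : ∀ j, Q (j + 1) = ⋃ q ∈ Q j, F j q := fun j => rfl
  have hQG : ∀ j, ∀ q ∈ Q j, G j q ∧ q.1.Nonempty ∧ q.2.Nonempty := by
    intro j
    induction j with
    | zero =>
      rintro q rfl
      exact ⟨⟨IsTree.sat_univ _, IsTree.sat_univ _, htot⟩, univ_nonempty, univ_nonempty⟩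
    | succ j ih =>
      intro q hq
      rw [hQs] at hq
      obtain ⟨q', hq', hq⟩ := mem_iUnion₂.1 hq
      have := hF j q' (ih q' hq').1
      refine ⟨⟨?_, ?_, this.weight q hq⟩, this.ne1 q hq, this.ne2 q hq⟩
      · have h1 := this.sat1 q hq
        rwa [← Nat.succ_mul] at h1
      · have h1 := this.sat2 q hq
        rwa [← Nat.succ_mul] at h1
  have hFm : ∀ j, ∀ q ∈ Q j, IsMatching N N' m m' (j * K) K q.1 q.2 (F j q) :=
    fun j q hq => hF j q (hQG j q hq).1
  refine ⟨Q, ⟨fun j q hq => (hQG j q hq).1.1, fun j q hq => (hQG j q hq).1.2.1,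
    fun j q hq => (hQG j q hq).2.1, fun j q hq => (hQG j q hq).2.2, ?_, ?_, ?_, ?_, ?_, ?_, ?_⟩⟩
  · intro j q hq
    obtain ⟨q', hq', hq⟩ := mem_iUnion₂.1 hq
    exact (hFm j q' hq').small1 q hq
  · intro j q hq
    obtain ⟨q', hq', hq⟩ := mem_iUnion₂.1 hq
    exact (hFm j q' hq').small2 q hq
  · intro j x
    induction j with
    | zero => exact ⟨_, rfl, mem_univ x⟩
    | succ j ih =>
      obtain ⟨q, hq, hx⟩ := ih
      obtain ⟨q', hq', hx'⟩ := (hFm j q hq).cov1 x hx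
      exact ⟨q', mem_iUnion₂.2 ⟨q, hq, hq'⟩, hx'⟩
  · intro j x
    induction j with
    | zero => exact ⟨_, rfl, mem_univ x⟩
    | succ j ih =>
      obtain ⟨q, hq, hx⟩ := ih
      obtain ⟨q', hq', hx'⟩ := (hFm j q hq).cov2 x hx
      exact ⟨q', mem_iUnion₂.2 ⟨q, hq, hq'⟩, hx'⟩
  · intro j
    induction j with
    | zero => rintro q rfl q' rfl _ _ _; rfl
    | succ j ih =>
      intro q hq q' hq' x hx hx'
      obtain ⟨a, ha, hq⟩ := mem_iUnion₂.1 hq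
      obtain ⟨a', ha', hq'⟩ := mem_iUnion₂.1 hq'
      obtain rfl := ih a ha a' ha' x ((hFm j a ha).sub1 q hq hx) ((hFm j a' ha').sub1 q' hq' hx')
      exact (hFm j a ha).disj1 q hq q' hq' x hx hx'
  · intro j
    induction j with
    | zero => rintro q rfl q' rfl _ _ _; rfl
    | succ j ih =>
      intro q hq q' hq' x hx hx'
      obtain ⟨a, ha, hq⟩ := mem_iUnion₂.1 hq
      obtain ⟨a', ha', hq'⟩ := mem_iUnion₂.1 hq'
      obtain rfl := ih a ha a' ha' x ((hFm j a ha).sub2 q hq hx) ((hFm j a' ha').sub2 q' hq' hx')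
      exact (hFm j a ha).disj2 q hq q' hq' x hx hx'
  · intro j q hq
    obtain ⟨q', hq', hq⟩ := mem_iUnion₂.1 hq
    exact ⟨q', hq', (hFm j q' hq').sub1 q hq, (hFm j q' hq').sub2 q hq⟩

/-- Two full weighted metric trees with the same parameters and total weight are
bi-Lipschitz equivalent. -/
theorem exists_bilipschitz {X X' : Type*} [MetricSpace X] [CompactSpace X] [Nonempty X]
    [MetricSpace X'] [CompactSpace X'] [Nonempty X'] {N : ℕ → X → Set X}
    {N' : ℕ → X' → Set X'} {m : Set X → ℝ} {m' : Set X' → ℝ} {p r δ C δ' C' σ σ' : ℝ}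
    {I : AddSubgroup ℝ} {W W' : Finset ℝ} (b : Full N p m I W σ) (b' : Full N' p m' I W' σ')
    (hN : IsMetricTree N r δ C) (hN' : IsMetricTree N' r δ' C') (htot : m univ = m' univ) :
    ∃ (f : X → X') (L : ℝ), 1 ≤ L ∧ Function.Bijective f ∧
      ∀ x y, L⁻¹ * dist x y ≤ dist (f x) (f y) ∧ dist (f x) (f y) ≤ L * dist x y := by
  obtain ⟨K, hK0, hK⟩ := exists_match b b'
  obtain ⟨Q, hQ⟩ := exists_matchSys hK htot
  have h1 := fun x => hQ.total hN' x
  choose f hf using h1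
  obtain ⟨L1, hL1, hd1⟩ := hQ.dist_le hK0 b.tree b'.tree hN hN'
  obtain ⟨L2, hL2, hd2⟩ := hQ.swap.dist_le hK0 b'.tree b.tree hN' hN
  set L := max 1 (max L1 L2) with hLdef
  have hLpos : 0 < L := lt_of_lt_of_le one_pos (le_max_left _ _)
  refine ⟨f, L, le_max_left _ _, ⟨?_, ?_⟩, fun x y => ⟨?_, ?_⟩⟩
  · intro x y hxy
    exact hQ.eq_of_rel hK0 b.tree hN (hf x) (by rw [hxy]; exact hf y)
  · intro y
    obtain ⟨x, hx⟩ := hQ.swap.total hN y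
    refine ⟨x, ?_⟩
    exact hQ.swap.eq_of_rel hK0 b'.tree hN' (IsMatchSys.rel_swap.2 (hf x)) hx
  · rw [inv_mul_le_iff₀ hLpos]
    refine (hd2 _ _ _ _ (IsMatchSys.rel_swap.2 (hf x)) (IsMatchSys.rel_swap.2 (hf y))).trans ?_
    gcongr
    exact (le_max_right _ _).trans (le_max_right _ _)
  · refine (hd1 _ _ _ _ (hf x) (hf y)).trans ?_
    gcongr
    exact (le_max_left _ _).trans (le_max_right _ _)

end

section

section Rescale

variable {X : Type*} {N : ℕ → X → Set X} {L : ℕ}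

lemma IsTree.rescale (h : IsTree N) (L : ℕ) : IsTree fun k => N (L * k) :=
  ⟨fun _ => h.self _, fun _ => h.eq _, fun k x => h.mono (Nat.mul_le_mul_left L (Nat.le_succ k)) x,
    fun _ => h.fin _⟩

lemma Base.rescale {p : ℝ} {m : Set X → ℝ} {I : AddSubgroup ℝ}
    {W : Finset ℝ} {σ : ℝ} (b : Base N p m I W σ) (hL : 0 < L) :
    Base (fun k => N (L * k)) (p ^ L) m I W σ where
  tree := b.tree.rescale L
  p_pos := pow_pos b.p_pos L
  p_lt := pow_lt_one₀ b.p_pos.le b.p_lt hL.ne'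
  add := fun k A B hA hB => b.add (L * k) A B hA hB
  W_pos := b.W_pos
  wt := fun k x => by
    obtain ⟨w, hw, h⟩ := b.wt (L * k) x
    exact ⟨w, hw, by rw [h, pow_mul]⟩
  mul_p := fun y hy => b.pow_mul_mem L hy
  mul_p_inv := fun y hy => b.mem_of_pow_mul L (by
    rw [mul_inv_cancel_left₀ (pow_pos b.p_pos L).ne']; exact hy)
  σ_pos := b.σ_pos
  rich := fun y hy h0 h1 => by
    obtain ⟨K, hK⟩ := b.rich y hy h0 h1
    refine ⟨K, fun k x => ?_⟩
    obtain ⟨A, hA, hs, hm⟩ := hK (L * k) x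
    refine ⟨A, hA, ?_, by rw [hm, pow_mul]⟩
    refine b.tree.sat_mono (l := L * (k + K)) ?_ hs
    rw [mul_add]
    exact Nat.add_le_add_left (Nat.le_mul_of_pos_left K hL) _

lemma IsMetricTree.rescale [MetricSpace X] {r δ C : ℝ} (h : IsMetricTree N r δ C) (hL : 0 < L) :
    IsMetricTree (fun k => N (L * k)) (r ^ L) δ C where
  r_pos := pow_pos h.r_pos L
  r_lt := pow_lt_one₀ h.r_pos.le h.r_lt hL.ne'
  δ_pos := h.δ_pos
  C_pos := h.C_pos
  dist_le := fun k x y hxy => by rw [← pow_mul]; exact h.dist_le _ _ _ hxy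
  le_dist := fun k x y hxy => by rw [← pow_mul]; exact h.le_dist _ _ _ hxy

end Rescale

variable {X : Type*} [MeasurableSpace X]

/-- `R` is a saturated part of the cell `c` of level `k`, with all saturated subsets of measure
in `I` and total measure in `(1 - q) • I`, missing only few cells of level `k + 1`. -/
structure IsGoodPart {N : ℕ → X → Set X} (hN : IsTree N) (μ : Measure X) (P q : ℝ)
    (I : AddSubgroup ℝ) (k : ℕ) (c R : Set X) : Prop where
  sub : R ⊆ c
  sat : Sat N (k + 1) R
  ne : R.Nonempty
  her : ∀ n D, D ⊆ R → Sat N n D → μ.real D ∈ I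
  mem : ∃ z ∈ I, μ.real R = (1 - q) * z
  card : ((hN.cells (k + 1) (c \ R)).card : ℝ) * P ≤ 1 / 2

lemma zpow_mul_mem {q : ℝ} {I : AddSubgroup ℝ} (hq : ∀ y ∈ I, q * y ∈ I)
    (hq' : ∀ y ∈ I, q⁻¹ * y ∈ I) (h : ℤ) {y : ℝ} (hy : y ∈ I) : q ^ h * y ∈ I := by
  have h1 : ∀ n : ℕ, ∀ a : ℝ, (∀ y ∈ I, a * y ∈ I) → a ^ n * y ∈ I := by
    intro n a ha
    induction n with
    | zero => simpa
    | succ n ih => rw [pow_succ', mul_assoc]; exact ha _ ih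
  obtain ⟨n, rfl | rfl⟩ := h.eq_nat_or_neg
  · rw [zpow_natCast]; exact h1 n q hq
  · rw [zpow_neg, zpow_natCast, ← inv_pow]; exact h1 n q⁻¹ hq'

variable {N : ℕ → X → Set X} {μ : Measure X} {P q σ : ℝ} {I : AddSubgroup ℝ} {W : Finset ℝ}

lemma exists_split_aux (b : Base N P μ.real I W σ) (hq0 : 0 < q) (hq1 : q < 1)
    (hq : ∀ y ∈ I, q * y ∈ I) (hq' : ∀ y ∈ I, q⁻¹ * y ∈ I) {β₀ β : ℝ} (hβI : β₀ ∈ I)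
    (hβ : β = (1 - q) * β₀) (hβ0 : 0 < β) (n : ℕ) (v : ℝ) :
    ∃ H K : ℕ, ∀ k c R, IsGoodPart b.tree μ P q I k c R →
      (b.tree.cells (k + 1) (c \ R)).card = n → μ.real R = P ^ k * v →
      ∃ R₂ ⊆ R, Sat N (k + K) R₂ ∧ ∃ h : ℤ, |h| ≤ H ∧
        q ^ h * μ.real (R \ R₂) + q ^ (h + 1) * μ.real R₂ =
          P ^ k * (β * (1 - n * P)) := by
  by_cases hc : 0 < v ∧ (n : ℝ) * P ≤ 1 / 2
  swap
  · refine ⟨0, 0, fun k c R hR hn hv => absurd ⟨?_, hn ▸ hR.card⟩ hc⟩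
    have h1 := b.pos hR.sat hR.ne
    rw [hv] at h1
    exact pos_of_mul_pos_right h1 (pow_pos b.p_pos k).le
  obtain ⟨hv0, hn2⟩ := hc
  set t := β * (1 - n * P) with ht
  have ht0 : 0 < t := mul_pos hβ0 (by linarith)
  obtain ⟨h, hh1, hh2⟩ : ∃ h : ℤ, q ^ (h + 1) * v < t ∧ t ≤ q ^ h * v := by
    obtain ⟨e, he1, he2⟩ := exists_mem_Ioc_zpow (div_pos ht0 hv0) ((one_lt_inv₀ hq0).2 hq1)
    refine ⟨-(e + 1), ?_, ?_⟩
    · rw [lt_div_iff₀ hv0] at he1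
      have : -(e + 1) + 1 = -e := by ring
      rwa [this, zpow_neg, ← inv_zpow]
    · rw [div_le_iff₀ hv0] at he2
      rwa [zpow_neg, ← inv_zpow]
  have hqh := zpow_pos hq0 h
  have h1q : 0 < 1 - q := by linarith
  set x := (q ^ h * v - t) / (q ^ h * (1 - q)) with hx
  have hxe : q ^ h * (1 - q) * x = q ^ h * v - t := by
    rw [hx]; field_simp
  have hqh1 : q ^ (h + 1) = q ^ h * q := zpow_add_one₀ hq0.ne' h
  have hx0 : 0 ≤ x := div_nonneg (by linarith) (mul_pos hqh h1q).le
  have hxv : x < v := by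
    rw [hx, div_lt_iff₀ (mul_pos hqh h1q)]
    rw [hqh1] at hh1
    linarith
  have hxI : ∀ k c R, IsGoodPart b.tree μ P q I k c R → μ.real R = P ^ k * v → x ∈ I := by
    intro k c R hR hRv
    obtain ⟨z, hz, hRz⟩ := hR.mem
    have hy : ∃ y ∈ I, z = P ^ k * y := by
      refine ⟨(P ^ k)⁻¹ * z, b.mem_of_pow_mul k ?_, ?_⟩
      · rwa [mul_inv_cancel_left₀ (pow_pos b.p_pos k).ne']
      · rw [mul_inv_cancel_left₀ (pow_pos b.p_pos k).ne']
    obtain ⟨y, hyI, rfl⟩ := hy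
    have hvy : v = (1 - q) * y := by
      have : P ^ k * v = P ^ k * ((1 - q) * y) := by rw [← hRv, hRz]; ring
      exact mul_left_cancel₀ (pow_pos b.p_pos k).ne' this
    have hxy : x = y - q ^ (-h) * (β₀ - n • (P * β₀)) := by
      have h3 : q ^ h * q ^ (-h) = 1 := by rw [← zpow_add₀ hq0.ne']; simp
      have h4 : q ^ h * (1 - q) * x = q ^ h * (1 - q) * (y - q ^ (-h) * (β₀ - n • (P * β₀))) := by
        rw [hxe, hvy, ht, hβ, nsmul_eq_mul]
        linear_combination (1 - q) * (β₀ - n * (P * β₀)) * h3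
      exact mul_left_cancel₀ (mul_pos hqh h1q).ne' h4
    rw [hxy]
    exact I.sub_mem hyI (zpow_mul_mem hq hq' _ (I.sub_mem hβI (I.nsmul_mem (b.mul_p _ hβI) n)))
  by_cases hxI' : x ∈ I
  swap
  · exact ⟨0, 0, fun k c R hR _ hv => absurd (hxI k c R hR hv) hxI'⟩
  have hfinal : ∀ (k : ℕ) (R R₂ : Set X) (l : ℕ), Sat N l R → Sat N l R₂ → R₂ ⊆ R →
      μ.real R = P ^ k * v → μ.real R₂ = P ^ k * x →
      q ^ h * μ.real (R \ R₂) + q ^ (h + 1) * μ.real R₂ = P ^ k * t := by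
    intro k R R₂ l h1 h2 h3 h4 h5
    rw [b.add.diff b.tree h1 h2 h3, h4, h5, hqh1]
    linear_combination -P ^ k * hxe
  rcases hx0.eq_or_lt with hx0 | hx0
  · refine ⟨h.natAbs, 0, fun k c R hR hn hv => ⟨∅, empty_subset _, IsTree.sat_empty _, h, ?_, ?_⟩⟩
    · rw [Int.natCast_natAbs]
    · refine hfinal k R ∅ _ hR.sat (IsTree.sat_empty _) (empty_subset _) hv ?_
      rw [← hx0]; simp
  · obtain ⟨K, hK1, hK⟩ := b.exists_cut hxI' hx0 1
    refine ⟨h.natAbs, K, fun k c R hR hn hv => ?_⟩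
    obtain ⟨R₂, hR₂, hs, hm⟩ := hK k R hR.sat hR.her
      (by rw [hv]; exact mul_lt_mul_of_pos_left hxv (pow_pos b.p_pos k))
    refine ⟨R₂, hR₂, hs, h, ?_, ?_⟩
    · rw [Int.natCast_natAbs]
    · exact hfinal k R R₂ _ (b.tree.sat_mono (by omega) hR.sat) hs hR₂ hv hm

lemma exists_split (b : Base N P μ.real I W σ) (hq0 : 0 < q) (hq1 : q < 1)
    (hq : ∀ y ∈ I, q * y ∈ I) (hq' : ∀ y ∈ I, q⁻¹ * y ∈ I) {β₀ β : ℝ} (hβI : β₀ ∈ I)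
    (hβ : β = (1 - q) * β₀) (hβ0 : 0 < β) :
    ∃ H K : ℕ, ∀ k x R, IsGoodPart b.tree μ P q I k (N k x) R →
      ∃ R₂ ⊆ R, Sat N (k + K) R₂ ∧ ∃ h : ℤ, |h| ≤ H ∧
        q ^ h * μ.real (R \ R₂) + q ^ (h + 1) * μ.real R₂ =
          P ^ k * (β * (1 - (b.tree.cells (k + 1) (N k x \ R)).card * P)) := by
  classical
  have haux := exists_split_aux b hq0 hq1 hq hq' hβI hβ hβ0
  choose H K hHK using haux
  obtain ⟨M, hM, hWM⟩ := b.exists_bound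
  obtain ⟨n₀, hn₀⟩ := exists_nat_gt (1 / 2 / P)
  have hfin : ((fun s => P * s) '' {s ∈ natCombs W | s ≤ M / P}).Finite :=
    (finite_natCombs_le W b.W_pos _).image _
  let T := Finset.range n₀ ×ˢ hfin.toFinset
  refine ⟨T.sup fun t => H t.1 t.2, T.sup fun t => K t.1 t.2, fun k x R hR => ?_⟩
  obtain ⟨v, hv, hval⟩ := b.exists_val hR.sat
  have hval' : μ.real R = P ^ k * (P * v) := by rw [hval, pow_succ]; ring
  have hmem : ((b.tree.cells (k + 1) (N k x \ R)).card, P * v) ∈ T := by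
    refine Finset.mem_product.2 ⟨Finset.mem_range.2 ?_, ?_⟩
    · have h1 := hR.card
      rw [← le_div_iff₀ b.p_pos] at h1
      exact_mod_cast h1.trans_lt hn₀
    · rw [hfin.mem_toFinset]
      refine ⟨v, ⟨hv, ?_⟩, rfl⟩
      rw [le_div_iff₀ b.p_pos]
      have h1 := b.mono (b.tree.sat_mono (Nat.le_succ k) (b.tree.sat_node k x)) hR.sat hR.sub
      obtain ⟨w, hw, hwv⟩ := b.wt k x
      rw [hwv, hval'] at h1
      have := le_of_mul_le_mul_left h1 (pow_pos b.p_pos k)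
      linarith [hWM w hw]
  obtain ⟨R₂, h1, h2, h, h3, h4⟩ := hHK _ _ k (N k x) R hR rfl hval'
  have hH := Finset.le_sup (f := fun t : ℕ × ℝ => H t.1 t.2) hmem
  have hK := Finset.le_sup (f := fun t : ℕ × ℝ => K t.1 t.2) hmem
  refine ⟨R₂, h1, b.tree.sat_mono (Nat.add_le_add_left hK k) h2, h, h3.trans ?_, h4⟩
  exact_mod_cast hH

end

section

variable {X : Type*} [MeasurableSpace X]
variable {N : ℕ → X → Set X} {μ : Measure X} {P q σ β : ℝ} {I : AddSubgroup ℝ} {W : Finset ℝ}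

/-- In each cell a good part `R` is chosen, with a subset `R₂`, such that multiplying the measure
by `q ^ h` on `R \ R₂` and `q ^ (h + 1)` on `R₂` gives the prescribed mass. -/
structure SplitData (hN : IsTree N) (μ : Measure X) (P q β : ℝ) (I : AddSubgroup ℝ) (H K : ℕ)
    (R R₂ : ℕ → Set X → Set X) (h : ℕ → Set X → ℤ) : Prop where
  good : ∀ k x, IsGoodPart hN μ P q I k (N k x) (R k (N k x))
  sub : ∀ k x, R₂ k (N k x) ⊆ R k (N k x)
  sat : ∀ k x, Sat N (k + K) (R₂ k (N k x))
  bd : ∀ k x, |h k (N k x)| ≤ H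
  eq : ∀ k x, q ^ h k (N k x) * μ.real (R k (N k x) \ R₂ k (N k x)) +
      q ^ (h k (N k x) + 1) * μ.real (R₂ k (N k x)) =
      P ^ k * (β * (1 - (hN.cells (k + 1) (N k x \ R k (N k x))).card * P))

open scoped Classical in
/-- The density of the modified measure. -/
def density (N : ℕ → X → Set X) (q : ℝ) (R R₂ : ℕ → Set X → Set X) (h : ℕ → Set X → ℤ) (x : X) :
    ENNReal :=
  if hx : ∃ n, x ∈ R n (N n x) then
    (fun n => if x ∈ R₂ n (N n x) then ENNReal.ofReal (q ^ (h n (N n x) + 1))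
      else ENNReal.ofReal (q ^ h n (N n x))) (Nat.find hx)
  else 0

/-- The mass with density `g`. -/
def mass (μ : Measure X) (g : X → ENNReal) (A : Set X) : ℝ := (∫⁻ x in A, g x ∂μ).toReal

lemma mass_const {g : X → ENNReal} {A : Set X} (hA : MeasurableSet A) {a : ℝ} (ha : 0 ≤ a)
    (h : ∀ x ∈ A, g x = ENNReal.ofReal a) : mass μ g A = a * μ.real A := by
  rw [mass, setLIntegral_congr_fun hA h, setLIntegral_const, ENNReal.toReal_mul,
    ENNReal.toReal_ofReal ha]
  rfl

lemma IsTree.measurableSet (hN : IsTree N) (hmeas : ∀ k x, MeasurableSet (N k x)) {k : ℕ}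
    {A : Set X} (hA : Sat N k A) : MeasurableSet A := by
  rw [← hN.sUnion_cells hA]
  refine MeasurableSet.sUnion (Finset.countable_toSet _) fun c hc => ?_
  obtain ⟨x, _, rfl⟩ := hN.mem_cells.1 hc
  exact hmeas k x

lemma mass_union [IsFiniteMeasure μ] {g : X → ENNReal} {G : ℝ}
    (hg : ∀ x, g x ≤ ENNReal.ofReal G) {A B : Set X} (hB : MeasurableSet B) (hAB : Disjoint A B) :
    mass μ g (A ∪ B) = mass μ g A + mass μ g B := by
  have hfin : ∀ A : Set X, ∫⁻ x in A, g x ∂μ ≠ ⊤ := by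
    intro A
    refine ne_top_of_le_ne_top ?_ (lintegral_mono fun x => hg x)
    rw [lintegral_const]
    exact ENNReal.mul_ne_top ENNReal.ofReal_ne_top (measure_ne_top _ _)
  rw [mass, lintegral_union hB hAB, ENNReal.toReal_add (hfin _) (hfin _)]
  rfl

namespace SplitData

variable {H K : ℕ} {R R₂ : ℕ → Set X → Set X} {h : ℕ → Set X → ℤ} {hN : IsTree N}
  (s : SplitData hN μ P q β I H K R R₂ h)
include s

lemma hit_congr {n : ℕ} {x y : X} (hy : y ∈ N (n + 1) x) :
    y ∈ R n (N n y) ↔ x ∈ R n (N n x) := by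
  have h1 : N n y = N n x := hN.eq _ _ _ (hN.anti n x hy)
  rw [h1]
  constructor
  · intro hyR
    apply (s.good n x).sat y hyR
    rw [hN.eq _ _ _ hy]
    exact hN.self _ _
  · intro hxR
    exact (s.good n x).sat x hxR hy

omit [MeasurableSpace X] s in
lemma density_eq {n : ℕ} {x : X} (hx : x ∈ R n (N n x)) (hno : ∀ j < n, x ∉ R j (N j x)) :
    (x ∈ R₂ n (N n x) → density N q R R₂ h x = ENNReal.ofReal (q ^ (h n (N n x) + 1))) ∧
    (x ∉ R₂ n (N n x) → density N q R R₂ h x = ENNReal.ofReal (q ^ h n (N n x))) := by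
  classical
  have hex : ∃ n, x ∈ R n (N n x) := ⟨n, hx⟩
  have hfind : Nat.find hex = n := by
    rw [Nat.find_eq_iff]
    exact ⟨hx, hno⟩
  unfold density
  rw [dif_pos hex]
  beta_reduce
  rw [hfind]
  exact ⟨fun h => if_pos h, fun h => if_neg h⟩

lemma density_le (hq0 : 0 < q) (hq1 : q < 1) (x : X) :
    density N q R R₂ h x ≤ ENNReal.ofReal (q ^ (-(H : ℤ))) := by
  classical
  unfold density
  split_ifs with hx
  · beta_reduce
    have hb := abs_le.1 (s.bd (Nat.find hx) x)
    split_ifs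
    · exact ENNReal.ofReal_le_ofReal (zpow_le_zpow_right_of_le_one₀ hq0 hq1.le (by linarith))
    · exact ENNReal.ofReal_le_ofReal (zpow_le_zpow_right_of_le_one₀ hq0 hq1.le (by linarith))
  · exact zero_le

lemma satAdd [IsFiniteMeasure μ] (hmeas : ∀ k x, MeasurableSet (N k x)) (hq0 : 0 < q)
    (hq1 : q < 1) : SatAdd N (mass μ (density N q R R₂ h)) :=
  fun _ _ _ _ hB hAB => mass_union (s.density_le hq0 hq1) (hN.measurableSet hmeas hB) hAB

lemma density_eq_of_mem {i : ℕ} {x y : X} (hno : ∀ j < i, x ∉ R j (N j x))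
    (hy : y ∈ R i (N i x)) :
    (y ∈ R₂ i (N i x) → density N q R R₂ h y = ENNReal.ofReal (q ^ (h i (N i x) + 1))) ∧
    (y ∉ R₂ i (N i x) → density N q R R₂ h y = ENNReal.ofReal (q ^ h i (N i x))) := by
  have hyN : y ∈ N i x := (s.good i x).sub hy
  have hNy := hN.eq _ _ _ hyN
  have := density_eq (q := q) (R := R) (R₂ := R₂) (h := h) (N := N) (n := i) (x := y)
    (by rwa [hNy]) (fun j hj hyj => hno j hj ((s.hit_congr (hN.mono hj x hyN)).1 hyj))
  rwa [hNy] at this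

lemma mass_eq [IsFiniteMeasure μ] (hmeas : ∀ k x, MeasurableSet (N k x)) (hq0 : 0 < q)
    (hq1 : q < 1) {i l : ℕ} {x : X} (hno : ∀ j < i, x ∉ R j (N j x)) {A : Set X}
    (hA : A ⊆ R i (N i x)) (hAs : Sat N l A) :
    mass μ (density N q R R₂ h) A = q ^ h i (N i x) * μ.real (A \ R₂ i (N i x)) +
      q ^ (h i (N i x) + 1) * μ.real (A ∩ R₂ i (N i x)) := by
  have hmA := hN.measurableSet hmeas hAs
  have hmR := hN.measurableSet hmeas (s.sat i x)
  have h1 := mass_union (μ := μ) (s.density_le hq0 hq1) (hmA.inter hmR)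
    (disjoint_sdiff_inter (s := A) (t := R₂ i (N i x)))
  rw [sdiff_union_inter] at h1
  rw [h1, mass_const (hmA.diff hmR) (zpow_pos hq0 _).le, mass_const (hmA.inter hmR) (zpow_pos hq0 _).le]
  · exact fun y hy => (s.density_eq_of_mem hno (hA hy.1)).1 hy.2
  · exact fun y hy => (s.density_eq_of_mem hno (hA hy.1)).2 hy.2

lemma mass_singular [IsFiniteMeasure μ] (b : Base N P μ.real I W σ)
    (hmeas : ∀ k x, MeasurableSet (N k x)) (hq0 : 0 < q) (hq1 : q < 1) (hβ : 0 < β)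
    {n : ℕ} {x : X} (hno : ∀ j < n, x ∉ R j (N j x)) :
    mass μ (density N q R R₂ h) (N n x) = P ^ n * β := by
  set m := mass μ (density N q R R₂ h) with hm
  have hadd := s.satAdd hmeas hq0 hq1
  obtain ⟨M, hM, hWM⟩ := b.exists_bound
  have hP := b.p_pos
  set G := q ^ (-(H : ℤ)) with hG
  have hGpos : 0 < G := zpow_pos hq0 _
  have hcrude : ∀ n x, m (N n x) ≤ P ^ n * (M * G) := by
    intro n x
    have h1 : ∫⁻ y in N n x, density N q R R₂ h y ∂μ ≤ ENNReal.ofReal G * μ (N n x) := by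
      rw [← setLIntegral_const]
      exact lintegral_mono fun y => s.density_le hq0 hq1 y
    have h2 := ENNReal.toReal_mono (ENNReal.mul_ne_top ENNReal.ofReal_ne_top
      (measure_ne_top μ _)) h1
    rw [ENNReal.toReal_mul, ENNReal.toReal_ofReal hGpos.le] at h2
    obtain ⟨w, hw, hwv⟩ := b.wt n x
    rw [Measure.real] at hwv
    rw [hwv] at h2
    have h3 : w * (G * P ^ n) ≤ M * (G * P ^ n) :=
      mul_le_mul_of_nonneg_right (hWM w hw) (mul_pos hGpos (pow_pos hP n)).le
    change m (N n x) ≤ _ at h2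
    linarith
  have hnn : ∀ A, 0 ≤ m A := fun A => ENNReal.toReal_nonneg
  set D := M * G + β with hD
  have hDpos : 0 < D := by positivity
  have key : ∀ j n x, (∀ j < n, x ∉ R j (N j x)) →
      |m (N n x) - P ^ n * β| ≤ P ^ n * (D * (1 / 2) ^ j) := by
    intro j
    induction j with
    | zero =>
      intro n x _
      rw [pow_zero, mul_one, abs_le, hD]
      have h1 := hcrude n x
      have h2 := hnn (N n x)
      have h3 : 0 < P ^ n * (M * G) := by positivity
      have h4 : 0 < P ^ n * β := by positivity
      constructor <;> linarith
    | succ j ih =>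
      intro n x hx
      set c := N n x with hc
      have hg := s.good n x
      have hcs : Sat N (n + 1) c := hN.sat_mono (Nat.le_succ n) (hN.sat_node n x)
      have hsd : Sat N (n + 1) (c \ R n c) := hN.sat_diff hcs hg.sat
      have h1 : m (c \ R n c) = m c - m (R n c) := hadd.diff hN hcs hg.sat hg.sub
      have h2 : m (R n c) = P ^ n * (β * (1 - (hN.cells (n + 1) (c \ R n c)).card * P)) := by
        rw [hm, s.mass_eq hmeas hq0 hq1 hx subset_rfl hg.sat, ← s.eq n x,
          inter_eq_self_of_subset_right (s.sub n x)]
      have h3 : m (c \ R n c) = ∑ d ∈ hN.cells (n + 1) (c \ R n c), m d := hadd.cells hN hsd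
      have h4 : ∀ d ∈ hN.cells (n + 1) (c \ R n c),
          |m d - P ^ (n + 1) * β| ≤ P ^ (n + 1) * (D * (1 / 2) ^ j) := by
        intro d hd
        obtain ⟨y, hy, rfl⟩ := hN.mem_cells.1 hd
        apply ih
        intro i hi hyi
        have hyc := hN.eq n x y hy.1
        rcases Nat.lt_succ_iff_lt_or_eq.1 hi with hi | rfl
        · exact hx i hi ((s.hit_congr (hN.mono hi x hy.1)).1 hyi)
        · rw [hyc] at hyi
          exact hy.2 hyi
      have h5 : m c - P ^ n * β = ∑ d ∈ hN.cells (n + 1) (c \ R n c), (m d - P ^ (n + 1) * β) := by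
        rw [Finset.sum_sub_distrib, ← h3, h1, h2, Finset.sum_const, nsmul_eq_mul]
        ring
      rw [h5]
      refine (Finset.abs_sum_le_sum_abs _ _).trans ((Finset.sum_le_sum h4).trans ?_)
      rw [Finset.sum_const, nsmul_eq_mul]
      have h6 := mul_le_mul_of_nonneg_right hg.card
        (by positivity : 0 ≤ P ^ n * (D * (1 / 2) ^ j))
      rw [pow_succ, pow_succ]
      linarith
  have hlim : Filter.Tendsto (fun j : ℕ => P ^ n * (D * (1 / 2 : ℝ) ^ j)) Filter.atTop
      (nhds (P ^ n * (D * 0))) :=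
    ((tendsto_pow_atTop_nhds_zero_of_lt_one (by norm_num) (by norm_num)).const_mul D).const_mul _
  rw [mul_zero, mul_zero] at hlim
  have := ge_of_tendsto' hlim fun j => key j n x hno
  have := abs_nonpos_iff.1 this
  linarith

omit [MeasurableSpace X] s in
lemma first_hit (x : X) (n : ℕ) : (∀ j < n, x ∉ R j (N j x)) ∨
    ∃ i < n, x ∈ R i (N i x) ∧ ∀ j < i, x ∉ R j (N j x) := by
  classical
  by_cases hx : ∃ i, i < n ∧ x ∈ R i (N i x)
  · right
    refine ⟨Nat.find hx, (Nat.find_spec hx).1, (Nat.find_spec hx).2, fun j hj hj' => ?_⟩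
    exact Nat.find_min hx hj ⟨hj.trans (Nat.find_spec hx).1, hj'⟩
  · left
    push Not at hx
    exact hx

/-- The modified mass makes the tree full. -/
theorem exists_full [IsFiniteMeasure μ] (b : Base N P μ.real I W σ)
    (hmeas : ∀ k x, MeasurableSet (N k x)) (hq0 : 0 < q) (hq1 : q < 1)
    (hq : ∀ y ∈ I, q * y ∈ I) (hq' : ∀ y ∈ I, q⁻¹ * y ∈ I) (hβI : β ∈ I) (hβ : 0 < β) :
    ∃ W' σ', Full N P (mass μ (density N q R R₂ h)) I W' σ' := by
  classical
  have hadd := s.satAdd hmeas hq0 hq1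
  obtain ⟨M, hM, hWM⟩ := b.exists_bound
  have hP := b.p_pos
  let V : Finset ℝ := ((finite_natCombs_le W b.W_pos (M / P ^ K)).image fun v => P ^ K * v).toFinset
  let W' : Finset ℝ := insert β (((Finset.Icc (-(H : ℤ)) H ×ˢ (V ×ˢ V)).image
    fun t => q ^ t.1 * t.2.1 + q ^ (t.1 + 1) * t.2.2).filter (0 < ·))
  have hVmem : ∀ n x A, Sat N (n + K) A → A ⊆ N n x → ∃ v ∈ V, μ.real A = P ^ n * v := by
    intro n x A hA hsub
    obtain ⟨v, hv, hval⟩ := b.exists_val hA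
    refine ⟨P ^ K * v, ?_, by rw [hval, pow_add]; ring⟩
    refine (Set.Finite.mem_toFinset _).2 ⟨v, ⟨hv, ?_⟩, rfl⟩
    rw [le_div_iff₀ (pow_pos hP K)]
    have h1 := b.mono (hN.sat_mono (Nat.le_add_right n K) (hN.sat_node n x)) hA hsub
    obtain ⟨w, hw, hwv⟩ := b.wt n x
    rw [hwv, hval, pow_add, mul_assoc] at h1
    have := le_of_mul_le_mul_left h1 (pow_pos hP n)
    linarith [hWM w hw]
  have hreg : ∀ n x i, i < n → x ∈ R i (N i x) → N n x ⊆ R i (N i x) := by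
    intro n x i hi hx
    exact (hN.mono hi x).trans ((s.good i x).sat x hx)
  refine ⟨W', σ * P ^ (1 + K) * q ^ ((H : ℤ) + 1), ⟨hN, hP, b.p_lt, hadd, ?_, ?_, b.mul_p,
    b.mul_p_inv, by have := b.σ_pos; have := zpow_pos hq0 ((H : ℤ) + 1); positivity, ?_⟩, ?_⟩
  · intro w hw
    rcases Finset.mem_insert.1 hw with rfl | hw
    · exact hβ
    · exact (Finset.mem_filter.1 hw).2
  · intro n x
    rcases first_hit (R := R) (N := N) x n with hno | ⟨i, hi, hx, hno⟩
    · exact ⟨β, Finset.mem_insert_self _ _, s.mass_singular b hmeas hq0 hq1 hβ hno⟩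
    · have hsat := hN.sat_node n x
      have hR2 : Sat N (n + K) (R₂ i (N i x)) := hN.sat_mono (by omega) (s.sat i x)
      have hsat' : Sat N (n + K) (N n x) := hN.sat_mono (by omega) hsat
      have hm := s.mass_eq hmeas hq0 hq1 hno (hreg n x i hi hx) hsat
      obtain ⟨v₁, hv₁, h1⟩ := hVmem n x _ (hN.sat_diff hsat' hR2) sdiff_subset
      obtain ⟨v₂, hv₂, h2⟩ := hVmem n x _ (IsTree.sat_inter hsat' hR2) inter_subset_left
      have hPn := pow_pos hP n
      have hsum : μ.real (N n x \ R₂ i (N i x)) + μ.real (N n x ∩ R₂ i (N i x)) =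
          μ.real (N n x) := by
        rw [← b.add (n + K) _ _ (hN.sat_diff hsat' hR2) (IsTree.sat_inter hsat' hR2)
          disjoint_sdiff_inter, sdiff_union_inter]
      have hn1 : 0 ≤ μ.real (N n x \ R₂ i (N i x)) := measureReal_nonneg
      have hn2 : 0 ≤ μ.real (N n x ∩ R₂ i (N i x)) := measureReal_nonneg
      have hpos := b.node_pos n x
      rw [← hsum, h1, h2] at hpos
      rw [h1] at hn1 hm
      rw [h2] at hn2 hm
      have hv1 := nonneg_of_mul_nonneg_right hn1 hPn
      have hv2 := nonneg_of_mul_nonneg_right hn2 hPn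
      have hz1 := zpow_pos hq0 (h i (N i x))
      have hz2 := zpow_pos hq0 (h i (N i x) + 1)
      refine ⟨q ^ h i (N i x) * v₁ + q ^ (h i (N i x) + 1) * v₂, ?_, by rw [hm]; ring⟩
      refine Finset.mem_insert_of_mem (Finset.mem_filter.2 ⟨Finset.mem_image.2
        ⟨(h i (N i x), v₁, v₂), ?_, rfl⟩, ?_⟩)
      · refine Finset.mem_product.2 ⟨?_, Finset.mem_product.2 ⟨hv₁, hv₂⟩⟩
        exact Finset.mem_Icc.2 (abs_le.1 (s.bd i x))
      · rcases hv1.eq_or_lt with h0 | h0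
        · rw [← h0] at hpos ⊢
          have : 0 < v₂ := pos_of_mul_pos_right (by linarith : 0 < P ^ n * v₂) hPn.le
          have := mul_pos hz2 this
          linarith
        · have := mul_pos hz1 h0
          have := mul_nonneg hz2.le hv2
          linarith
  · intro y hy hy0 hyσ
    let Y : Set ℝ := (fun e : ℤ => q ^ (-e) * (P ^ (1 + K))⁻¹ * y) '' (Finset.Icc (-(H : ℤ)) (H + 1))
    have hY : Y.Finite := (Finset.finite_toSet _).image _
    obtain ⟨K', hK'⟩ := b.rich_finite hY
    refine ⟨1 + K + K', fun k x₀ => ?_⟩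
    obtain ⟨x, hxc, i, hi, hx, hno⟩ : ∃ x ∈ N k x₀, ∃ i < k + 1, x ∈ R i (N i x) ∧
        ∀ j < i, x ∉ R j (N j x) := by
      obtain ⟨x, hx⟩ := (s.good k x₀).ne
      have hxN := (s.good k x₀).sub hx
      have hxx := hN.eq k x₀ x hxN
      rcases first_hit (R := R) (N := N) x (k + 1) with hno | h
      · exact absurd (by rwa [hxx]) (hno k (Nat.lt_succ_self k))
      · exact ⟨x, hxN, h⟩
    have hD : N (k + (1 + K)) x ⊆ R i (N i x) := hreg _ _ i (by omega) hx
    obtain ⟨e, he1, he2, hde⟩ : ∃ e : ℤ, -(H : ℤ) ≤ e ∧ e ≤ H + 1 ∧ ∀ z ∈ N (k + (1 + K)) x,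
        density N q R R₂ h z = ENNReal.ofReal (q ^ e) := by
      have hb := abs_le.1 (s.bd i x)
      have hs2 : Sat N (k + (1 + K)) (R₂ i (N i x)) := hN.sat_mono (by omega) (s.sat i x)
      by_cases hx2 : x ∈ R₂ i (N i x)
      · refine ⟨h i (N i x) + 1, by linarith, by linarith, fun z hz => ?_⟩
        exact (s.density_eq_of_mem hno (hD hz)).1 (hs2 x hx2 hz)
      · refine ⟨h i (N i x), by linarith, by linarith, fun z hz => ?_⟩
        exact (s.density_eq_of_mem hno (hD hz)).2 fun hz2 => hN.sat_compl hs2 x hx2 hz hz2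
    set y' := q ^ (-e) * (P ^ (1 + K))⁻¹ * y with hy'
    have hPK := pow_pos hP (1 + K)
    have hqe := zpow_pos hq0 (-e)
    have hy'I : y' ∈ I := by
      rw [hy', mul_assoc]
      refine zpow_mul_mem hq hq' _ (b.mem_of_pow_mul (1 + K) ?_)
      rwa [mul_inv_cancel_left₀ hPK.ne']
    have hqq : q ^ e * q ^ (-e) = 1 := by rw [← zpow_add₀ hq0.ne']; simp
    have hy'0 : 0 < y' := by positivity
    have hy'σ : y' < σ := by
      have h1 : q ^ (-e) * q ^ ((H : ℤ) + 1) ≤ 1 := by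
        rw [← zpow_add₀ hq0.ne']
        exact zpow_le_one₀ hq0 hq1.le (by linarith)
      calc y' < q ^ (-e) * (P ^ (1 + K))⁻¹ * (σ * P ^ (1 + K) * q ^ ((H : ℤ) + 1)) := by
            rw [hy']; exact mul_lt_mul_of_pos_left hyσ (by positivity)
        _ = σ * (q ^ (-e) * q ^ ((H : ℤ) + 1)) := by field_simp
        _ ≤ σ := mul_le_of_le_one_right b.σ_pos.le h1
    obtain ⟨A, hA, hAs, hAm⟩ := hK' y' ⟨e, by simpa using ⟨he1, he2⟩, rfl⟩ hy'I hy'0 hy'σ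
      (k + (1 + K)) x
    refine ⟨A, ?_, hN.sat_mono (by omega) hAs, ?_⟩
    · refine (hA.trans (hN.mono (Nat.le_add_right k _) x)).trans ?_
      rw [hN.eq k x₀ x hxc]
    · rw [mass_const (hN.measurableSet hmeas hAs) (zpow_pos hq0 e).le fun z hz => hde z (hA hz),
        hAm, hy', pow_add]
      have hPK' := hPK.ne'
      calc q ^ e * (P ^ k * P ^ (1 + K) * (q ^ (-e) * (P ^ (1 + K))⁻¹ * y))
          = (q ^ e * q ^ (-e)) * (P ^ (1 + K) * (P ^ (1 + K))⁻¹) * (P ^ k * y) := by ring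
        _ = P ^ k * y := by rw [hqq, mul_inv_cancel₀ hPK', one_mul, one_mul]
  · intro k A hA
    rw [hadd.cells hN hA]
    refine I.sum_mem fun c hc => ?_
    obtain ⟨x, _, rfl⟩ := hN.mem_cells.1 hc
    rcases first_hit (R := R) (N := N) x k with hno | ⟨i, hi, hx, hno⟩
    · rw [s.mass_singular b hmeas hq0 hq1 hβ hno]
      exact b.pow_mul_mem k hβI
    · have hsat' : Sat N (k + K) (N k x) := hN.sat_mono (by omega) (hN.sat_node k x)
      have hR2 : Sat N (k + K) (R₂ i (N i x)) := hN.sat_mono (by omega) (s.sat i x)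
      have hsub := hreg k x i hi hx
      rw [s.mass_eq hmeas hq0 hq1 hno hsub (hN.sat_node k x)]
      refine I.add_mem (zpow_mul_mem hq hq' _ ?_) (zpow_mul_mem hq hq' _ ?_)
      · exact (s.good i x).her _ _ (sdiff_subset.trans hsub) (hN.sat_diff hsat' hR2)
      · exact (s.good i x).her _ _ (inter_subset_left.trans hsub) (IsTree.sat_inter hsat' hR2)

end SplitData

/-- If every cell has a good part, the weights can be modified so that the tree becomes full and
all cells of level `0` get weight `β`. -/
theorem exists_full_of_goodPart [IsFiniteMeasure μ] (b : Base N P μ.real I W σ)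
    (hmeas : ∀ k x, MeasurableSet (N k x)) (hq0 : 0 < q) (hq1 : q < 1)
    (hq : ∀ y ∈ I, q * y ∈ I) (hq' : ∀ y ∈ I, q⁻¹ * y ∈ I)
    (hgood : ∀ k x, ∃ R, IsGoodPart b.tree μ P q I k (N k x) R) {β₀ : ℝ} (hβI : β₀ ∈ I)
    (hβ0 : 0 < β₀) :
    ∃ (m : Set X → ℝ) (W' : Finset ℝ) (σ' : ℝ), Full N P m I W' σ' ∧
      m univ = (b.tree.cells 0 univ).card * ((1 - q) * β₀) := by
  classical
  have hβ : 0 < (1 - q) * β₀ := mul_pos (by linarith) hβ0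
  have hβI' : (1 - q) * β₀ ∈ I := by
    rw [sub_mul, one_mul]
    exact I.sub_mem hβI (hq _ hβI)
  obtain ⟨H, K, hHK⟩ := exists_split b hq0 hq1 hq hq' hβI rfl hβ
  have h1 : ∀ k (c : Set X), ∃ R, (∃ x, c = N k x) → IsGoodPart b.tree μ P q I k c R := by
    intro k c
    by_cases hc : ∃ x, c = N k x
    · obtain ⟨x, rfl⟩ := hc
      obtain ⟨R, hR⟩ := hgood k x
      exact ⟨R, fun _ => hR⟩
    · exact ⟨∅, fun h => absurd h hc⟩
  choose R hR using h1
  have h2 : ∀ k (c : Set X), ∃ (R₂ : Set X) (h : ℤ), (∃ x, c = N k x) → R₂ ⊆ R k c ∧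
      Sat N (k + K) R₂ ∧ |h| ≤ H ∧
      q ^ h * μ.real (R k c \ R₂) + q ^ (h + 1) * μ.real R₂ =
          P ^ k * ((1 - q) * β₀ * (1 - (b.tree.cells (k + 1) (c \ R k c)).card * P)) := by
    intro k c
    by_cases hc : ∃ x, c = N k x
    · obtain ⟨x, rfl⟩ := hc
      obtain ⟨R₂, ha, hb, h, hc, hd⟩ := hHK k x _ (hR k (N k x) ⟨x, rfl⟩)
      exact ⟨R₂, h, fun _ => ⟨ha, hb, hc, hd⟩⟩
    · exact ⟨∅, 0, fun h => absurd h hc⟩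
  choose R₂ h hR₂ using h2
  have s : SplitData b.tree μ P q ((1 - q) * β₀) I H K R R₂ h :=
    ⟨fun k x => hR k _ ⟨x, rfl⟩, fun k x => (hR₂ k _ ⟨x, rfl⟩).1,
      fun k x => (hR₂ k _ ⟨x, rfl⟩).2.1, fun k x => (hR₂ k _ ⟨x, rfl⟩).2.2.1,
      fun k x => (hR₂ k _ ⟨x, rfl⟩).2.2.2⟩
  obtain ⟨W', σ', hF⟩ := s.exists_full b hmeas hq0 hq1 hq hq' hβI' hβ
  refine ⟨_, W', σ', hF, ?_⟩
  rw [hF.add.cells b.tree (IsTree.sat_univ 0), Finset.sum_congr rfl (g := fun _ => (1 - q) * β₀),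
    Finset.sum_const, nsmul_eq_mul]
  intro c hc
  obtain ⟨x, _, rfl⟩ := b.tree.mem_cells.1 hc
  rw [s.mass_singular b hmeas hq0 hq1 hβ (n := 0) (x := x) (by simp)]
  simp

end

section

section Renewal

variable {ι : Type*} [Fintype ι] {lam : ι → ℕ} {p : ℝ} {v : ℕ → ℝ} {n₀ : ℕ}

lemma exists_mem_closure_range (hgcd : Finset.univ.gcd lam = 1) :
    ∃ A, ∀ a ≥ A, a ∈ AddSubmonoid.closure (range lam) := by
  obtain ⟨A, hA⟩ := Nat.exists_mem_closure_of_ge (range lam)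
  refine ⟨A, fun a ha => hA a ha ?_⟩
  have h : Nat.setGcd (range lam) ∣ Finset.univ.gcd lam :=
    Finset.dvd_gcd fun i _ => Nat.setGcd_dvd_of_mem (mem_range_self i)
  rw [hgcd] at h
  exact h.trans (one_dvd a)

/-- Solutions of the renewal equation with masses `p ^ lam i` converge. -/
theorem exists_tendsto_of_renewal (hp0 : 0 < p) (hp : ∑ i, p ^ lam i = 1) (hlam : ∀ i, 0 < lam i)
    (hgcd : Finset.univ.gcd lam = 1) (hv : ∀ n ≥ n₀, v n = ∑ i, p ^ lam i * v (n - lam i))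
    {B : ℝ} (h0 : ∀ n, 0 ≤ v n) (hB : ∀ n, v n ≤ B) :
    ∃ L, Filter.Tendsto v Filter.atTop (nhds L) := by
  set L := Filter.limsup v Filter.atTop with hL
  have hbdd : Filter.IsBoundedUnder (· ≤ ·) Filter.atTop v := ⟨B, by simp [hB]⟩
  have hbdd' : Filter.IsBoundedUnder (· ≥ ·) Filter.atTop v := ⟨0, by simp [h0]⟩
  have hup : ∀ ε > 0, ∃ n1, ∀ n ≥ n1, v n ≤ L + ε := by
    intro ε hε
    have : ∀ᶠ n in Filter.atTop, v n < L + ε :=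
      Filter.eventually_lt_of_limsup_lt (by linarith) hbdd
    obtain ⟨n1, h⟩ := Filter.eventually_atTop.1 this
    exact ⟨n1, fun n hn => (h n hn).le⟩
  have hfr : ∀ ε > 0, ∀ n1, ∃ n ≥ n1, L - ε ≤ v n := by
    intro ε hε n1
    have : ∃ᶠ n in Filter.atTop, L - ε < v n :=
      Filter.frequently_lt_of_lt_limsup hbdd'.isCoboundedUnder_le (by linarith)
    obtain ⟨n, hn, h⟩ := Filter.frequently_atTop.1 this n1
    exact ⟨n, hn, h.le⟩
  have hcl : ∀ a ∈ AddSubmonoid.closure (range lam), ∀ ε > 0, ∃ η > 0, ∃ n1, ∀ n ≥ n1,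
      L - η ≤ v n → L - ε ≤ v (n - a) := by
    intro a ha
    induction ha using AddSubmonoid.closure_induction with
    | zero => exact fun ε hε => ⟨ε, hε, 0, fun n _ h => h⟩
    | mem a ha =>
      obtain ⟨i, rfl⟩ := ha
      intro ε hε
      have hP := pow_pos hp0 (lam i)
      obtain ⟨n1, hn1⟩ := hup (ε * p ^ lam i / 2) (by positivity)
      set Λ := ∑ i, lam i
      refine ⟨ε * p ^ lam i / 2, by positivity, max n₀ (n1 + Λ), fun n hn h => ?_⟩
      classical
      rw [hv n (le_of_max_le_left hn), ← Finset.add_sum_erase _ _ (Finset.mem_univ i)] at h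
      have h1 : ∑ j ∈ Finset.univ.erase i, p ^ lam j * v (n - lam j) ≤
          ∑ j ∈ Finset.univ.erase i, p ^ lam j * (L + ε * p ^ lam i / 2) := by
        refine Finset.sum_le_sum fun j _ => ?_
        have : lam j ≤ Λ := Finset.single_le_sum (fun _ _ => Nat.zero_le _) (Finset.mem_univ j)
        have h2 := le_of_max_le_right hn
        exact mul_le_mul_of_nonneg_left (hn1 _ (by omega)) (pow_pos hp0 _).le
      rw [← Finset.sum_mul] at h1
      have h3 := Finset.add_sum_erase Finset.univ (fun j => p ^ lam j) (Finset.mem_univ i)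
      rw [hp] at h3
      have h4 : ∑ j ∈ Finset.univ.erase i, p ^ lam j = 1 - p ^ lam i := by linarith
      rw [h4] at h1
      have h5 : p ^ lam i * (L - ε) ≤ p ^ lam i * v (n - lam i) := by
        nlinarith [mul_pos (mul_pos hε hP) hP]
      exact le_of_mul_le_mul_left h5 hP
    | add a b _ _ iha ihb =>
      intro ε hε
      obtain ⟨η, hη, n1, h1⟩ := ihb ε hε
      obtain ⟨η', hη', n2, h2⟩ := iha η hη
      refine ⟨η', hη', n1 + n2 + a, fun n hn h => ?_⟩
      rw [← Nat.sub_sub]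
      exact h1 _ (by omega) (h2 n (by omega) h)
  obtain ⟨A, hA⟩ := exists_mem_closure_range hgcd
  set Λ := ∑ i, lam i with hΛ
  have hΛle : ∀ i, lam i ≤ Λ := fun i =>
    Finset.single_le_sum (fun _ _ => Nat.zero_le _) (Finset.mem_univ i)
  have hlow : ∀ ε > 0, ∃ n1, ∀ n ≥ n1, L - ε ≤ v n := by
    intro ε hε
    have h1 : ∀ D, ∃ η > 0, ∃ n1, ∀ n ≥ n1, L - η ≤ v n → ∀ d < D, L - ε ≤ v (n - (A + d)) := by
      intro D
      induction D with
      | zero => exact ⟨1, one_pos, 0, by simp⟩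
      | succ D ih =>
        obtain ⟨η, hη, n1, h1⟩ := ih
        obtain ⟨η', hη', n2, h2⟩ := hcl (A + D) (hA _ (Nat.le_add_right _ _)) ε hε
        refine ⟨min η η', lt_min hη hη', max n1 n2, fun n hn h d hd => ?_⟩
        rcases Nat.lt_succ_iff_lt_or_eq.1 hd with hd | rfl
        · exact h1 n (le_of_max_le_left hn) (by linarith [min_le_left η η']) d hd
        · exact h2 n (le_of_max_le_right hn) (by linarith [min_le_right η η'])
    obtain ⟨η, hη, n1, h1⟩ := h1 (Λ + 1)
    obtain ⟨n, hn, h2⟩ := hfr η hη (n1 + n₀ + A + Λ)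
    refine ⟨n - A - Λ, fun k hk => ?_⟩
    induction k using Nat.strong_induction_on with
    | _ k ih =>
      by_cases hkn : k ≤ n - A
      · have := h1 n (by omega) h2 (n - A - k) (by omega)
        rwa [show n - (A + (n - A - k)) = k by omega] at this
      · rw [hv k (by omega)]
        calc L - ε = ∑ i, p ^ lam i * (L - ε) := by rw [← Finset.sum_mul, hp, one_mul]
          _ ≤ _ := Finset.sum_le_sum fun i _ => mul_le_mul_of_nonneg_left
            (ih _ (by have := hlam i; omega) (by have := hΛle i; omega)) (pow_pos hp0 _).le
  refine ⟨L, Metric.tendsto_atTop.2 fun ε hε => ?_⟩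
  obtain ⟨n1, h1⟩ := hlow (ε / 2) (by positivity)
  obtain ⟨n2, h2⟩ := hup (ε / 2) (by positivity)
  refine ⟨max n1 n2, fun n hn => ?_⟩
  rw [Real.dist_eq, abs_lt]
  have := h1 n (le_of_max_le_left hn)
  have := h2 n (le_of_max_le_right hn)
  constructor <;> linarith

/-- A nonnegative solution of the renewal equation not vanishing on a window has positive limit. -/
theorem limit_pos_of_renewal (hp0 : 0 < p) (hp : ∑ i, p ^ lam i = 1)
    (hv : ∀ n ≥ n₀, v n = ∑ i, p ^ lam i * v (n - lam i)) (h0 : ∀ n, 0 ≤ v n) (i₀ : ι)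
    {a : ℕ} (ha : a < n₀) (ha' : n₀ ≤ a + lam i₀)
    (hva : 0 < v a) {L : ℝ} (hL : Filter.Tendsto v Filter.atTop (nhds L)) : 0 < L := by
  set Φ : ℕ → ℝ := fun n => ∑ i, p ^ lam i * ∑ s ∈ Finset.range (lam i), v (n - 1 - s) with hΦ
  have hconst : ∀ n ≥ n₀, Φ n = Φ n₀ := by
    intro n hn
    induction n, hn using Nat.le_induction with
    | base => rfl
    | succ n hn ih =>
      rw [← ih, ← sub_eq_zero, hΦ]
      simp only
      rw [← Finset.sum_sub_distrib]
      have : ∀ i, p ^ lam i * ∑ s ∈ Finset.range (lam i), v (n + 1 - 1 - s) -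
          p ^ lam i * ∑ s ∈ Finset.range (lam i), v (n - 1 - s) =
          p ^ lam i * v n - p ^ lam i * v (n - lam i) := by
        intro i
        have h1 : ∀ s, v (n - 1 - s) = v (n - (s + 1)) := fun s => by congr 1; omega
        simp only [h1, Nat.add_sub_cancel]
        have h2 := Finset.sum_range_succ (fun s => v (n - s)) (lam i)
        have h3 := Finset.sum_range_succ' (fun s => v (n - s)) (lam i)
        simp only [Nat.sub_zero] at h3
        rw [← mul_sub, ← mul_sub]
        congr 1
        linarith
      simp only [this]
      rw [Finset.sum_sub_distrib, ← Finset.sum_mul, hp, one_mul, ← hv n hn, sub_self]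
  have hpos : 0 < Φ n₀ := by
    have h1 : 0 < p ^ lam i₀ * ∑ s ∈ Finset.range (lam i₀), v (n₀ - 1 - s) := by
      refine mul_pos (pow_pos hp0 _) (lt_of_lt_of_le hva ?_)
      have := Finset.single_le_sum (f := fun s => v (n₀ - 1 - s)) (fun s _ => h0 _)
        (Finset.mem_range.2 (show n₀ - 1 - a < lam i₀ by omega))
      simpa [show n₀ - 1 - (n₀ - 1 - a) = a by omega] using this
    refine lt_of_lt_of_le h1 ?_
    exact Finset.single_le_sum (f := fun i => p ^ lam i * ∑ s ∈ Finset.range (lam i), v (n₀ - 1 - s))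
      (fun i _ => mul_nonneg (pow_pos hp0 _).le (Finset.sum_nonneg fun s _ => h0 _))
      (Finset.mem_univ i₀)
  have hlim : Filter.Tendsto Φ Filter.atTop (nhds (∑ i, p ^ lam i * ∑ _s ∈ Finset.range (lam i), L)) := by
    refine tendsto_finsetSum _ fun i _ => Filter.Tendsto.const_mul _ ?_
    refine tendsto_finsetSum _ fun s _ => hL.comp ?_
    simp only [Nat.sub_sub]
    exact Filter.tendsto_sub_atTop_nat _
  have heq : ∑ i, p ^ lam i * ∑ _s ∈ Finset.range (lam i), L = Φ n₀ := by
    refine tendsto_nhds_unique hlim (tendsto_const_nhds.congr' ?_)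
    filter_upwards [Filter.eventually_ge_atTop n₀] with n hn
    exact (hconst n hn).symm
  by_contra hneg
  have hL0 : L = 0 := le_antisymm (not_lt.1 hneg) (ge_of_tendsto' hL h0)
  rw [hL0] at heq
  simp at heq
  linarith

end Renewal

end

section

section Words

variable {ι : Type*} {lam : ι → ℕ}

/-- The level of a word. -/
def lev (lam : ι → ℕ) (u : List ι) : ℕ := (u.map lam).sum

@[simp] lemma lev_nil : lev lam [] = 0 := rfl

@[simp] lemma lev_cons (i : ι) (u : List ι) : lev lam (i :: u) = lam i + lev lam u := by simp [lev]

@[simp] lemma lev_append (u v : List ι) : lev lam (u ++ v) = lev lam u + lev lam v := by simp [lev]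

/-- `u` is a shortest word of level at least `k`. -/
def IsCut (lam : ι → ℕ) : List ι → ℕ → Prop
  | [], k => k = 0
  | i :: u, k => 0 < k ∧ IsCut lam u (k - lam i)

lemma isCut_nil {k : ℕ} : IsCut lam [] k ↔ k = 0 := Iff.rfl

lemma isCut_cons {i : ι} {u : List ι} {k : ℕ} :
    IsCut lam (i :: u) k ↔ 0 < k ∧ IsCut lam u (k - lam i) := Iff.rfl

lemma IsCut.le {u : List ι} {k : ℕ} (h : IsCut lam u k) : k ≤ lev lam u := by
  induction u generalizing k with
  | nil => exact (isCut_nil.1 h).le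
  | cons i u ih =>
    have := ih (isCut_cons.1 h).2
    rw [lev_cons]
    omega

lemma IsCut.lt {Λ : ℕ} (hΛ0 : 0 < Λ) (hΛ : ∀ i, lam i ≤ Λ) {u : List ι} {k : ℕ}
    (h : IsCut lam u k) : lev lam u < k + Λ := by
  induction u generalizing k with
  | nil => simp only [lev_nil]; omega
  | cons i u ih =>
    obtain ⟨h1, h2⟩ := isCut_cons.1 h
    have := ih h2
    have := hΛ i
    rw [lev_cons]
    rcases le_total (lam i) k with h3 | h3
    · omega
    · rw [Nat.sub_eq_zero_of_le h3] at h2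
      cases u with
      | nil => simp only [lev_nil]; omega
      | cons j u => exact absurd (isCut_cons.1 h2).1 (lt_irrefl 0)

lemma IsCut.append {w v : List ι} {k : ℕ} (hlam : ∀ i, 0 < lam i) (h : IsCut lam v k) :
    IsCut lam (w ++ v) (lev lam w + k) := by
  induction w with
  | nil => simpa using h
  | cons i w ih =>
    rw [List.cons_append, isCut_cons, lev_cons]
    refine ⟨by have := hlam i; omega, ?_⟩
    rwa [show lam i + lev lam w + k - lam i = lev lam w + k by omega]

lemma isCut_lev (hlam : ∀ i, 0 < lam i) (u : List ι) : IsCut lam u (lev lam u) := by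
  simpa using (isCut_nil.2 rfl : IsCut lam [] 0).append (w := u) hlam

lemma exists_cut_append {u : List ι} {k : ℕ} (h : k ≤ lev lam u) :
    ∃ v w, u = v ++ w ∧ IsCut lam v k := by
  induction u generalizing k with
  | nil => exact ⟨[], [], rfl, isCut_nil.2 (by simpa using h)⟩
  | cons i u ih =>
    rcases Nat.eq_zero_or_pos k with rfl | hk
    · exact ⟨[], i :: u, rfl, rfl⟩
    · obtain ⟨v, w, rfl, hv⟩ := ih (k := k - lam i) (by rw [lev_cons] at h; omega)
      exact ⟨i :: v, w, rfl, hk, hv⟩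

variable [Fintype ι]

lemma finite_isCut (hlam : ∀ i, 0 < lam i) (k : ℕ) : {u | IsCut lam u k}.Finite := by
  induction k using Nat.strong_induction_on with
  | _ k ih =>
    rcases Nat.eq_zero_or_pos k with rfl | hk
    · refine (finite_singleton []).subset fun u hu => ?_
      cases u with
      | nil => rfl
      | cons i u => exact absurd (isCut_cons.1 hu).1 (lt_irrefl 0)
    · refine (finite_iUnion fun i => (ih (k - lam i) (by have := hlam i; omega)).image
        (List.cons i)).subset fun u hu => ?_
      cases u with
      | nil => exact absurd (isCut_nil (lam := lam).1 hu) hk.ne'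
      | cons i u => exact mem_iUnion.2 ⟨i, u, (isCut_cons.1 hu).2, rfl⟩

/-- The finite set of shortest words of level at least `k`. -/
def cuts (hlam : ∀ i, 0 < lam i) (k : ℕ) : Finset (List ι) := (finite_isCut hlam k).toFinset

@[simp] lemma mem_cuts {hlam : ∀ i, 0 < lam i} {k : ℕ} {u : List ι} :
    u ∈ cuts hlam k ↔ IsCut lam u k := by simp [cuts]

lemma cuts_zero (hlam : ∀ i, 0 < lam i) : cuts hlam 0 = {[]} := by
  ext u
  rw [mem_cuts, Finset.mem_singleton]
  cases u with
  | nil => simp [isCut_nil]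
  | cons i u => simp [isCut_cons]

lemma sum_cuts {M : Type*} [AddCommMonoid M] (hlam : ∀ i, 0 < lam i) {k : ℕ} (hk : 0 < k)
    (g : List ι → M) :
    ∑ u ∈ cuts hlam k, g u = ∑ i, ∑ u ∈ cuts hlam (k - lam i), g (i :: u) := by
  classical
  have h : cuts hlam k = Finset.univ.biUnion fun i =>
      (cuts hlam (k - lam i)).image (List.cons i) := by
    ext u
    simp only [mem_cuts, Finset.mem_biUnion, Finset.mem_univ, true_and, Finset.mem_image]
    cases u with
    | nil => simp [isCut_nil, hk.ne']
    | cons i u => simp [isCut_cons, hk]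
  rw [h, Finset.sum_biUnion]
  · refine Finset.sum_congr rfl fun i _ => Finset.sum_image ?_
    intro a _ b _ h
    simpa using h
  · intro i _ j _ hij
    rw [Function.onFun, Finset.disjoint_left]
    intro u hu hu'
    obtain ⟨a, _, rfl⟩ := Finset.mem_image.1 hu
    obtain ⟨b, _, hb⟩ := Finset.mem_image.1 hu'
    exact hij (List.cons.inj hb).1.symm

lemma sum_cuts_pow {p : ℝ} (hp : ∑ i, p ^ lam i = 1) (hlam : ∀ i, 0 < lam i) (k : ℕ) :
    ∑ u ∈ cuts hlam k, p ^ lev lam u = 1 := by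
  induction k using Nat.strong_induction_on with
  | _ k ih =>
    rcases Nat.eq_zero_or_pos k with rfl | hk
    · simp [cuts_zero]
    · rw [sum_cuts hlam hk, ← hp]
      refine Finset.sum_congr rfl fun i _ => ?_
      simp only [lev_cons, pow_add]
      rw [← Finset.mul_sum, ih _ (by have := hlam i; omega), mul_one]

/-- The number of words in the cut of level `n` whose level is `n + j`. -/
def cutCount (hlam : ∀ i, 0 < lam i) (j n : ℕ) : ℕ :=
  ((cuts hlam n).filter fun u => lev lam u = n + j).card

lemma cutCount_eq (hlam : ∀ i, 0 < lam i) {j n : ℕ} (hn : 0 < n) (hn' : ∀ i, lam i ≤ n) :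
    cutCount hlam j n = ∑ i, cutCount hlam j (n - lam i) := by
  simp only [cutCount, Finset.card_filter]
  rw [sum_cuts hlam hn]
  refine Finset.sum_congr rfl fun i _ => Finset.sum_congr rfl fun u _ => ?_
  have : lev lam (i :: u) = n + j ↔ lev lam u = n - lam i + j := by
    rw [lev_cons]
    have := hn' i
    omega
  simp only [this]

lemma sum_cuts_fiber {Λ : ℕ} (hΛ0 : 0 < Λ) (hΛ : ∀ i, lam i ≤ Λ) (hlam : ∀ i, 0 < lam i) (n : ℕ)
    (p : ℝ) : ∑ u ∈ cuts hlam n, p ^ lev lam u =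
      ∑ j ∈ Finset.range Λ, cutCount hlam j n * p ^ (n + j) := by
  rw [← Finset.sum_fiberwise_of_maps_to (s := cuts hlam n) (t := Finset.range Λ)
    (g := fun u => lev lam u - n)]
  · refine Finset.sum_congr rfl fun j _ => ?_
    have : (cuts hlam n).filter (fun u => lev lam u - n = j) =
        (cuts hlam n).filter fun u => lev lam u = n + j := by
      refine Finset.filter_congr fun u hu => ?_
      have := (mem_cuts.1 hu).le
      omega
    rw [this, cutCount, Finset.sum_congr rfl (g := fun _ => p ^ (n + j)), Finset.sum_const,
      nsmul_eq_mul]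
    intro u hu
    rw [(Finset.mem_filter.1 hu).2]
  · intro u hu
    have := (mem_cuts.1 hu).lt hΛ0 hΛ
    have := (mem_cuts.1 hu).le
    exact Finset.mem_range.2 (by omega)

lemma exists_cutCount_tendsto {p : ℝ} (hp0 : 0 < p) (hp : ∑ i, p ^ lam i = 1)
    (hlam : ∀ i, 0 < lam i) (hgcd : Finset.univ.gcd lam = 1) (i₀ : ι) (hi₀ : ∀ i, lam i ≤ lam i₀)
    {j : ℕ} (hj : j < lam i₀) :
    ∃ κ > 0, Filter.Tendsto (fun n => cutCount hlam j n * p ^ n) Filter.atTop (nhds κ) := by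
  have hrec : ∀ n ≥ lam i₀ + 1, (cutCount hlam j n * p ^ n : ℝ) =
      ∑ i, p ^ lam i * (cutCount hlam j (n - lam i) * p ^ (n - lam i)) := by
    intro n hn
    have hle : ∀ i, lam i ≤ n := fun i => (hi₀ i).trans (by omega)
    rw [cutCount_eq hlam (by omega) hle, Nat.cast_sum, Finset.sum_mul]
    refine Finset.sum_congr rfl fun i _ => ?_
    rw [mul_left_comm, ← pow_add, Nat.add_sub_cancel' (hle i)]
  have h0 : ∀ n, (0 : ℝ) ≤ cutCount hlam j n * p ^ n := fun n => by positivity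
  have hB : ∀ n, (cutCount hlam j n * p ^ n : ℝ) ≤ (p ^ j)⁻¹ := by
    intro n
    have h1 := sum_cuts_pow hp hlam n
    rw [sum_cuts_fiber (hlam i₀) hi₀] at h1
    have h2 := Finset.single_le_sum (f := fun j => (cutCount hlam j n * p ^ (n + j) : ℝ))
      (fun j _ => by positivity) (Finset.mem_range.2 hj)
    rw [h1] at h2
    rw [← one_div, le_div_iff₀ (pow_pos hp0 j), mul_assoc, ← pow_add]
    exact h2
  obtain ⟨κ, hκ⟩ := exists_tendsto_of_renewal hp0 hp hlam hgcd hrec h0 hB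
  refine ⟨κ, ?_, hκ⟩
  refine limit_pos_of_renewal hp0 hp hrec h0 i₀ (a := lam i₀ - j) (by omega) (by omega) ?_ hκ
  have : 0 < cutCount hlam j (lam i₀ - j) := by
    refine Finset.card_pos.2 ⟨[i₀], Finset.mem_filter.2 ⟨mem_cuts.2 ⟨by omega, ?_⟩, ?_⟩⟩
    · exact isCut_nil.2 (by omega)
    · simp only [lev_cons, lev_nil]; omega
  positivity

lemma exists_polynomial_of_mem_Zring {p x : ℝ} (hx : x ∈ Zring p) :
    ∃ P : Polynomial ℤ, Polynomial.aeval p P = x := by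
  induction hx using Subring.closure_induction with
  | mem x hx => exact ⟨Polynomial.X, by simpa using (mem_singleton_iff.1 hx).symm⟩
  | zero => exact ⟨0, by simp⟩
  | one => exact ⟨1, by simp⟩
  | add x y _ _ hx hy =>
    obtain ⟨P, rfl⟩ := hx
    obtain ⟨Q, rfl⟩ := hy
    exact ⟨P + Q, by simp⟩
  | neg x _ hx => obtain ⟨P, rfl⟩ := hx; exact ⟨-P, by simp⟩
  | mul x y _ _ hx hy =>
    obtain ⟨P, rfl⟩ := hx
    obtain ⟨Q, rfl⟩ := hy
    exact ⟨P * Q, by simp⟩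

/-- Each element of `ℤ[p] ∩ (0, 1)` is the mass of a set of words in some cut. -/
theorem exists_subset_cuts {p : ℝ} (hp0 : 0 < p) (hp : ∑ i, p ^ lam i = 1)
    (hlam : ∀ i, 0 < lam i) (hgcd : Finset.univ.gcd lam = 1) {q : ℝ} (hq : q ∈ Zring p)
    (hq0 : 0 < q) (hq1 : q < 1) :
    ∃ n, ∃ C ⊆ cuts hlam n, ∑ u ∈ C, p ^ lev lam u = q := by
  classical
  have hne : Nonempty ι := by
    by_contra h
    rw [not_nonempty_iff] at h
    simp at hp
  obtain ⟨i₀, -, hi₀'⟩ := Finset.exists_max_image Finset.univ lam Finset.univ_nonempty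
  have hi₀ : ∀ i, lam i ≤ lam i₀ := fun i => hi₀' i (Finset.mem_univ i)
  set Λ := lam i₀ with hΛ
  have h1 : ∀ j, ∃ κ : ℝ, j < Λ → 0 < κ ∧
      Filter.Tendsto (fun n => cutCount hlam j n * p ^ n) Filter.atTop (nhds κ) := by
    intro j
    by_cases hj : j < Λ
    · obtain ⟨κ, h1, h2⟩ := exists_cutCount_tendsto hp0 hp hlam hgcd i₀ hi₀ hj
      exact ⟨κ, fun _ => ⟨h1, h2⟩⟩
    · exact ⟨0, fun h => absurd h hj⟩
  choose κ hκ using h1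
  have hrep : ∀ Q : Polynomial ℤ, ∃ B : ℕ → ℕ → ℤ,
      (∀ᶠ n in Filter.atTop, Polynomial.aeval p Q = ∑ j ∈ Finset.range Λ, (B n j : ℝ) * p ^ (n + j)) ∧
      ∀ j < Λ, Filter.Tendsto (fun n => (B n j : ℝ) * p ^ n) Filter.atTop
        (nhds (Polynomial.aeval p Q * κ j)) := by
    intro Q
    induction Q using Polynomial.induction_on with
    | C b =>
      refine ⟨fun n j => b * cutCount hlam j n, Filter.Eventually.of_forall fun n => ?_, ?_⟩
      · have h1 := sum_cuts_pow hp hlam n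
        rw [sum_cuts_fiber (hlam i₀) hi₀] at h1
        simp only [Int.cast_mul, Int.cast_natCast, mul_assoc]
        rw [← Finset.mul_sum, h1]
        simp
      · intro j hj
        simp only [Int.cast_mul, Int.cast_natCast, mul_assoc]
        simpa using (hκ j hj).2.const_mul (b : ℝ)
    | add P Q hP hQ =>
      obtain ⟨B, h1, h2⟩ := hP
      obtain ⟨B', h1', h2'⟩ := hQ
      refine ⟨fun n j => B n j + B' n j, ?_, fun j hj => ?_⟩
      · filter_upwards [h1, h1'] with n hn hn'
        rw [map_add, hn, hn', ← Finset.sum_add_distrib]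
        exact Finset.sum_congr rfl fun j _ => by push_cast; ring
      · have := (h2 j hj).add (h2' j hj)
        simp only [Int.cast_add, map_add, add_mul]
        exact this
    | monomial t b h =>
      obtain ⟨B, h1, h2⟩ := h
      refine ⟨fun n j => B (n - 1) j, ?_, fun j hj => ?_⟩
      · filter_upwards [(Filter.tendsto_sub_atTop_nat 1).eventually h1,
          Filter.eventually_ge_atTop 1] with n hn hn1
        rw [pow_succ, ← mul_assoc, map_mul, hn, Polynomial.aeval_X, Finset.sum_mul]
        refine Finset.sum_congr rfl fun j _ => ?_
        obtain ⟨n, rfl⟩ := Nat.exists_eq_add_of_le' hn1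
        rw [Nat.add_sub_cancel, mul_assoc, ← pow_succ]
        congr 2
        omega
      · have h3 := ((h2 j hj).comp (Filter.tendsto_sub_atTop_nat 1)).mul_const p
        rw [pow_succ, ← mul_assoc, map_mul _ _ Polynomial.X, Polynomial.aeval_X, mul_right_comm]
        refine h3.congr' ?_
        filter_upwards [Filter.eventually_ge_atTop 1] with n hn1
        obtain ⟨n, rfl⟩ := Nat.exists_eq_add_of_le' hn1
        simp only [Function.comp, Nat.add_sub_cancel, pow_succ, mul_assoc]
  obtain ⟨Q, rfl⟩ := exists_polynomial_of_mem_Zring hq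
  obtain ⟨B, hB1, hB2⟩ := hrep Q
  set q := Polynomial.aeval p Q
  have hB3 : ∀ᶠ n in Filter.atTop, ∀ j ∈ Finset.range Λ, 0 ≤ B n j ∧ B n j ≤ cutCount hlam j n := by
    rw [Filter.eventually_all_finset]
    intro j hj
    have hj := Finset.mem_range.1 hj
    obtain ⟨hκ0, hκt⟩ := hκ j hj
    have h2 : ∀ᶠ n in Filter.atTop, (0 : ℝ) < B n j * p ^ n :=
      (hB2 j hj).eventually_const_lt (by positivity)
    have h3 : ∀ᶠ n in Filter.atTop, (0 : ℝ) < cutCount hlam j n * p ^ n - B n j * p ^ n := by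
      refine (hκt.sub (hB2 j hj)).eventually_const_lt ?_
      nlinarith
    filter_upwards [h2, h3] with n h2 h3
    have hpn := pow_pos hp0 n
    rw [← sub_mul] at h3
    have h2 := (mul_pos_iff_of_pos_right hpn).1 h2
    have h3 := (mul_pos_iff_of_pos_right hpn).1 h3
    constructor
    · exact_mod_cast h2.le
    · have : (B n j : ℝ) ≤ cutCount hlam j n := by linarith
      exact_mod_cast this
  obtain ⟨n, hn1, hn2⟩ := (hB1.and hB3).exists
  have hsub : ∀ j, ∃ C ⊆ (cuts hlam n).filter fun u => lev lam u = n + j,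
      j < Λ → (C.card : ℤ) = B n j := by
    intro j
    by_cases hj : j < Λ
    · obtain ⟨h0, h1⟩ := hn2 j (Finset.mem_range.2 hj)
      obtain ⟨C, hC, hcard⟩ := Finset.exists_subset_card_eq
        (s := (cuts hlam n).filter fun u => lev lam u = n + j) (n := (B n j).toNat)
        (by rw [← cutCount]; omega)
      exact ⟨C, hC, fun _ => by omega⟩
    · exact ⟨∅, Finset.empty_subset _, fun h => absurd h hj⟩
  choose C hC hcard using hsub
  have hlev : ∀ j, ∀ u ∈ C j, lev lam u = n + j := fun j u hu => (Finset.mem_filter.1 (hC j hu)).2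
  refine ⟨n, (Finset.range Λ).biUnion C, ?_, ?_⟩
  · exact Finset.biUnion_subset.2 fun j _ => (hC j).trans (Finset.filter_subset _ _)
  · rw [Finset.sum_biUnion, hn1]
    · refine Finset.sum_congr rfl fun j hj => ?_
      rw [Finset.sum_congr rfl (g := fun _ => p ^ (n + j)) fun u hu => by rw [hlev j u hu],
        Finset.sum_const, nsmul_eq_mul, ← hcard j (Finset.mem_range.1 hj)]
      simp
    · intro i _ j _ hij
      rw [Function.onFun, Finset.disjoint_left]
      intro u hu hu'
      have := hlev i u hu
      have := hlev j u hu'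
      omega

end Words

end

section

section Similarity

variable {V : Type*} [NormedAddCommGroup V] [InnerProductSpace ℝ V] [FiniteDimensional ℝ V]

lemma surjective_of_dist_eq {f : V → V} {c : ℝ} (hc : 0 < c)
    (hf : ∀ x y, dist (f x) (f y) = c * dist x y) : Function.Surjective f := by
  have hg : Isometry fun x => c⁻¹ • f x := by
    refine Isometry.of_dist_eq fun x y => ?_
    rw [dist_smul₀, hf, Real.norm_of_nonneg (by positivity), inv_mul_cancel_left₀ hc.ne']
  have h1 : Function.Surjective hg.affineIsometryOfStrictConvexSpace := by
    have h2 : Function.Surjective hg.affineIsometryOfStrictConvexSpace.toAffineMap.linear :=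
      LinearMap.surjective_of_injective
        hg.affineIsometryOfStrictConvexSpace.linearIsometry.injective
    exact (AffineMap.linear_surjective_iff _).1 h2
  intro y
  obtain ⟨x, hx⟩ := h1 (c⁻¹ • y)
  exact ⟨x, smul_right_injective V (inv_ne_zero hc.ne') hx⟩

lemma image_ball_of_dist_eq {f : V → V} {c : ℝ} (hc : 0 < c)
    (hf : ∀ x y, dist (f x) (f y) = c * dist x y) (x : V) (ρ : ℝ) :
    f '' ball x ρ = ball (f x) (c * ρ) := by
  ext y
  constructor
  · rintro ⟨z, hz, rfl⟩
    rw [mem_ball, hf]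
    exact mul_lt_mul_of_pos_left hz hc
  · intro hy
    obtain ⟨z, rfl⟩ := surjective_of_dist_eq hc hf y
    rw [mem_ball, hf] at hy
    exact ⟨z, lt_of_mul_lt_mul_left hy hc.le, rfl⟩

lemma isOpen_image_of_dist_eq {f : V → V} {c : ℝ} (hc : 0 < c)
    (hf : ∀ x y, dist (f x) (f y) = c * dist x y) {O : Set V} (hO : IsOpen O) :
    IsOpen (f '' O) := by
  rw [Metric.isOpen_iff] at hO ⊢
  rintro _ ⟨x, hx, rfl⟩
  obtain ⟨ρ, hρ, h⟩ := hO x hx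
  refine ⟨c * ρ, mul_pos hc hρ, ?_⟩
  rw [← image_ball_of_dist_eq hc hf]
  exact image_mono h

omit [InnerProductSpace ℝ V] [FiniteDimensional ℝ V] in
lemma injective_of_dist_eq {f : V → V} {c : ℝ} (hc : 0 < c)
    (hf : ∀ x y, dist (f x) (f y) = c * dist x y) : Function.Injective f := by
  intro x y h
  have := hf x y
  rw [h, dist_self] at this
  exact dist_eq_zero.1 ((mul_eq_zero.1 this.symm).resolve_left hc.ne')

omit [InnerProductSpace ℝ V] [FiniteDimensional ℝ V] in
lemma continuous_of_dist_eq {f : V → V} {c : ℝ} (hc : 0 < c)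
    (hf : ∀ x y, dist (f x) (f y) = c * dist x y) : Continuous f :=
  (LipschitzWith.of_dist_le_mul (K := ⟨c, hc.le⟩) fun x y => (hf x y).le).continuous

/-- The number of points in a ball which are pairwise far apart is bounded, uniformly in scale. -/
lemma exists_packing_bound (R ε : ℝ) (hε : 0 < ε) : ∃ M : ℕ, ∀ {α : Type} (s : Finset α) (y : α → V)
    (x : V) (t : ℝ), 0 < t → (∀ a ∈ s, dist (y a) x ≤ R * t) →
    (∀ a ∈ s, ∀ b ∈ s, a ≠ b → ε * t ≤ dist (y a) (y b)) → s.card ≤ M := by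
  obtain ⟨T, -, hT, hcov⟩ := (isCompact_closedBall (0 : V) R).finite_cover_balls (e := ε / 2)
    (by positivity)
  refine ⟨hT.toFinset.card, fun s y x t ht h1 h2 => ?_⟩
  have hmem : ∀ a ∈ s, ∃ c ∈ T, dist (t⁻¹ • (y a - x)) c < ε / 2 := by
    intro a ha
    have : t⁻¹ • (y a - x) ∈ closedBall (0 : V) R := by
      rw [mem_closedBall, dist_zero_right, norm_smul, ← dist_eq_norm,
        Real.norm_of_nonneg (by positivity), inv_mul_le_iff₀ ht, mul_comm]
      exact h1 a ha
    obtain ⟨c, hc, hd⟩ := mem_iUnion₂.1 (hcov this)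
    exact ⟨c, hc, hd⟩
  choose! c hcT hcd using hmem
  refine Finset.card_le_card_of_injOn c (fun a ha => by simpa using hcT a ha) ?_
  intro a ha b hb hab
  by_contra hne
  have h3 := h2 a ha b hb hne
  have h4 := hcd a ha
  have h5 := hcd b hb
  rw [← show c a = c b from hab] at h5
  have h6 : dist (t⁻¹ • (y a - x)) (t⁻¹ • (y b - x)) < ε :=
    (dist_triangle_right _ _ (c a)).trans_lt (by linarith)
  rw [dist_smul₀, Real.norm_of_nonneg (by positivity), dist_sub_right, inv_mul_lt_iff₀ ht] at h6
  linarith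

end Similarity

/-- An iterated function system with attractor, the open set condition and ratios `r ^ lam i`. -/
structure IFS.IsSys {d : ℕ} (S : IFS d) (lam : S.ι → ℕ) (r : ℝ) : Prop where
  r_pos : 0 < r
  r_lt : r < 1
  lam_pos : ∀ i, 0 < lam i
  r_eq : ∀ i, S.r i = r ^ lam i
  attr : S.IsAttractor S.attractor
  osc : S.OSC

/-- The composition of the maps of the system along a word. -/
def IFS.word {d : ℕ} (S : IFS d) (u : List S.ι) (x : EuclideanSpace ℝ (Fin d)) :
    EuclideanSpace ℝ (Fin d) := u.foldr S.f x

/-- The cylinder of a word. -/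
def IFS.cyl {d : ℕ} (S : IFS d) (u : List S.ι) : Set (EuclideanSpace ℝ (Fin d)) :=
  S.word u '' S.attractor

namespace IFS

variable {d : ℕ} {S : IFS d} {lam : S.ι → ℕ} {r : ℝ}

@[simp] lemma word_nil : S.word [] = id := rfl

lemma word_cons (i : S.ι) (u : List S.ι) : S.word (i :: u) = S.f i ∘ S.word u := rfl

lemma word_append (u v : List S.ι) : S.word (u ++ v) = S.word u ∘ S.word v := by
  funext x
  simp [word]

lemma word_append_image (u v : List S.ι) (A : Set (EuclideanSpace ℝ (Fin d))) :
    S.word (u ++ v) '' A = S.word u '' (S.word v '' A) := by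
  rw [word_append, image_comp]

@[simp] lemma cyl_nil : S.cyl [] = S.attractor := by simp [cyl]

lemma cyl_append (u v : List S.ι) : S.cyl (u ++ v) = S.word u '' S.cyl v := by
  rw [cyl, word_append_image, cyl]

namespace IsSys

variable (h : S.IsSys lam r)
include h

lemma pow_pos (k : ℕ) : 0 < r ^ k := _root_.pow_pos h.r_pos k

lemma dist_word (u : List S.ι) (x y : EuclideanSpace ℝ (Fin d)) :
    dist (S.word u x) (S.word u y) = r ^ lev lam u * dist x y := by
  induction u with
  | nil => simp
  | cons i u ih =>
    rw [word_cons, Function.comp, Function.comp, S.sim, ih, h.r_eq, lev_cons, pow_add, mul_assoc]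

lemma word_injective (u : List S.ι) : Function.Injective (S.word u) :=
  injective_of_dist_eq (h.pow_pos _) (h.dist_word u)

lemma word_surjective (u : List S.ι) : Function.Surjective (S.word u) :=
  surjective_of_dist_eq (h.pow_pos _) (h.dist_word u)

lemma word_continuous (u : List S.ι) : Continuous (S.word u) :=
  continuous_of_dist_eq (h.pow_pos _) (h.dist_word u)

lemma nonempty : S.attractor.Nonempty := h.attr.1

lemma isCompact : IsCompact S.attractor := h.attr.2.1

lemma eq_iUnion : S.attractor = ⋃ i, S.f i '' S.attractor := h.attr.2.2

lemma cyl_nonempty (u : List S.ι) : (S.cyl u).Nonempty := h.nonempty.image _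

lemma isCompact_cyl (u : List S.ι) : IsCompact (S.cyl u) := h.isCompact.image (h.word_continuous u)

lemma cyl_subset (u : List S.ι) : S.cyl u ⊆ S.attractor := by
  induction u with
  | nil => simp
  | cons i u ih =>
    rw [cyl, word_cons, image_comp]
    refine (image_mono ih).trans ?_
    conv_rhs => rw [h.eq_iUnion]
    exact subset_iUnion (fun i => S.f i '' S.attractor) i

lemma word_mem (u : List S.ι) {x : EuclideanSpace ℝ (Fin d)} (hx : x ∈ S.attractor) :
    S.word u x ∈ S.attractor := h.cyl_subset u (mem_image_of_mem _ hx)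

lemma cyl_append_subset (u v : List S.ι) : S.cyl (u ++ v) ⊆ S.cyl u := by
  rw [cyl_append]
  exact image_mono (h.cyl_subset v)

lemma exists_mem_cyl (k : ℕ) {x : EuclideanSpace ℝ (Fin d)} (hx : x ∈ S.attractor) :
    ∃ u, IsCut lam u k ∧ x ∈ S.cyl u := by
  induction k using Nat.strong_induction_on generalizing x with
  | _ k ih =>
    rcases Nat.eq_zero_or_pos k with rfl | hk
    · exact ⟨[], isCut_nil.2 rfl, by simpa using hx⟩
    · rw [h.eq_iUnion] at hx
      obtain ⟨i, y, hy, rfl⟩ := mem_iUnion.1 hx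
      obtain ⟨u, hu, z, hz, rfl⟩ := ih (k - lam i) (by have := h.lam_pos i; omega) hy
      exact ⟨i :: u, isCut_cons.2 ⟨hk, hu⟩, z, hz, rfl⟩

lemma attractor_eq_cuts (k : ℕ) : S.attractor = ⋃ u ∈ cuts h.lam_pos k, S.cyl u := by
  ext x
  constructor
  · intro hx
    obtain ⟨u, hu, hxu⟩ := h.exists_mem_cyl k hx
    exact mem_iUnion₂.2 ⟨u, mem_cuts.2 hu, hxu⟩
  · intro hx
    obtain ⟨u, _, hxu⟩ := mem_iUnion₂.1 hx
    exact h.cyl_subset u hxu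

/-- A bound for the diameter of the attractor. -/
lemma exists_diam : ∃ D > 0, ∀ x ∈ S.attractor, ∀ y ∈ S.attractor, dist x y ≤ D := by
  obtain ⟨D, hD⟩ := Metric.isBounded_iff.1 h.isCompact.isBounded
  exact ⟨max D 1, by positivity, fun x hx y hy => (hD hx hy).trans (le_max_left _ _)⟩

omit h in
lemma image_word_subset {O : Set (EuclideanSpace ℝ (Fin d))} (hO : S.OSCSet O) (u : List S.ι) :
    S.word u '' O ⊆ O := by
  induction u with
  | nil => simp
  | cons i u ih =>
    rw [word_cons, image_comp]
    exact (image_mono ih).trans (hO.2.2.2.1 i)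

lemma disjoint_image_word {O : Set (EuclideanSpace ℝ (Fin d))} (hO : S.OSCSet O) {u v : List S.ι}
    {k : ℕ} (hu : IsCut lam u k) (hv : IsCut lam v k) (huv : u ≠ v) :
    Disjoint (S.word u '' O) (S.word v '' O) := by
  induction u generalizing v k with
  | nil =>
    cases v with
    | nil => exact absurd rfl huv
    | cons j v =>
      have h1 := isCut_nil.1 hu
      have h2 := (isCut_cons.1 hv).1
      omega
  | cons i u ih =>
    cases v with
    | nil =>
      have h1 := isCut_nil.1 hv
      have h2 := (isCut_cons.1 hu).1
      omega
    | cons j v =>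
      rw [word_cons, image_comp, word_cons, image_comp]
      by_cases hij : i = j
      · subst hij
        have hinj : Function.Injective (S.f i) := by simpa [word_cons] using h.word_injective [i]
        exact (disjoint_image_iff hinj).2 (ih (isCut_cons.1 hu).2 (isCut_cons.1 hv).2
          fun h => huv (by rw [h]))
      · exact (hO.2.2.2.2 i j hij).mono (image_mono (image_word_subset hO u))
          (image_mono (image_word_subset hO v))

lemma attractor_subset_closure {O : Set (EuclideanSpace ℝ (Fin d))} (hO : S.OSCSet O) :
    S.attractor ⊆ closure O := by
  obtain ⟨z, hz⟩ := hO.1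
  intro y hy
  rw [Metric.mem_closure_iff]
  intro ε hε
  obtain ⟨D, hD, hd⟩ := h.exists_diam
  set D' := D + dist y z + 1
  have hD' : 0 < D' := by positivity
  obtain ⟨k, hk⟩ := exists_pow_lt_of_lt_one (div_pos hε hD') h.r_lt
  obtain ⟨u, hu, x, hx, hxy⟩ := h.exists_mem_cyl k hy
  refine ⟨S.word u z, image_word_subset hO u (mem_image_of_mem _ hz), ?_⟩
  rw [← hxy, h.dist_word]
  have h1 : dist x z ≤ D' := (dist_triangle x y z).trans (by linarith [hd x hx y hy])
  have h2 : r ^ lev lam u ≤ r ^ k := pow_le_pow_of_le_one h.r_pos.le h.r_lt.le hu.le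
  calc r ^ lev lam u * dist x z ≤ r ^ k * D' :=
        mul_le_mul h2 h1 dist_nonneg (h.pow_pos k).le
    _ < ε := (lt_div_iff₀ hD').1 hk

/-- The number of cylinders of given scale meeting a ball of that scale is bounded. -/
lemma exists_cyl_bound (R : ℝ) : ∃ M : ℕ, ∀ k x (s : Finset (List S.ι)), (∀ u ∈ s, IsCut lam u k) →
    (∀ u ∈ s, ∃ y ∈ S.cyl u, dist y x ≤ R * r ^ k) → s.card ≤ M := by
  obtain ⟨O, hO⟩ := h.osc
  obtain ⟨z, hz⟩ := hO.1
  obtain ⟨ρ, hρ, hball⟩ := Metric.isOpen_iff.1 hO.2.1 z hz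
  obtain ⟨D, hD, hd⟩ := h.exists_diam
  obtain ⟨e, he⟩ := h.nonempty
  set Λ := ∑ i, lam i + 1 with hΛ
  have hΛle : ∀ i, lam i ≤ Λ := fun i =>
    (Finset.single_le_sum (fun _ _ => Nat.zero_le _) (Finset.mem_univ i)).trans (Nat.le_succ _)
  obtain ⟨M, hM⟩ := exists_packing_bound (V := EuclideanSpace ℝ (Fin d))
    (dist z e + D + R) (ρ * r ^ Λ) (mul_pos hρ (h.pow_pos Λ))
  refine ⟨M, fun k x s hs hx => hM s (fun u => S.word u z) x (r ^ k) (h.pow_pos k) ?_ ?_⟩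
  · intro u hu
    obtain ⟨_, ⟨y, hy, rfl⟩, hyx⟩ := hx u hu
    have h1 : r ^ lev lam u ≤ r ^ k := pow_le_pow_of_le_one h.r_pos.le h.r_lt.le (hs u hu).le
    have h2 : dist z y ≤ dist z e + D := (dist_triangle z e y).trans (by linarith [hd e he y hy])
    calc dist (S.word u z) x ≤ dist (S.word u z) (S.word u y) + dist (S.word u y) x :=
          dist_triangle _ _ _
      _ ≤ r ^ k * (dist z e + D) + R * r ^ k := by
          rw [h.dist_word]
          gcongr
          exact (h.pow_pos k).le
      _ = _ := by ring
  · intro u hu v hv huv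
    have h1 := h.disjoint_image_word hO (hs u hu) (hs v hv) huv
    have h2 : ball (S.word u z) (r ^ lev lam u * ρ) ⊆ S.word u '' O := by
      rw [← image_ball_of_dist_eq (h.pow_pos _) (h.dist_word u)]
      exact image_mono hball
    have h3 : ρ * r ^ Λ * r ^ k ≤ r ^ lev lam u * ρ := by
      rw [mul_assoc, ← pow_add, mul_comm]
      refine mul_le_mul_of_nonneg_right (pow_le_pow_of_le_one h.r_pos.le h.r_lt.le ?_) hρ.le
      have := (hs u hu).lt (Nat.succ_pos _) hΛle
      omega
    refine h3.trans (not_lt.1 fun h4 => ?_)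
    exact disjoint_left.1 h1 (h2 (by rw [mem_ball, dist_comm]; exact h4)) (mem_image_of_mem _ hz)

end IsSys

end IFS

end

section

section Bernoulli

variable {ι : Type} [Fintype ι] {lam : ι → ℕ} {p : ℝ}

/-- The sequences starting with the word `u`. -/
def seqCyl (u : List ι) : Set (ℕ → ι) := {ω | (List.range u.length).map ω = u}

omit [Fintype ι] in
lemma seqCyl_eq_pi (u : List ι) :
    seqCyl u = Set.pi (Finset.range u.length) fun i => {a | u[i]? = some a} := by
  ext ω
  simp only [seqCyl, Set.mem_ofPred_eq, Set.mem_pi, Finset.coe_range, mem_Iio]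
  constructor
  · intro h i hi
    have h1 : ((List.range u.length).map ω)[i]? = u[i]? := by rw [h]
    rw [← h1]
    simp [hi]
  · intro h
    refine List.ext_getElem? fun i => ?_
    by_cases hi : i < u.length
    · rw [h i hi]; simp [hi]
    · simp [not_lt.1 hi]

/-- There is a measure on sequences giving mass `p ^ lev u` to the sequences starting with `u`. -/
lemma exists_bernoulli [MeasurableSpace ι] [DiscreteMeasurableSpace ι] (hp0 : 0 ≤ p)
    (hp : ∑ i, p ^ lam i = 1) :
    ∃ ν : Measure (ℕ → ι), IsProbabilityMeasure ν ∧ (∀ u : List ι, MeasurableSet (seqCyl u)) ∧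
      ∀ u : List ι, ν (seqCyl u) = ENNReal.ofReal (p ^ lev lam u) := by
  let m : PMF ι := PMF.ofFintype (fun i => ENNReal.ofReal (p ^ lam i)) (by
    rw [← ENNReal.ofReal_sum_of_nonneg fun i _ => pow_nonneg hp0 _, hp, ENNReal.ofReal_one])
  have hmeas : ∀ (u : List ι) (i : ℕ), MeasurableSet {a | u[i]? = some a} :=
    fun u i => MeasurableSet.of_discrete
  refine ⟨Measure.infinitePi fun _ : ℕ => m.toMeasure, inferInstance, fun u => ?_, fun u => ?_⟩
  · rw [seqCyl_eq_pi]
    exact MeasurableSet.pi (Finset.countable_toSet _) fun i _ => hmeas u i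
  · rw [seqCyl_eq_pi, Measure.infinitePi_pi _ fun i _ => hmeas u i]
    induction u using List.reverseRecOn with
    | nil => simp
    | append_singleton v a ih =>
      rw [List.length_append, List.length_singleton, Finset.prod_range_succ, lev_append, pow_add,
        ENNReal.ofReal_mul (pow_nonneg hp0 _), ← ih]
      congr 1
      · refine Finset.prod_congr rfl fun i hi => ?_
        rw [List.getElem?_append_left (Finset.mem_range.1 hi)]
      · have : {b | (v ++ [a])[v.length]? = some b} = {a} := by
          ext b
          simp [eq_comm]
        rw [this, PMF.toMeasure_apply_singleton _ _ (measurableSet_singleton a)]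
        simp [m]

end Bernoulli

namespace IFS

variable {d : ℕ} {S : IFS d} {lam : S.ι → ℕ} {r p : ℝ}

namespace IsSys

variable (h : S.IsSys lam r)
include h

lemma dist_le_of_mem_cyl {D : ℝ} (hD : ∀ x ∈ S.attractor, ∀ y ∈ S.attractor, dist x y ≤ D)
    {u : List S.ι} {x y : EuclideanSpace ℝ (Fin d)} (hx : x ∈ S.cyl u) (hy : y ∈ S.cyl u) :
    dist x y ≤ D * r ^ lev lam u := by
  obtain ⟨x, hx, rfl⟩ := hx
  obtain ⟨y, hy, rfl⟩ := hy
  rw [h.dist_word, mul_comm]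
  exact mul_le_mul_of_nonneg_right (hD x hx y hy) (h.pow_pos _).le

lemma le_lev_map_range (ω : ℕ → S.ι) (n : ℕ) : n ≤ lev lam ((List.range n).map ω) := by
  induction n with
  | zero => simp
  | succ n ih =>
    rw [List.range_succ, List.map_append, lev_append]
    have := h.lam_pos (ω n)
    simp only [List.map_cons, List.map_nil, lev_cons, lev_nil]
    omega

lemma exists_coding : ∃ π : (ℕ → S.ι) → EuclideanSpace ℝ (Fin d),
    ∀ ω n, π ω ∈ S.cyl ((List.range n).map ω) := by
  have h1 : ∀ ω : ℕ → S.ι, (⋂ n, S.cyl ((List.range n).map ω)).Nonempty := by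
    intro ω
    refine IsCompact.nonempty_iInter_of_sequence_nonempty_isCompact_isClosed _ (fun n => ?_)
      (fun n => h.cyl_nonempty _) (h.isCompact_cyl _) fun n => (h.isCompact_cyl _).isClosed
    rw [List.range_succ, List.map_append]
    exact h.cyl_append_subset _ _
  choose π hπ using h1
  exact ⟨π, fun ω n => mem_iInter.1 (hπ ω) n⟩

lemma measurable_coding [MeasurableSpace S.ι] [DiscreteMeasurableSpace S.ι]
    {π : (ℕ → S.ι) → EuclideanSpace ℝ (Fin d)} (hπ : ∀ ω n, π ω ∈ S.cyl ((List.range n).map ω))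
    (hmeas : ∀ u : List S.ι, MeasurableSet (seqCyl u)) : Measurable π := by
  obtain ⟨e, he⟩ := h.nonempty
  obtain ⟨D, hD, hd⟩ := h.exists_diam
  refine measurable_of_tendsto_metrizable
    (f := fun n ω => S.word ((List.range n).map ω) e) (fun n B _ => ?_) ?_
  · have : (fun ω => S.word ((List.range n).map ω) e) ⁻¹' B =
        ⋃ u : {u : List S.ι // u.length = n ∧ S.word u e ∈ B}, seqCyl u.1 := by
      ext ω
      simp only [mem_preimage, mem_iUnion, seqCyl, Set.mem_ofPred_eq]
      constructor
      · intro hω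
        exact ⟨⟨_, by simp, hω⟩, by simp⟩
      · rintro ⟨⟨u, rfl, hu⟩, hω⟩
        simp only at hω
        rwa [hω]
    rw [this]
    exact MeasurableSet.iUnion fun u => hmeas u.1
  · rw [tendsto_pi_nhds]
    intro ω
    rw [tendsto_iff_dist_tendsto_zero]
    refine squeeze_zero (g := fun n => D * r ^ n) (fun _ => dist_nonneg) (fun n => ?_) ?_
    · refine (h.dist_le_of_mem_cyl hd (mem_image_of_mem _ he) (hπ ω n)).trans ?_
      exact mul_le_mul_of_nonneg_left
        (pow_le_pow_of_le_one h.r_pos.le h.r_lt.le (h.le_lev_map_range ω n)) hD.le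
    · have := (tendsto_pow_atTop_nhds_zero_of_lt_one h.r_pos.le h.r_lt).const_mul D
      rwa [mul_zero] at this

lemma preimage_coding_subset {π : (ℕ → S.ι) → EuclideanSpace ℝ (Fin d)}
    (hπ : ∀ ω n, π ω ∈ S.cyl ((List.range n).map ω)) (A : Set (EuclideanSpace ℝ (Fin d))) (k : ℕ) :
    π ⁻¹' A ⊆ ⋃ u ∈ {u | IsCut lam u k ∧ (S.cyl u ∩ A).Nonempty}, seqCyl u := by
  intro ω hω
  obtain ⟨v, w, hvw, hv⟩ := exists_cut_append (h.le_lev_map_range ω k)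
  have h1 := hπ ω k
  rw [hvw] at h1
  refine mem_iUnion₂.2 ⟨v, ⟨hv, π ω, h.cyl_append_subset _ _ h1, hω⟩, ?_⟩
  have hlen : v.length ≤ k := by
    have := congrArg List.length hvw
    simp at this
    omega
  have h2 := congrArg (List.take v.length) hvw
  rw [← List.map_take, List.take_range, List.take_left, min_eq_left hlen] at h2
  exact h2

/-- The lower bound in Moran's theorem. -/
lemma hausdorffMeasure_ne_zero {s : ℝ} (hs : 0 ≤ s) (hps : p = r ^ s)
    (hp : ∑ i, p ^ lam i = 1) : μH[s] S.attractor ≠ 0 := by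
  let _ : MeasurableSpace S.ι := ⊤
  have hp0 : 0 < p := by rw [hps]; exact Real.rpow_pos_of_pos h.r_pos s
  have hp1 : p ≤ 1 := by rw [hps]; exact Real.rpow_le_one h.r_pos.le h.r_lt.le hs
  obtain ⟨ν, hν, hmeas, hcyl⟩ := exists_bernoulli hp0.le hp
  obtain ⟨π, hπ⟩ := h.exists_coding
  have hπm := h.measurable_coding hπ hmeas
  obtain ⟨M, hM⟩ := h.exists_cyl_bound 1
  have hbound : ∀ A k, (∀ x ∈ A, ∀ y ∈ A, dist x y ≤ r ^ k) →
      ν (π ⁻¹' A) ≤ ENNReal.ofReal (M * p ^ k) := by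
    intro A k hA
    classical
    rcases A.eq_empty_or_nonempty with rfl | ⟨x, hx⟩
    · simp
    set s := (cuts h.lam_pos k).filter fun u => (S.cyl u ∩ A).Nonempty with hs
    have h1 : π ⁻¹' A ⊆ ⋃ u ∈ s, seqCyl u := by
      refine (h.preimage_coding_subset hπ A k).trans (biUnion_subset_biUnion_left fun u hu => ?_)
      simpa [hs] using hu
    have h2 : s.card ≤ M := by
      refine hM k x s (fun u hu => mem_cuts.1 (Finset.mem_filter.1 hu).1) fun u hu => ?_
      obtain ⟨y, hy, hyA⟩ := (Finset.mem_filter.1 hu).2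
      exact ⟨y, hy, by rw [one_mul]; exact hA y hyA x hx⟩
    calc ν (π ⁻¹' A) ≤ ν (⋃ u ∈ s, seqCyl u) := measure_mono h1
      _ ≤ ∑ u ∈ s, ν (seqCyl u) := measure_biUnion_finset_le _ _
      _ ≤ ∑ u ∈ s, ENNReal.ofReal (p ^ k) := by
          refine Finset.sum_le_sum fun u hu => ?_
          rw [hcyl]
          exact ENNReal.ofReal_le_ofReal (pow_le_pow_of_le_one hp0.le hp1
            (mem_cuts.1 (Finset.mem_filter.1 hu).1).le)
      _ = s.card * ENNReal.ofReal (p ^ k) := by rw [Finset.sum_const, nsmul_eq_mul]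
      _ ≤ M * ENNReal.ofReal (p ^ k) := by gcongr
      _ = _ := by rw [ENNReal.ofReal_mul (by positivity), ENNReal.ofReal_natCast]
  have hMpos : 0 < M := by
    by_contra hM0
    have h1 := hbound {S.word [] (h.nonempty.some)} 0
    have h2 := h.attractor_eq_cuts 0
    have h3 := hM 0 h.nonempty.some {[]} (by simp [isCut_nil])
      (by simpa using ⟨h.nonempty.some, h.nonempty.some_mem, by simp⟩)
    simp at h3
    omega
  have hM0 : (0 : ℝ) < M := by exact_mod_cast hMpos
  set c : ENNReal := ENNReal.ofReal (p / M) with hc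
  have hc0 : c ≠ 0 := by
    rw [hc, Ne, ENNReal.ofReal_eq_zero, not_le]; positivity
  have hle : c • ν.map π ≤ μH[s] := by
    refine Measure.le_hausdorffMeasure s _ 1 one_pos fun A hA => ?_
    have h0 : (c • ν.map π) A ≤ c * ν (π ⁻¹' closure A) := by
      rw [Measure.smul_apply, smul_eq_mul, ← Measure.map_apply hπm isClosed_closure.measurableSet]
      gcongr
      exact subset_closure
    refine h0.trans ?_
    rw [← Metric.ediam_closure A] at hA ⊢
    set B := closure A
    have hdist : ∀ x ∈ B, ∀ y ∈ B, dist x y ≤ (ediam B).toReal := by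
      intro x hx y hy
      rw [dist_edist]
      exact ENNReal.toReal_mono (ne_top_of_le_ne_top ENNReal.one_ne_top hA)
        (Metric.edist_le_ediam_of_mem hx hy)
    set δ := (ediam B).toReal with hδ
    have hδB : ediam B = ENNReal.ofReal δ :=
      (ENNReal.ofReal_toReal (ne_top_of_le_ne_top ENNReal.one_ne_top hA)).symm
    have hδ0 : 0 ≤ δ := ENNReal.toReal_nonneg
    have hδ1 : δ ≤ 1 := by
      rw [hδB, ENNReal.ofReal_le_one] at hA
      exact hA
    rw [hδB, ENNReal.ofReal_rpow_of_nonneg hδ0 hs]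
    rcases hδ0.eq_or_lt with hδ0 | hδ0
    · rw [← hδ0]
      rcases hs.eq_or_lt with hs0 | hs0
      · have h1 := hbound B 0 fun x hx y hy => (hdist x hx y hy).trans (by simpa using hδ1)
        rw [← hs0, Real.rpow_zero]
        calc c * ν (π ⁻¹' B) ≤ c * ENNReal.ofReal (M * p ^ 0) := by gcongr
          _ = ENNReal.ofReal (p / M * (M * p ^ 0)) := by
            rw [hc, ← ENNReal.ofReal_mul (by positivity)]
          _ ≤ _ := by
            refine ENNReal.ofReal_le_ofReal ?_
            rw [pow_zero, mul_one, div_mul_cancel₀ _ hM0.ne']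
            exact hp1
      · have hp1 : p < 1 := by rw [hps]; exact Real.rpow_lt_one h.r_pos.le h.r_lt hs0
        have h1 : ν (π ⁻¹' B) = 0 := by
          have h2 := (tendsto_pow_atTop_nhds_zero_of_lt_one hp0.le hp1).const_mul (M : ℝ)
          rw [mul_zero] at h2
          have h3 := ENNReal.tendsto_ofReal h2
          rw [ENNReal.ofReal_zero] at h3
          refine le_antisymm (ge_of_tendsto' h3 fun k => hbound B k fun x hx y hy => ?_) zero_le
          refine (hdist x hx y hy).trans ?_
          rw [← hδ0]
          exact (h.pow_pos k).le
        rw [h1, mul_zero]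
        exact zero_le
    · obtain ⟨k, hk1, hk2⟩ := exists_nat_pow_near_of_lt_one hδ0 hδ1 h.r_pos h.r_lt
      have h1 := hbound B k fun x hx y hy => (hdist x hx y hy).trans hk2
      calc c * ν (π ⁻¹' B) ≤ c * ENNReal.ofReal (M * p ^ k) := by gcongr
        _ = ENNReal.ofReal (p / M * (M * p ^ k)) := by
          rw [hc, ← ENNReal.ofReal_mul (by positivity)]
        _ ≤ _ := by
          refine ENNReal.ofReal_le_ofReal ?_
          have h2 : p / M * (M * p ^ k) = (r ^ (k + 1)) ^ s := by
            rw [← Real.rpow_natCast r, ← Real.rpow_mul h.r_pos.le, mul_comm _ s,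
              Real.rpow_mul h.r_pos.le, ← hps, Real.rpow_natCast, pow_succ]
            field_simp
          rw [h2]
          exact Real.rpow_le_rpow (h.pow_pos _).le hk1.le hs
  have h1 := hle S.attractor
  rw [Measure.smul_apply, smul_eq_mul, Measure.map_apply hπm h.isCompact.isClosed.measurableSet]
    at h1
  have h2 : π ⁻¹' S.attractor = univ := by
    refine eq_univ_of_forall fun ω => ?_
    simpa using hπ ω 0
  rw [h2, measure_univ, mul_one] at h1
  exact fun h3 => hc0 (le_antisymm (h3 ▸ h1) zero_le)

/-- The upper bound in Moran's theorem. -/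
lemma hausdorffMeasure_ne_top {s : ℝ} (hs : 0 ≤ s) (hps : p = r ^ s)
    (hp : ∑ i, p ^ lam i = 1) : μH[s] S.attractor ≠ ⊤ := by
  have hp0 : 0 < p := by rw [hps]; exact Real.rpow_pos_of_pos h.r_pos s
  obtain ⟨D, hD, hd⟩ := h.exists_diam
  have hdiam : ∀ u : List S.ι, ediam (S.cyl u) ≤ ENNReal.ofReal (D * r ^ lev lam u) := by
    intro u
    refine Metric.ediam_le fun x hx y hy => ?_
    rw [edist_dist]
    exact ENNReal.ofReal_le_ofReal (h.dist_le_of_mem_cyl hd hx hy)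
  have h1 := Measure.hausdorffMeasure_le_liminf_sum (β := ℕ) (ι := fun k => cuts h.lam_pos k) s
    S.attractor (l := Filter.atTop) (fun k => ENNReal.ofReal (D * r ^ k)) (by
      have := (tendsto_pow_atTop_nhds_zero_of_lt_one h.r_pos.le h.r_lt).const_mul D
      rw [mul_zero] at this
      simpa using ENNReal.tendsto_ofReal this) (fun k u => S.cyl u.1)
    (Filter.Eventually.of_forall fun k u => (hdiam u.1).trans (ENNReal.ofReal_le_ofReal
      (mul_le_mul_of_nonneg_left (pow_le_pow_of_le_one h.r_pos.le h.r_lt.le (mem_cuts.1 u.2).le)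
        hD.le)))
    (Filter.Eventually.of_forall fun k => by
      rw [h.attractor_eq_cuts k]
      exact iUnion₂_subset fun u hu => subset_iUnion_of_subset ⟨u, hu⟩ subset_rfl)
  have h2 : ∀ k, ∑ u : cuts h.lam_pos k, ediam (S.cyl u.1) ^ s ≤ ENNReal.ofReal (D ^ s) := by
    intro k
    calc ∑ u : cuts h.lam_pos k, ediam (S.cyl u.1) ^ s
        ≤ ∑ u : cuts h.lam_pos k, ENNReal.ofReal (D ^ s * p ^ lev lam u.1) := by
          refine Finset.sum_le_sum fun u _ => ?_
          refine (ENNReal.rpow_le_rpow (hdiam u.1) hs).trans ?_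
          rw [ENNReal.ofReal_rpow_of_nonneg (mul_nonneg hD.le (h.pow_pos _).le) hs,
            Real.mul_rpow hD.le (h.pow_pos _).le]
          refine (congrArg ENNReal.ofReal ?_).le
          rw [← Real.rpow_natCast, ← Real.rpow_mul h.r_pos.le, mul_comm _ s,
              Real.rpow_mul h.r_pos.le, ← hps, Real.rpow_natCast]
      _ = ENNReal.ofReal (∑ u ∈ cuts h.lam_pos k, D ^ s * p ^ lev lam u) := by
          rw [← ENNReal.ofReal_sum_of_nonneg fun u _ => by positivity,
            Finset.sum_coe_sort (cuts h.lam_pos k) fun u => D ^ s * p ^ lev lam u]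
      _ = _ := by rw [← Finset.mul_sum, sum_cuts_pow hp, mul_one]
  refine ne_top_of_le_ne_top (b := ENNReal.ofReal (D ^ s)) ENNReal.ofReal_ne_top (h1.trans ?_)
  refine (Filter.liminf_le_liminf (Filter.Eventually.of_forall h2)).trans ?_
  rw [Filter.liminf_const]

end IsSys

end IFS

end

section

lemma mem_Zring_self (p : ℝ) : p ∈ Zring p := Subring.subset_closure (mem_singleton p)

namespace IFS

variable {d : ℕ} {S : IFS d} {lam : S.ι → ℕ} {r p : ℝ}

/-- An iterated function system with the data and conclusions of Moran's theorem. -/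
structure IsReg (S : IFS d) (lam : S.ι → ℕ) (r p : ℝ) : Prop extends S.IsSys lam r where
  gcd_eq : Finset.univ.gcd lam = 1
  p_pos : 0 < p
  p_lt : p < 1
  sum_eq : ∑ i, p ^ lam i = 1
  p_eq : p = r ^ S.hdim
  hdim_pos : 0 < S.hdim
  ne_zero : μH[S.hdim] S.attractor ≠ 0
  ne_top : μH[S.hdim] S.attractor ≠ ⊤
  disc : IsTotallyDisconnected S.attractor

lemma exists_sum_pow_eq_one {ι : Type*} [Fintype ι] [Nonempty ι] {lam : ι → ℕ}
    (hlam : ∀ i, 0 < lam i) : ∃ q : ℝ, 0 < q ∧ q ≤ 1 ∧ ∑ i, q ^ lam i = 1 := by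
  have hc : ContinuousOn (fun q : ℝ => ∑ i, q ^ lam i) (Icc 0 1) := by fun_prop
  have h1 := intermediate_value_Icc zero_le_one hc
  have h2 : (1 : ℝ) ∈ Icc (∑ i, (0 : ℝ) ^ lam i) (∑ i, (1 : ℝ) ^ lam i) := by
    constructor
    · rw [Finset.sum_eq_zero fun i _ => zero_pow (hlam i).ne']
      exact zero_le_one
    · simp only [one_pow, Finset.sum_const, nsmul_eq_mul, mul_one, Finset.card_univ]
      exact_mod_cast Fintype.card_pos
  obtain ⟨q, hq, hq1⟩ := h1 h2
  refine ⟨q, hq.1.lt_of_ne fun h => ?_, hq.2, hq1⟩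
  simp only [← h, Finset.sum_eq_zero fun i _ => zero_pow (M₀ := ℝ) (hlam i).ne'] at hq1
  exact zero_ne_one hq1

theorem MemTOECpr.isReg (h : S.MemTOECpr p r) (hp0 : 0 < p) (hp1 : p < 1) :
    ∃ lam, S.IsReg lam r p := by
  obtain ⟨⟨hosc, -, hdisc⟩, ⟨hr0, hr1, lam, hlam, hr, hgcd⟩, hp⟩ := h
  have hattr : S.IsAttractor S.attractor := by
    by_cases hex : ∃ E, S.IsAttractor E
    · rw [attractor, dif_pos hex]
      exact hex.choose_spec
    · have : S.hdim = 0 := by rw [hdim, attractor, dif_neg hex, dimH_empty, ENNReal.toReal_zero]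
      rw [this, Real.rpow_zero] at hp
      exact absurd hp hp1.ne
  have hsys : S.IsSys lam r := ⟨hr0, hr1, hlam, hr, hattr, hosc⟩
  have : Nonempty S.ι := by
    obtain ⟨x, hx⟩ := hattr.1
    rw [hattr.2.2] at hx
    exact ⟨(mem_iUnion.1 hx).choose⟩
  obtain ⟨q, hq0, hq1, hq⟩ := exists_sum_pow_eq_one hlam
  have hlog : Real.log r < 0 := Real.log_neg hr0 hr1
  set s := Real.log q / Real.log r with hs
  have hs0 : 0 ≤ s := div_nonneg_of_nonpos (Real.log_nonpos hq0.le hq1) hlog.le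
  have hqs : q = r ^ s := by
    rw [Real.rpow_def_of_pos hr0, hs, mul_div_cancel₀ _ hlog.ne, Real.exp_log hq0]
  have h1 := hsys.hausdorffMeasure_ne_zero hs0 hqs hq
  have h2 := hsys.hausdorffMeasure_ne_top hs0 hqs hq
  have h3 : S.hdim = s := by
    have := dimH_of_hausdorffMeasure_ne_zero_ne_top (d := ⟨s, hs0⟩) h1 h2
    rw [hdim, this]
    rfl
  rw [← h3] at h1 h2 hqs
  have hqp : q = p := by rw [hqs, hp]
  rw [hqp] at hq
  refine ⟨lam, hsys, hgcd, hp0, hp1, hq, hp, ?_, h1, h2, hdisc⟩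
  refine (h3 ▸ hs0).lt_of_ne fun h0 => ?_
  rw [← h0, Real.rpow_zero] at hp
  exact hp1.ne hp

/-- The natural measure as a measure on the ambient space. -/
def mu (S : IFS d) : Measure (EuclideanSpace ℝ (Fin d)) :=
  (μH[S.hdim] S.attractor)⁻¹ • (μH[S.hdim]).restrict S.attractor

instance : IsFiniteMeasure S.mu := by
  refine ⟨?_⟩
  rw [mu, Measure.smul_apply, Measure.restrict_apply_univ, smul_eq_mul]
  exact ENNReal.inv_mul_le_one _ |>.trans_lt ENNReal.one_lt_top

lemma mu_apply_of_subset {F : Set (EuclideanSpace ℝ (Fin d))} (hF : F ⊆ S.attractor) :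
    S.mu F = (μH[S.hdim] S.attractor)⁻¹ * μH[S.hdim] F := by
  rw [mu, Measure.smul_apply, Measure.restrict_eq_self _ hF, smul_eq_mul]

lemma mu_real_of_subset {F : Set (EuclideanSpace ℝ (Fin d))} (hF : F ⊆ S.attractor) :
    S.mu.real F = S.natMeasure F := by
  rw [measureReal_def, mu_apply_of_subset hF, natMeasure, ENNReal.div_eq_inv_mul]

namespace IsReg

variable (h : S.IsReg lam r p)
include h

lemma mu_attractor : S.mu.real S.attractor = 1 := by
  rw [measureReal_def, mu_apply_of_subset subset_rfl, ENNReal.inv_mul_cancel h.ne_zero h.ne_top,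
    ENNReal.toReal_one]

lemma pow_rpow_hdim (k : ℕ) : (r ^ k) ^ S.hdim = p ^ k := by
  rw [← Real.rpow_natCast, ← Real.rpow_mul h.r_pos.le, mul_comm, Real.rpow_mul h.r_pos.le, ← h.p_eq,
    Real.rpow_natCast]

lemma hausdorffMeasure_image_word (u : List S.ι) (A : Set (EuclideanSpace ℝ (Fin d))) :
    μH[S.hdim] (S.word u '' A) = ENNReal.ofReal (p ^ lev lam u) * μH[S.hdim] A := by
  have hc := h.pow_pos (lev lam u)
  set c : NNReal := ⟨r ^ lev lam u, hc.le⟩ with hcdef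
  have hcp : (c : ENNReal) ^ S.hdim = ENNReal.ofReal (p ^ lev lam u) := by
    rw [← h.pow_rpow_hdim, ← ENNReal.ofReal_rpow_of_nonneg hc.le h.hdim_pos.le]
    congr 1
    rw [ENNReal.ofReal, Real.toNNReal_of_nonneg hc.le]
    rfl
  have hc0 : c ≠ 0 := fun h0 => hc.ne' (congrArg NNReal.toReal h0)
  have h1 : LipschitzWith c (S.word u) :=
    LipschitzWith.of_dist_le_mul fun x y => (h.dist_word u x y).le
  have h2 : AntilipschitzWith c⁻¹ (S.word u) := by
    refine AntilipschitzWith.of_le_mul_dist fun x y => ?_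
    rw [h.dist_word, NNReal.coe_inv]
    exact (inv_mul_cancel_left₀ hc.ne' _).ge
  rw [← hcp]
  refine le_antisymm (h1.hausdorffMeasure_image_le h.hdim_pos.le A) ?_
  refine (mul_le_mul_right (h2.le_hausdorffMeasure_image h.hdim_pos.le A) _).trans ?_
  rw [ENNReal.coe_inv hc0, ENNReal.inv_rpow, ENNReal.mul_inv_cancel_left]
  · rw [hcp]
    exact (ENNReal.ofReal_pos.2 (_root_.pow_pos h.p_pos _)).ne'
  · rw [hcp]
    exact ENNReal.ofReal_ne_top

lemma mu_image_word (u : List S.ι) {A : Set (EuclideanSpace ℝ (Fin d))} (hA : A ⊆ S.attractor) :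
    S.mu.real (S.word u '' A) = p ^ lev lam u * S.mu.real A := by
  rw [measureReal_def, measureReal_def, mu_apply_of_subset hA,
    mu_apply_of_subset ((image_mono hA).trans (h.cyl_subset u)), h.hausdorffMeasure_image_word,
    mul_left_comm, ENNReal.toReal_mul, ENNReal.toReal_ofReal (_root_.pow_pos h.p_pos _).le]

lemma mu_cyl (u : List S.ι) : S.mu.real (S.cyl u) = p ^ lev lam u := by
  rw [cyl, h.mu_image_word u subset_rfl, h.mu_attractor, mul_one]

lemma mu_cyl_inter {k : ℕ} {u v : List S.ι} (hu : IsCut lam u k) (hv : IsCut lam v k)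
    (huv : u ≠ v) : S.mu (S.cyl u ∩ S.cyl v) = 0 := by
  classical
  have hsum := sum_cuts_pow h.sum_eq h.lam_pos k
  set s := ((cuts h.lam_pos k).erase u).erase v with hs
  have hv' : v ∈ (cuts h.lam_pos k).erase u := Finset.mem_erase.2 ⟨huv.symm, mem_cuts.2 hv⟩
  rw [← Finset.add_sum_erase _ _ (mem_cuts.2 hu : u ∈ cuts h.lam_pos k),
    ← Finset.add_sum_erase _ _ hv'] at hsum
  have h1 : S.attractor ⊆ (S.cyl u ∪ S.cyl v) ∪ ⋃ w ∈ s, S.cyl w := by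
    rw [h.attractor_eq_cuts k]
    refine iUnion₂_subset fun w hw x hx => ?_
    by_cases hwu : w = u
    · exact Or.inl (Or.inl (hwu ▸ hx))
    by_cases hwv : w = v
    · exact Or.inl (Or.inr (hwv ▸ hx))
    · exact Or.inr (mem_iUnion₂.2 ⟨w, Finset.mem_erase.2 ⟨hwv, Finset.mem_erase.2 ⟨hwu, hw⟩⟩, hx⟩)
  have h2 : S.mu.real (⋃ w ∈ s, S.cyl w) ≤ ∑ w ∈ s, p ^ lev lam w :=
    (measureReal_biUnion_finset_le _ _).trans (Finset.sum_le_sum fun w _ => (h.mu_cyl w).le)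
  have h3 := measureReal_union_add_inter (μ := S.mu) (s := S.cyl u)
    (h.isCompact_cyl v).isClosed.measurableSet
  have h4 := (measureReal_mono (μ := S.mu) h1).trans (measureReal_union_le _ _)
  rw [h.mu_attractor] at h4
  rw [h.mu_cyl, h.mu_cyl] at h3
  have h5 : S.mu.real (S.cyl u ∩ S.cyl v) = 0 :=
    le_antisymm (by linarith) measureReal_nonneg
  exact (measureReal_eq_zero_iff).1 h5

/-- The measure of a union of pieces inside different cylinders of a cut. -/
lemma mu_biUnion {k : ℕ} {C : Finset (List S.ι)} (hC : ∀ u ∈ C, IsCut lam u k)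
    {F : List S.ι → Set (EuclideanSpace ℝ (Fin d))} (hF : ∀ u ∈ C, F u ⊆ S.attractor)
    (hFc : ∀ u ∈ C, IsCompact (F u)) :
    S.mu.real (⋃ u ∈ C, S.word u '' F u) = ∑ u ∈ C, p ^ lev lam u * S.mu.real (F u) := by
  rw [measureReal_def, measure_biUnion_finset₀, ENNReal.toReal_sum fun u _ => measure_ne_top _ _]
  · exact Finset.sum_congr rfl fun u hu => h.mu_image_word u (hF u hu)
  · intro u hu v hv huv
    exact measure_mono_null (inter_subset_inter (image_mono (hF u hu)) (image_mono (hF v hv)))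
      (h.mu_cyl_inter (hC u hu) (hC v hv) huv)
  · exact fun u hu => ((hFc u hu).image (h.word_continuous u)).isClosed.measurableSet.nullMeasurableSet

lemma mu_biUnion_cyl {k : ℕ} {C : Finset (List S.ι)} (hC : ∀ u ∈ C, IsCut lam u k) :
    S.mu.real (⋃ u ∈ C, S.cyl u) = ∑ u ∈ C, p ^ lev lam u := by
  refine (h.mu_biUnion hC (F := fun _ => S.attractor) (fun _ _ => subset_rfl)
    fun _ _ => h.isCompact).trans ?_
  simp [h.mu_attractor]

lemma inv_mem : p⁻¹ ∈ Zring p := by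
  have h1 : p⁻¹ = ∑ i, p ^ (lam i - 1) := by
    rw [inv_eq_one_div, div_eq_iff h.p_pos.ne', Finset.sum_mul, ← h.sum_eq]
    refine Finset.sum_congr rfl fun i _ => ?_
    rw [← pow_succ, Nat.sub_add_cancel (h.lam_pos i)]
  rw [h1]
  exact Subring.sum_mem _ fun i _ => pow_mem (mem_Zring_self p) _

end IsReg

end IFS

end

section

section Separation

variable {V : Type*} [MetricSpace V]

/-- `A` is a subset of `E` at distance at least `t` from the rest of `E`. -/
def SepIn (E : Set V) (t : ℝ) (A : Set V) : Prop := A ⊆ E ∧ ∀ x ∈ A, ∀ y ∈ E, y ∉ A → t ≤ dist x y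

namespace SepIn

variable {E A B : Set V} {t t' : ℝ}

lemma mono (h : SepIn E t A) (htt : t' ≤ t) : SepIn E t' A :=
  ⟨h.1, fun x hx y hy hyA => htt.trans (h.2 x hx y hy hyA)⟩

lemma union (hA : SepIn E t A) (hB : SepIn E t B) : SepIn E t (A ∪ B) := by
  refine ⟨union_subset hA.1 hB.1, fun x hx y hy hyAB => ?_⟩
  rw [mem_union, not_or] at hyAB
  rcases hx with hx | hx
  · exact hA.2 x hx y hy hyAB.1
  · exact hB.2 x hx y hy hyAB.2

lemma compl (hA : SepIn E t A) : SepIn E t (E \ A) := by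
  refine ⟨sdiff_subset, fun x hx y hy hyA => ?_⟩
  rw [dist_comm]
  refine hA.2 y ?_ x hx.1 hx.2
  by_contra h
  exact hyA ⟨hy, h⟩

lemma diff (hA : SepIn E t A) (hB : SepIn E t B) : SepIn E t (A \ B) := by
  refine ⟨sdiff_subset.trans hA.1, fun x hx y hy hyAB => ?_⟩
  by_cases hyA : y ∈ A
  · have hyB : y ∈ B := by
      by_contra h
      exact hyAB ⟨hyA, h⟩
    rw [dist_comm]
    exact hB.2 y hyB x (hA.1 hx.1) hx.2
  · exact hA.2 x hx.1 y hy hyA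

lemma empty : SepIn E t ∅ := ⟨empty_subset _, fun _ hx => hx.elim⟩

lemma biUnion {ι : Type*} {s : Finset ι} {F : ι → Set V} (h : ∀ i ∈ s, SepIn E t (F i)) :
    SepIn E t (⋃ i ∈ s, F i) := by
  refine ⟨iUnion₂_subset fun i hi => (h i hi).1, fun x hx y hy hyF => ?_⟩
  obtain ⟨i, hi, hx⟩ := mem_iUnion₂.1 hx
  exact (h i hi).2 x hx y hy fun h' => hyF (mem_iUnion₂.2 ⟨i, hi, h'⟩)

lemma isCompact (hE : IsCompact E) (ht : 0 < t) (h : SepIn E t A) : IsCompact A := by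
  refine hE.of_isClosed_subset ?_ h.1
  refine isClosed_of_closure_subset fun y hy => ?_
  by_contra hyA
  have hyE : y ∈ E := (hE.isClosed.closure_subset_iff.2 h.1) hy
  obtain ⟨x, hx, hxy⟩ := Metric.mem_closure_iff.1 hy t ht
  exact absurd (h.2 x hx y hyE hyA) (by rw [dist_comm]; exact not_le.2 hxy)

lemma exists_of_isCompact (hAE : A ⊆ E) (hA : IsCompact A) (hB : IsCompact (E \ A)) :
    ∃ t > 0, SepIn E t A := by
  obtain ⟨t, ht, h⟩ := (disjoint_sdiff_right (s := A) (t := E)).exists_thickenings hA hB.isClosed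
  refine ⟨t, ht, hAE, fun x hx y hy hyA => not_lt.1 fun hxy => ?_⟩
  exact disjoint_left.1 h (mem_thickening_iff.2 ⟨x, hx, by rwa [dist_comm]⟩)
    (self_subset_thickening ht _ ⟨hy, hyA⟩)

end SepIn

lemma exists_pos_le_of_finset {α : Type*} (s : Finset α) {t : α → ℝ} (ht : ∀ x ∈ s, 0 < t x) :
    ∃ ε > 0, ∀ x ∈ s, ε ≤ t x := by
  rcases s.eq_empty_or_nonempty with rfl | hs
  · exact ⟨1, one_pos, by simp⟩
  · exact ⟨s.inf' hs t, (Finset.lt_inf'_iff hs).2 ht, fun x hx => Finset.inf'_le t hx⟩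

/-- Chains with steps less than `ε` in `Y` join only points at distance at most `η`. -/
def Dsc (Y : Set V) (ε η : ℝ) : Prop :=
  ∀ a ∈ Y, ∀ b, Relation.ReflTransGen (fun a b => b ∈ Y ∧ dist a b < ε) a b → dist a b ≤ η

lemma Dsc.mono {Y : Set V} {ε ε' η η' : ℝ} (h : Dsc Y ε η) (hε : ε' ≤ ε) (hη : η ≤ η') :
    Dsc Y ε' η' := fun a ha b hab =>
  (h a ha b (Relation.ReflTransGen.mono (fun _ _ (h : _ ∧ _) => ⟨h.1, h.2.trans_le hε⟩) _ _ hab)).trans hη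

lemma Dsc.union {Y Z : Set V} {ε η η' : ℝ} (hε : 0 ≤ ε) (hη0 : 0 ≤ η) (hη0' : 0 ≤ η')
    (hY : Dsc Y ε η) (hZ : Dsc Z (η + 2 * ε) η') : Dsc (Y ∪ Z) ε (η' + 2 * η + 2 * ε) := by
  intro a ha b hab
  have key : (a ∈ Y ∧ Relation.ReflTransGen (fun a b => b ∈ Y ∧ dist a b < ε) a b) ∨
      ∃ z ∈ Z, ∃ z', dist a z ≤ η + ε ∧
        Relation.ReflTransGen (fun a b => b ∈ Z ∧ dist a b < η + 2 * ε) z z' ∧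
        (b = z' ∨ ∃ y ∈ Y, dist z' y < ε ∧
          Relation.ReflTransGen (fun a b => b ∈ Y ∧ dist a b < ε) y b) := by
    induction hab with
    | refl =>
      rcases ha with ha | ha
      · exact Or.inl ⟨ha, .refl⟩
      · exact Or.inr ⟨a, ha, a, by rw [dist_self]; positivity, .refl, Or.inl rfl⟩
    | tail _ hbc ih =>
      rename_i b c _
      obtain ⟨hcYZ, hbc⟩ := hbc
      rcases hcYZ with hc | hc
      · rcases ih with ⟨haY, ih⟩ | ⟨z, hz, z', h1, h2, rfl | ⟨y, hy, h3, h4⟩⟩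
        · exact Or.inl ⟨haY, ih.tail ⟨hc, hbc⟩⟩
        · exact Or.inr ⟨z, hz, b, h1, h2, Or.inr ⟨c, hc, hbc, .refl⟩⟩
        · exact Or.inr ⟨z, hz, z', h1, h2, Or.inr ⟨y, hy, h3, h4.tail ⟨hc, hbc⟩⟩⟩
      · rcases ih with ⟨haY, ih⟩ | ⟨z, hz, z', h1, h2, rfl | ⟨y, hy, h3, h4⟩⟩
        · exact Or.inr ⟨c, hc, c, (dist_triangle _ b _).trans
            (add_le_add (hY a haY b ih) hbc.le), .refl, Or.inl rfl⟩
        · exact Or.inr ⟨z, hz, c, h1, h2.tail ⟨hc, by linarith⟩, Or.inl rfl⟩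
        · refine Or.inr ⟨z, hz, c, h1, h2.tail ⟨hc, ?_⟩, Or.inl rfl⟩
          have := hY y hy b h4
          linarith [dist_triangle4 z' y b c]
  rcases key with ⟨haY, h1⟩ | ⟨z, hz, z', h1, h2, rfl | ⟨y, hy, h3, h4⟩⟩
  · linarith [hY a haY b h1]
  · linarith [hZ z hz b h2, dist_triangle a z b]
  · linarith [hZ z hz z' h2, dist_triangle a z b, hY y hy b h4, dist_triangle4 z z' y b]

/-- A small separated set around every point of a totally disconnected compact set. -/
lemma exists_sep_of_isTotallyDisconnected {E : Set V} (hE : IsCompact E)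
    (hd : IsTotallyDisconnected E) {x : V} (hx : x ∈ E) {U : Set V} (hU : U ∈ nhds x) :
    ∃ A t, 0 < t ∧ SepIn E t A ∧ x ∈ A ∧ A ⊆ U := by
  have : CompactSpace E := isCompact_iff_compactSpace.1 hE
  have : TotallyDisconnectedSpace E := totallyDisconnectedSpace_subtype_iff.2 hd
  obtain ⟨W, hWU, hWo, hxW⟩ := _root_.mem_nhds_iff.1 hU
  obtain ⟨K, hK, hxK, hKW⟩ := compact_exists_isClopen_in_isOpen
    (hWo.preimage (continuous_subtype_val (p := (· ∈ E)))) (show (⟨x, hx⟩ : E) ∈ _ from hxW)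
  obtain ⟨t, ht, hs⟩ := SepIn.exists_of_isCompact (E := E) (A := Subtype.val '' K)
    (by simp) (hK.1.isCompact.image continuous_subtype_val) (by
      have : E \ Subtype.val '' K = Subtype.val '' Kᶜ := by
        rw [image_compl_eq_range_sdiff_image Subtype.val_injective, Subtype.range_coe]
      rw [this]
      exact hK.compl.1.isCompact.image continuous_subtype_val)
  exact ⟨_, t, ht, hs, ⟨_, hxK, rfl⟩, (image_subset_iff.2 hKW).trans hWU⟩

lemma exists_dsc {E : Set V} (hE : IsCompact E) (hd : IsTotallyDisconnected E) {η : ℝ}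
    (hη : 0 < η) : ∃ ε > 0, Dsc E ε η := by
  have h1 : ∀ x ∈ E, ∃ A t, 0 < t ∧ SepIn E t A ∧ x ∈ A ∧ A ⊆ ball x (η / 2) := fun x hx =>
    exists_sep_of_isTotallyDisconnected hE hd hx (ball_mem_nhds x (by positivity))
  choose! A t ht hA hxA hAb using h1
  obtain ⟨s, hs, hsE⟩ := hE.elim_nhds_subcover (fun x => ball x (t x))
    fun x hx => ball_mem_nhds x (ht x hx)
  obtain ⟨ε, hε, hεt⟩ := exists_pos_le_of_finset s fun x hx => ht x (hs x hx)
  refine ⟨ε, hε, fun a ha b hab => ?_⟩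
  obtain ⟨x, hx, hax⟩ := mem_iUnion₂.1 (hsE ha)
  have hxE := hs x hx
  have haA : a ∈ A x := by
    by_contra h
    exact absurd ((hA x hxE).2 x (hxA x hxE) a ha h) (not_le.2 (by rwa [dist_comm]))
  have hbA : b ∈ A x := by
    induction hab with
    | refl => exact haA
    | tail _ hbc ih =>
      by_contra h
      exact absurd ((hA x hxE).2 _ ih _ hbc.1 h) (not_le.2 (hbc.2.trans_le (hεt x hx)))
  have h1 := hAb x hxE haA
  have h2 := hAb x hxE hbA
  rw [mem_ball] at h1 h2
  linarith [dist_triangle_right a b x]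

lemma Dsc.image {Y : Set V} {ε η c : ℝ} {f : V → V} (hc : 0 < c)
    (hf : ∀ x y, dist (f x) (f y) = c * dist x y) (h : Dsc Y ε η) :
    Dsc (f '' Y) (c * ε) (c * η) := by
  rintro _ ⟨a, ha, rfl⟩ b hab
  have key : ∃ b' ∈ Y, f b' = b ∧
      Relation.ReflTransGen (fun a b => b ∈ Y ∧ dist a b < ε) a b' := by
    induction hab with
    | refl => exact ⟨a, ha, rfl, .refl⟩
    | tail _ hbc ih =>
      obtain ⟨b', hb', rfl, hab⟩ := ih
      obtain ⟨⟨c', hc', rfl⟩, hlt⟩ := hbc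
      rw [hf] at hlt
      exact ⟨c', hc', rfl, hab.tail ⟨hc', lt_of_mul_lt_mul_left hlt hc.le⟩⟩
  obtain ⟨b', -, rfl, hab'⟩ := key
  rw [hf]
  exact mul_le_mul_of_nonneg_left (h a ha b' hab') hc.le

end Separation

lemma exists_lam_bound {ι : Type*} [Fintype ι] (lam : ι → ℕ) :
    ∃ Λ, 0 < Λ ∧ ∀ i, lam i ≤ Λ := ⟨∑ i, lam i + 1, Nat.succ_pos _, fun i =>
    (Finset.single_le_sum (fun _ _ => Nat.zero_le _) (Finset.mem_univ i)).trans (Nat.le_succ _)⟩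

namespace IFS.IsReg

variable {d : ℕ} {S : IFS d} {lam : S.ι → ℕ} {r p : ℝ} (h : S.IsReg lam r p)
include h

lemma exists_dsc_cyl (M : ℕ) {η : ℝ} (hη : 0 < η) : ∃ ε > 0, ∀ k (s : Finset (List S.ι)),
    (∀ u ∈ s, IsCut lam u k) → s.card ≤ M →
      Dsc (⋃ u ∈ s, S.cyl u) (ε * r ^ k) (η * r ^ k) := by
  obtain ⟨Λ, hΛ0, hΛ⟩ := exists_lam_bound lam
  induction M generalizing η with
  | zero =>
    refine ⟨1, one_pos, fun k s _ hs a ha => ?_⟩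
    rw [Finset.card_eq_zero.1 (Nat.le_zero.1 hs)] at ha
    simp at ha
  | succ M ih =>
    obtain ⟨ε', hε', h1⟩ := ih (half_pos hη)
    set η₁ := min (η / 8) (ε' / 2) with hη₁
    have hη₁0 : 0 < η₁ := by positivity
    obtain ⟨ε₀, hε₀, h2⟩ := exists_dsc h.isCompact h.disc hη₁0
    set ε := min (ε₀ * r ^ Λ) (min (η / 8) (ε' / 4)) with hε
    have hε0 : 0 < ε := by
      have := h.pow_pos Λ
      positivity
    have e1 : ε ≤ ε₀ * r ^ Λ := min_le_left _ _
    have e2 : ε ≤ η / 8 := (min_le_right _ _).trans (min_le_left _ _)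
    have e3 : ε ≤ ε' / 4 := (min_le_right _ _).trans (min_le_right _ _)
    have e4 : η₁ ≤ η / 8 := min_le_left _ _
    have e5 : η₁ ≤ ε' / 2 := min_le_right _ _
    refine ⟨ε, hε0, fun k s hcut hs => ?_⟩
    have hk := h.pow_pos k
    classical
    rcases s.eq_empty_or_nonempty with rfl | ⟨u, hu⟩
    · intro a ha
      simp at ha
    · have h3 : (⋃ v ∈ s, S.cyl v) = S.cyl u ∪ ⋃ v ∈ s.erase u, S.cyl v := by
        conv_lhs => rw [← Finset.insert_erase hu, Finset.set_biUnion_insert]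
      rw [h3]
      have h4 : Dsc (S.cyl u) (ε * r ^ k) (η₁ * r ^ k) := by
        refine (h2.image (h.pow_pos (lev lam u)) (h.dist_word u)).mono ?_ ?_
        · calc ε * r ^ k ≤ ε₀ * r ^ Λ * r ^ k := by gcongr
            _ = r ^ (k + Λ) * ε₀ := by ring
            _ ≤ r ^ lev lam u * ε₀ := mul_le_mul_of_nonneg_right (pow_le_pow_of_le_one h.r_pos.le
              h.r_lt.le ((hcut u hu).lt hΛ0 hΛ).le) hε₀.le
        · rw [mul_comm]
          exact mul_le_mul_of_nonneg_left
            (pow_le_pow_of_le_one h.r_pos.le h.r_lt.le (hcut u hu).le) hη₁0.le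
      have h5 := h1 k (s.erase u) (fun v hv => hcut v (Finset.mem_of_mem_erase hv)) (by
        rw [Finset.card_erase_of_mem hu]; omega)
      refine (h4.union (by positivity) (by positivity) (by positivity)
        (h5.mono ?_ le_rfl)).mono le_rfl ?_
      · rw [← mul_assoc, ← add_mul]
        exact mul_le_mul_of_nonneg_right (by linarith) hk.le
      · rw [← mul_assoc, ← mul_assoc, ← add_mul, ← add_mul]
        exact mul_le_mul_of_nonneg_right (by linarith) hk.le

/-- Every point of the attractor lies in small sets which are separated at the same scale. -/
lemma exists_sepIn : ∃ δ > 0, ∀ k, ∀ x ∈ S.attractor, ∃ A, SepIn S.attractor (δ * r ^ k) A ∧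
    x ∈ A ∧ A ⊆ closedBall x (r ^ k) := by
  classical
  obtain ⟨M, hM⟩ := h.exists_cyl_bound 1
  obtain ⟨ε₁, hε₁, h1⟩ := h.exists_dsc_cyl M (half_pos one_pos)
  set ε := min ε₁ (1 / 2) with hε
  have hε0 : 0 < ε := by positivity
  refine ⟨ε, hε0, fun k x hx => ?_⟩
  have hk := h.pow_pos k
  set R := fun a b => b ∈ S.attractor ∧ dist a b < ε * r ^ k with hR
  set s := (cuts h.lam_pos k).filter fun u => ∃ y ∈ S.cyl u, dist y x ≤ 1 * r ^ k with hs
  have hcut : ∀ u ∈ s, IsCut lam u k := fun u hu => mem_cuts.1 (Finset.mem_filter.1 hu).1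
  have h2 := (h1 k s hcut (hM k x s hcut fun u hu => (Finset.mem_filter.1 hu).2)).mono
    (mul_le_mul_of_nonneg_right (min_le_left ε₁ (1 / 2)) hk.le) le_rfl
  have hmem : ∀ y ∈ S.attractor, dist x y ≤ r ^ k → y ∈ ⋃ u ∈ s, S.cyl u := by
    intro y hy hxy
    obtain ⟨u, hu, hyu⟩ := h.exists_mem_cyl k hy
    exact mem_iUnion₂.2 ⟨u, Finset.mem_filter.2 ⟨mem_cuts.2 hu, y, hyu,
      by rwa [one_mul, dist_comm]⟩, hyu⟩
  have hxY := hmem x hx (by rw [dist_self]; exact hk.le)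
  have h3 : ∀ b, Relation.ReflTransGen R x b → Relation.ReflTransGen
      (fun a b => b ∈ (⋃ u ∈ s, S.cyl u) ∧ dist a b < ε * r ^ k) x b := by
    intro b hb
    induction hb with
    | refl => exact .refl
    | @tail b c _ hbc ih =>
      refine ih.tail ⟨hmem c hbc.1 ?_, hbc.2⟩
      have h4 := h2 x hxY b ih
      have h5 : ε * r ^ k ≤ 1 / 2 * r ^ k := mul_le_mul_of_nonneg_right (min_le_right _ _) hk.le
      linarith [dist_triangle x b c, hbc.2]
  have hE : ∀ b, Relation.ReflTransGen R x b → b ∈ S.attractor := by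
    intro b hb
    cases hb with
    | refl => exact hx
    | tail _ hbc => exact hbc.1
  refine ⟨{b | Relation.ReflTransGen R x b}, ⟨hE, fun a ha y hy hyA => ?_⟩, .refl, fun b hb => ?_⟩
  · exact not_lt.1 fun hlt => hyA (Relation.ReflTransGen.tail ha ⟨hy, hlt⟩)
  · rw [mem_closedBall, dist_comm]
    linarith [h2 x hxY b (h3 b hb)]

end IFS.IsReg

section Nodes

variable {V : Type*} [MetricSpace V] {E : Set V}

/-- The smallest separated subset of `E` at scale `δ * r ^ k` around `x`. -/
def sepNode (E : Set V) (δ r : ℝ) (k : ℕ) (x : E) : Set E :=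
  {y | ∀ A, SepIn E (δ * r ^ k) A → x.1 ∈ A → y.1 ∈ A}

variable {δ r : ℝ}

lemma sepNode_le_dist {k : ℕ} {x y : E} (hy : y ∉ sepNode E δ r k x) : δ * r ^ k ≤ dist x y := by
  simp only [sepNode, Set.mem_ofPred_eq, not_forall] at hy
  obtain ⟨A, hA, hx, hyA⟩ := hy
  exact hA.2 x hx y y.2 hyA

lemma isTree_sepNode (hE : IsCompact E) (hδ : 0 < δ) (hr : 0 < r) (hr1 : r < 1) :
    IsTree (sepNode E δ r) := by
  have heq : ∀ k x y, y ∈ sepNode E δ r k x → sepNode E δ r k y = sepNode E δ r k x := by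
    intro k x y hy
    have hiff : ∀ A, SepIn E (δ * r ^ k) A → (y.1 ∈ A ↔ x.1 ∈ A) := by
      refine fun A hA => ⟨fun hyA => ?_, hy A hA⟩
      by_contra hxA
      exact (hy _ hA.compl ⟨x.2, hxA⟩).2 hyA
    ext z
    exact forall₂_congr fun A hA => by rw [hiff A hA]
  refine ⟨fun k x A _ hx => hx, heq, fun k x y hy A hA hx => hy A (hA.mono ?_) hx, fun k => ?_⟩
  · exact mul_le_mul_of_nonneg_left (pow_le_pow_of_le_one hr.le hr1.le (Nat.le_succ k)) hδ.le
  · have : CompactSpace E := isCompact_iff_compactSpace.1 hE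
    have hpos : 0 < δ * r ^ k := mul_pos hδ (pow_pos hr k)
    obtain ⟨t, -, ht, hcov⟩ := (isCompact_univ (X := E)).finite_cover_balls hpos
    refine (ht.image (sepNode E δ r k)).subset ?_
    rintro _ ⟨x, rfl⟩
    obtain ⟨c, hc, hxc⟩ := mem_iUnion₂.1 (hcov (mem_univ x))
    refine ⟨c, hc, (heq k c x ?_).symm⟩
    by_contra hn
    exact absurd (sepNode_le_dist hn) (not_le.2 (by rwa [dist_comm]))

lemma isMetricTree_sepNode (hδ : 0 < δ) (hr : 0 < r) (hr1 : r < 1)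
    (hs : ∀ k, ∀ x ∈ E, ∃ A, SepIn E (δ * r ^ k) A ∧ x ∈ A ∧ A ⊆ closedBall x (r ^ k)) :
    IsMetricTree (sepNode E δ r) r δ 1 := by
  refine ⟨hr, hr1, hδ, one_pos, fun k x y hy => ?_, fun k x y hy => sepNode_le_dist hy⟩
  obtain ⟨A, hA, hxA, hAb⟩ := hs k x x.2
  rw [one_mul, dist_comm]
  exact hAb (hy A hA hxA)

lemma sepIn_of_sat {k : ℕ} {A : Set E} (hA : Sat (sepNode E δ r) k A) :
    SepIn E (δ * r ^ k) (Subtype.val '' A) := by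
  refine ⟨by simp, ?_⟩
  rintro _ ⟨x, hx, rfl⟩ y hy hyA
  exact sepNode_le_dist (y := ⟨y, hy⟩) fun h => hyA ⟨_, hA x hx h, rfl⟩

lemma sat_of_sepIn {k : ℕ} {t : ℝ} (ht : δ * r ^ k ≤ t) {A : Set V} (hA : SepIn E t A) :
    Sat (sepNode E δ r) k (Subtype.val ⁻¹' A) :=
  fun _ hx _ hy => hy A (hA.mono ht) hx

end Nodes

end

section

namespace IFS

variable {d : ℕ} {S : IFS d} {lam : S.ι → ℕ} {r p : ℝ}

namespace IsReg

variable (h : S.IsReg lam r p)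
include h

/-- Words of the level of `u` whose cylinders are close to the cylinder of `u`. -/
lemma exists_max_neighbours : ∃ u : List S.ι, ∀ w v, IsCut lam v (lev lam (w ++ u)) →
    (∃ x ∈ S.cyl (w ++ u), ∃ y ∈ S.cyl v, dist x y ≤ r ^ lev lam (w ++ u)) →
    ∃ v', v = w ++ v' := by
  classical
  obtain ⟨D, hD, hd⟩ := h.exists_diam
  obtain ⟨M, hM⟩ := h.exists_cyl_bound (D + 1)
  let N : List S.ι → Finset (List S.ι) := fun u => (cuts h.lam_pos (lev lam u)).filter fun v =>
    ∃ x ∈ S.cyl u, ∃ y ∈ S.cyl v, dist x y ≤ r ^ lev lam u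
  have hN : ∀ u v, v ∈ N u ↔ IsCut lam v (lev lam u) ∧
      ∃ x ∈ S.cyl u, ∃ y ∈ S.cyl v, dist x y ≤ r ^ lev lam u := fun u v => by
    rw [Finset.mem_filter, mem_cuts]
  have hcard : ∀ u, (N u).card ≤ M := by
    intro u
    obtain ⟨x₀, hx₀⟩ := h.cyl_nonempty u
    refine hM (lev lam u) x₀ (N u) (fun v hv => ((hN u v).1 hv).1) fun v hv => ?_
    obtain ⟨-, x, hx, y, hy, hxy⟩ := (hN u v).1 hv
    refine ⟨y, hy, ?_⟩
    have := h.dist_le_of_mem_cyl hd hx hx₀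
    rw [add_mul, one_mul]
    linarith [dist_triangle y x x₀, dist_comm x y]
  obtain ⟨n, ⟨u, hu⟩, hmax⟩ : ∃ n, (∃ u, (N u).card = n) ∧ ∀ v, (N v).card ≤ n := by
    have hb : BddAbove (range fun u => (N u).card) := ⟨M, by rintro _ ⟨u, rfl⟩; exact hcard u⟩
    exact ⟨_, Nat.sSup_mem (range_nonempty _) hb, fun v => le_csSup hb (mem_range_self v)⟩
  refine ⟨u, fun w v hv hxy => ?_⟩
  have hsub : (N u).image (w ++ ·) ⊆ N (w ++ u) := by
    intro v' hv'
    obtain ⟨v₁, hv₁, rfl⟩ := Finset.mem_image.1 hv'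
    obtain ⟨hcut, x, hx, y, hy, hxy⟩ := (hN u v₁).1 hv₁
    refine (hN _ (w ++ v₁)).2 ⟨by rw [lev_append]; exact hcut.append h.lam_pos, S.word w x, ?_,
      S.word w y, ?_, ?_⟩
    · rw [cyl_append]; exact mem_image_of_mem _ hx
    · rw [cyl_append]; exact mem_image_of_mem _ hy
    · rw [h.dist_word, lev_append, pow_add]
      exact mul_le_mul_of_nonneg_left hxy (h.pow_pos _).le
  have heq := Finset.eq_of_subset_of_card_le hsub (by
    rw [Finset.card_image_of_injective _ (List.append_right_injective w), hu]
    exact hmax _)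
  have := (hN _ v).2 ⟨hv, hxy⟩
  rw [← heq] at this
  obtain ⟨v', -, rfl⟩ := Finset.mem_image.1 this
  exact ⟨v', rfl⟩

/-- An open set for the open set condition which meets the attractor. -/
lemma exists_oscSet_inter : ∃ O, S.OSCSet O ∧ (S.attractor ∩ O).Nonempty := by
  obtain ⟨u, hu⟩ := h.exists_max_neighbours
  set U := thickening (1 / 3) S.attractor with hU
  have hEU : S.attractor ⊆ U := self_subset_thickening (by norm_num) _
  have hUo : IsOpen U := isOpen_thickening
  have hwU : ∀ w, S.word w '' U ⊆ U := by
    rintro w _ ⟨x, hx, rfl⟩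
    obtain ⟨e, he, hxe⟩ := mem_thickening_iff.1 hx
    refine mem_thickening_iff.2 ⟨S.word w e, h.word_mem w he, ?_⟩
    rw [h.dist_word]
    have : r ^ lev lam w ≤ 1 := pow_le_one₀ h.r_pos.le h.r_lt.le
    nlinarith [dist_nonneg (x := x) (y := e)]
  have hkey : ∀ (i j : S.ι) (w w' : List S.ι), i ≠ j →
      lev lam (i :: w ++ u) ≤ lev lam (j :: w' ++ u) →
      Disjoint (S.word (i :: w ++ u) '' U) (S.word (j :: w' ++ u) '' U) := by
    intro i j w w' hij hle
    rw [disjoint_left]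
    rintro _ ⟨x, hx, rfl⟩ ⟨y, hy, hxy⟩
    obtain ⟨a, ha, hxa⟩ := mem_thickening_iff.1 hx
    obtain ⟨b, hb, hyb⟩ := mem_thickening_iff.1 hy
    obtain ⟨b₁, b₂, hb12, hcut⟩ := exists_cut_append hle
    have h1 : S.word (j :: w' ++ u) b ∈ S.cyl b₁ := by
      refine h.cyl_append_subset b₁ b₂ ?_
      rw [← hb12]
      exact mem_image_of_mem _ hb
    obtain ⟨v', hv'⟩ := hu (i :: w) b₁ hcut ⟨S.word (i :: w ++ u) a, mem_image_of_mem _ ha, _, h1, by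
      have h2 := h.dist_word (i :: w ++ u) x a
      have h3 := h.dist_word (j :: w' ++ u) y b
      have h4 : r ^ lev lam (j :: w' ++ u) ≤ r ^ lev lam (i :: w ++ u) :=
        pow_le_pow_of_le_one h.r_pos.le h.r_lt.le hle
      have h5 := h.pow_pos (lev lam (i :: w ++ u))
      have h6 := h.pow_pos (lev lam (j :: w' ++ u))
      rw [hxy] at h3
      have h7 := dist_triangle_left (S.word (i :: w ++ u) a) (S.word (j :: w' ++ u) b)
        (S.word (i :: w ++ u) x)
      rw [h2, h3] at h7
      nlinarith⟩
    rw [hv'] at hb12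
    simp only [List.cons_append, List.cons.injEq] at hb12
    exact hij hb12.1.symm
  refine ⟨⋃ w, S.word (w ++ u) '' U, ⟨?_, ?_, ?_, ?_, ?_⟩, ?_⟩
  · obtain ⟨e, he⟩ := h.nonempty
    exact ⟨_, mem_iUnion.2 ⟨[], mem_image_of_mem _ (hEU he)⟩⟩
  · exact isOpen_iUnion fun w => isOpen_image_of_dist_eq (h.pow_pos _) (h.dist_word _) hUo
  · exact h.isCompact.isBounded.thickening.subset (iUnion_subset fun w => hwU _)
  · intro i
    rw [image_iUnion]
    refine iUnion_subset fun w => subset_iUnion_of_subset (i :: w) ?_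
    rw [List.cons_append, word_cons, image_comp]
  · intro i j hij
    rw [image_iUnion, image_iUnion, disjoint_iUnion_left]
    intro w
    rw [disjoint_iUnion_right]
    intro w'
    rw [← image_comp, ← image_comp, ← word_cons, ← word_cons, ← List.cons_append,
      ← List.cons_append]
    rcases le_total (lev lam (i :: w ++ u)) (lev lam (j :: w' ++ u)) with hle | hle
    · exact hkey i j w w' hij hle
    · exact (hkey j i w' w hij.symm hle).symm
  · obtain ⟨e, he⟩ := h.nonempty
    exact ⟨S.word u e, h.word_mem u he, mem_iUnion.2 ⟨[], mem_image_of_mem _ (hEU he)⟩⟩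

end IsReg

lemma IsIntSep.exists_sepIn {F : Set (EuclideanSpace ℝ (Fin d))} (hF : S.IsIntSep F) :
    ∃ t > 0, SepIn S.attractor t F := SepIn.exists_of_isCompact hF.2.1 hF.1 hF.2.2.1

namespace IsReg

variable (h : S.IsReg lam r p)
include h

lemma exists_isIntSep : ∃ F, S.IsIntSep F ∧ F.Nonempty := by
  obtain ⟨O, hO, x, hxE, hxO⟩ := h.exists_oscSet_inter
  obtain ⟨A, t, ht, hA, hxA, hAO⟩ := exists_sep_of_isTotallyDisconnected h.isCompact h.disc hxE
    (hO.2.1.mem_nhds hxO)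
  exact ⟨A, ⟨hA.isCompact h.isCompact ht, hA.1, hA.compl.isCompact h.isCompact ht, O, hO, hAO⟩,
    x, hxA⟩

lemma isIntSep_of_subset {F D : Set (EuclideanSpace ℝ (Fin d))} (hF : S.IsIntSep F) (hDF : D ⊆ F)
    {t : ℝ} (ht : 0 < t) (hD : SepIn S.attractor t D) : S.IsIntSep D := by
  obtain ⟨-, -, -, O, hO, hFO⟩ := hF
  exact ⟨hD.isCompact h.isCompact ht, hD.1, hD.compl.isCompact h.isCompact ht, O, hO,
    hDF.trans hFO⟩

end IsReg

/-- All copies of `F` are separated at their own scale. -/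
def HSep (S : IFS d) (lam : S.ι → ℕ) (r : ℝ) (F : Set (EuclideanSpace ℝ (Fin d))) : Prop :=
  ∃ c > 0, ∀ u, SepIn S.attractor (c * r ^ lev lam u) (S.word u '' F)

lemma HSep.exists_sepIn {F : Set (EuclideanSpace ℝ (Fin d))} (hF : S.HSep lam r F) :
    ∃ t > 0, SepIn S.attractor t F := by
  obtain ⟨c, hc, hcF⟩ := hF
  exact ⟨c, hc, by simpa using hcF []⟩

lemma HSep.subset {F : Set (EuclideanSpace ℝ (Fin d))} (hF : S.HSep lam r F) :
    F ⊆ S.attractor := hF.exists_sepIn.choose_spec.2.1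

namespace IsReg

variable (h : S.IsReg lam r p)
include h

lemma isCompact_of_hSep {F : Set (EuclideanSpace ℝ (Fin d))} (hF : S.HSep lam r F) :
    IsCompact F := by
  obtain ⟨t, ht, hs⟩ := hF.exists_sepIn
  exact hs.isCompact h.isCompact ht

lemma hSep_of_isIntSep {F : Set (EuclideanSpace ℝ (Fin d))} (hF : S.IsIntSep F) :
    S.HSep lam r F := by
  obtain ⟨t, ht, hs⟩ := hF.exists_sepIn
  obtain ⟨hFc, hFE, -, O, hO, hFO⟩ := hF
  obtain ⟨ρ, hρ, hth⟩ := hFc.exists_thickening_subset_open hO.2.1 hFO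
  refine ⟨min ρ t, lt_min hρ ht, fun u => ⟨(image_mono hFE).trans (h.cyl_subset u), ?_⟩⟩
  rintro _ ⟨x, hx, rfl⟩ y hy hyF
  refine not_lt.1 fun hlt => ?_
  have hc := h.pow_pos (lev lam u)
  obtain ⟨y, rfl⟩ := h.word_surjective u y
  rw [h.dist_word, mul_comm] at hlt
  have hlt := lt_of_mul_lt_mul_right hlt hc.le
  have hyO : y ∈ O := hth (mem_thickening_iff.2 ⟨x, hx, by
    rw [dist_comm]; exact hlt.trans_le (min_le_left _ _)⟩)
  obtain ⟨v, hv, hyv⟩ := h.exists_mem_cyl (lev lam u) hy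
  have hyE : y ∈ S.attractor := by
    by_cases huv : v = u
    · subst huv
      obtain ⟨z, hz, hzy⟩ := hyv
      rwa [← h.word_injective v hzy]
    · exfalso
      have h1 := h.disjoint_image_word hO (isCut_lev h.lam_pos u) hv (Ne.symm huv)
      have h2 : IsOpen (S.word u '' O) :=
        isOpen_image_of_dist_eq (h.pow_pos _) (h.dist_word u) hO.2.1
      have h3 := h1.closure_right h2
      refine disjoint_left.1 h3 (mem_image_of_mem _ hyO) ?_
      refine image_closure_subset_closure_image (h.word_continuous v) ?_
      exact image_mono (h.attractor_subset_closure hO) hyv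
  have := hs.2 x hx y hyE fun hyF' => hyF (mem_image_of_mem _ hyF')
  exact absurd this (not_le.2 (hlt.trans_le (min_le_right _ _)))

omit h in
lemma hSep_union (hr : 0 < r) {F G : Set (EuclideanSpace ℝ (Fin d))} (hF : S.HSep lam r F)
    (hG : S.HSep lam r G) : S.HSep lam r (F ∪ G) := by
  obtain ⟨c, hc, hF⟩ := hF
  obtain ⟨c', hc', hG⟩ := hG
  refine ⟨min c c', lt_min hc hc', fun u => ?_⟩
  have hu := _root_.pow_pos hr (lev lam u)
  rw [image_union]
  exact ((hF u).mono (mul_le_mul_of_nonneg_right (min_le_left _ _) hu.le)).union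
    ((hG u).mono (mul_le_mul_of_nonneg_right (min_le_right _ _) hu.le))

omit h in
lemma hSep_empty : S.HSep lam r ∅ := ⟨1, one_pos, fun u => by rw [image_empty]; exact SepIn.empty⟩

lemma hSep_biUnion {α : Type*} (s : Finset α) {F : α → Set (EuclideanSpace ℝ (Fin d))}
    (hF : ∀ a ∈ s, S.HSep lam r (F a)) : S.HSep lam r (⋃ a ∈ s, F a) := by
  classical
  induction s using Finset.induction_on with
  | empty => simpa using hSep_empty
  | insert a s _ ih =>
    rw [Finset.set_biUnion_insert]
    exact hSep_union h.r_pos (hF a (Finset.mem_insert_self a s))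
      (ih fun b hb => hF b (Finset.mem_insert_of_mem hb))

lemma hSep_image_word (w : List S.ι) {F : Set (EuclideanSpace ℝ (Fin d))} (hF : S.HSep lam r F) :
    S.HSep lam r (S.word w '' F) := by
  obtain ⟨c, hc, hF⟩ := hF
  refine ⟨c * r ^ lev lam w, mul_pos hc (h.pow_pos _), fun u => ?_⟩
  rw [← word_append_image, mul_assoc, ← pow_add, add_comm, ← lev_append]
  exact hF (u ++ w)

/-- The pull back of a separated set along a word. -/
lemma sepIn_of_image_word {u : List S.ι} {D : Set (EuclideanSpace ℝ (Fin d))}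
    (hDE : D ⊆ S.attractor) {t : ℝ} (hD : SepIn S.attractor t (S.word u '' D)) :
    SepIn S.attractor (t / r ^ lev lam u) D := by
  refine ⟨hDE, fun x hx y hy hyD => ?_⟩
  rw [div_le_iff₀ (h.pow_pos _), mul_comm, ← h.dist_word]
  refine hD.2 _ (mem_image_of_mem _ hx) _ (h.word_mem u hy) fun hy' => hyD ?_
  obtain ⟨z, hz, hzy⟩ := hy'
  rwa [← h.word_injective u hzy]

/-- The measure of a separated subset of a copy of an interior separated set. -/
lemma mu_mem_of_subset_image_word {F D : Set (EuclideanSpace ℝ (Fin d))} (hF : S.IsIntSep F)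
    {u : List S.ι} (hD : D ⊆ S.word u '' F) {t : ℝ} (ht : 0 < t) (hs : SepIn S.attractor t D) :
    ∃ D', S.IsIntSep D' ∧ S.mu.real D = p ^ lev lam u * S.mu.real D' := by
  obtain ⟨D', hD'F, rfl⟩ := subset_image_iff.1 hD
  have hD'E := hD'F.trans hF.2.1
  exact ⟨D', h.isIntSep_of_subset hF hD'F (div_pos ht (h.pow_pos _))
    (h.sepIn_of_image_word hD'E hs), h.mu_image_word u hD'E⟩

lemma cyl_subset_of_sepIn {A : Set (EuclideanSpace ℝ (Fin d))} {t : ℝ} (ht : 0 < t)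
    (hA : SepIn S.attractor t A) : ∃ k₀, ∀ k ≥ k₀, ∀ u, IsCut lam u k →
      (S.cyl u ∩ A).Nonempty → S.cyl u ⊆ A := by
  obtain ⟨D, hD, hd⟩ := h.exists_diam
  obtain ⟨k₀, hk₀⟩ := exists_pow_lt_of_lt_one (div_pos ht hD) h.r_lt
  refine ⟨k₀, fun k hk u hu ⟨x, hxu, hxA⟩ y hy => ?_⟩
  by_contra hyA
  have h1 := hA.2 x hxA y (h.cyl_subset u hy) hyA
  have h2 := h.dist_le_of_mem_cyl hd hxu hy
  have h3 : r ^ lev lam u ≤ r ^ k₀ :=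
    pow_le_pow_of_le_one h.r_pos.le h.r_lt.le (hk.trans hu.le)
  rw [lt_div_iff₀ hD] at hk₀
  nlinarith

open scoped Classical in
/-- A separated set is a union of cylinders. -/
lemma eq_biUnion_of_sepIn {A : Set (EuclideanSpace ℝ (Fin d))} {t : ℝ} (ht : 0 < t)
    (hA : SepIn S.attractor t A) : ∃ k₀, ∀ k ≥ k₀,
      A = ⋃ u ∈ (cuts h.lam_pos k).filter fun u => S.cyl u ⊆ A, S.cyl u := by
  obtain ⟨k₀, hk₀⟩ := h.cyl_subset_of_sepIn ht hA
  refine ⟨k₀, fun k hk => Subset.antisymm (fun x hx => ?_) (iUnion₂_subset fun u hu =>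
    (Finset.mem_filter.1 hu).2)⟩
  obtain ⟨u, hu, hxu⟩ := h.exists_mem_cyl k (hA.1 hx)
  exact mem_iUnion₂.2 ⟨u, Finset.mem_filter.2 ⟨mem_cuts.2 hu, hk₀ k hk u hu ⟨x, hxu, hx⟩⟩, hxu⟩

lemma mu_eq_sum_of_sepIn {A : Set (EuclideanSpace ℝ (Fin d))} {t : ℝ} (ht : 0 < t)
    (hA : SepIn S.attractor t A) : ∃ k₀, ∀ k ≥ k₀, ∃ C ⊆ cuts h.lam_pos k,
      A = (⋃ u ∈ C, S.cyl u) ∧ S.mu.real A = ∑ u ∈ C, p ^ lev lam u := by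
  classical
  obtain ⟨k₀, hk₀⟩ := h.eq_biUnion_of_sepIn ht hA
  refine ⟨k₀, fun k hk => ⟨_, Finset.filter_subset _ _, hk₀ k hk, ?_⟩⟩
  conv_lhs => rw [hk₀ k hk]
  exact h.mu_biUnion_cyl fun u hu => mem_cuts.1 (Finset.mem_filter.1 hu).1

lemma mu_mem_Zring {A : Set (EuclideanSpace ℝ (Fin d))} {t : ℝ} (ht : 0 < t)
    (hA : SepIn S.attractor t A) : S.mu.real A ∈ Zring p := by
  obtain ⟨k₀, hk₀⟩ := h.mu_eq_sum_of_sepIn ht hA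
  obtain ⟨C, -, -, hC⟩ := hk₀ k₀ le_rfl
  rw [hC]
  exact Subring.sum_mem _ fun u _ => pow_mem (mem_Zring_self p) _

lemma mu_pos {A : Set (EuclideanSpace ℝ (Fin d))} {t : ℝ} (ht : 0 < t)
    (hA : SepIn S.attractor t A) (hne : A.Nonempty) : 0 < S.mu.real A := by
  obtain ⟨k₀, hk₀⟩ := h.cyl_subset_of_sepIn ht hA
  obtain ⟨x, hx⟩ := hne
  obtain ⟨u, hu, hxu⟩ := h.exists_mem_cyl k₀ (hA.1 hx)
  have h1 := measureReal_mono (μ := S.mu) (hk₀ k₀ le_rfl u hu ⟨x, hxu, hx⟩)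
  rw [h.mu_cyl] at h1
  exact (_root_.pow_pos h.p_pos _).trans_le h1

end IsReg

end IFS

end

section

/-- The image in `ℝ` of an ideal of a subring of `ℝ`, as an additive group. -/
def idealGroup {R : Subring ℝ} (J : Ideal R) : AddSubgroup ℝ where
  carrier := idealSet J
  add_mem' := by
    rintro _ _ ⟨x, hx, rfl⟩ ⟨y, hy, rfl⟩
    exact ⟨x + y, J.add_mem hx hy, by simp⟩
  zero_mem' := ⟨0, J.zero_mem, by simp⟩
  neg_mem' := by
    rintro _ ⟨x, hx, rfl⟩
    exact ⟨-x, J.neg_mem hx, by simp⟩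

lemma mul_mem_idealGroup {R : Subring ℝ} {J : Ideal R} {a x : ℝ} (ha : a ∈ R)
    (hx : x ∈ idealGroup J) : a * x ∈ idealGroup J := by
  obtain ⟨x, hx, rfl⟩ := hx
  exact ⟨⟨a, ha⟩ * x, J.mul_mem_left _ hx, by simp⟩

/-- Elements of `Z[p]` are dense in the line. -/
lemma exists_mem_Zring_between {p : ℝ} (hp0 : 0 < p) (hp1 : p < 1) {a b : ℝ} (hab : a < b) :
    ∃ z ∈ Zring p, a < z ∧ z < b := by
  obtain ⟨k, hk⟩ := exists_pow_lt_of_lt_one (sub_pos.2 hab) hp1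
  have hpk : 0 < p ^ k := pow_pos hp0 k
  refine ⟨(⌊a / p ^ k⌋ + 1 : ℤ) * p ^ k,
    mul_mem (intCast_mem _ _) (pow_mem (mem_Zring_self p) k), ?_, ?_⟩
  · have := Int.lt_floor_add_one (a / p ^ k)
    rw [div_lt_iff₀ hpk] at this
    exact_mod_cast this
  · have := Int.floor_le (a / p ^ k)
    rw [le_div_iff₀ hpk] at this
    push_cast
    rw [add_mul, one_mul]
    linarith

/-- A small positive combination can be rewritten with small positive coefficients. -/
lemma exists_small_coeffs {p : ℝ} (hp0 : 0 < p) (hp1 : p < 1) {α : Type*} [DecidableEq α]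
    (s : Finset α) (c : α → ℝ) (hc : ∀ i ∈ s, 0 ≤ c i) (hcZ : ∀ i ∈ s, c i ∈ Zring p) {i₀ : α}
    (hi₀ : i₀ ∈ s) (hc₀ : 0 < c i₀) {ε : ℝ} (hε : 0 < ε) (a : α → ℝ) (ha : ∀ i ∈ s, a i ∈ Zring p)
    (h0 : 0 < ∑ i ∈ s, a i * c i) (h1 : ∑ i ∈ s, a i * c i < c i₀ * ε) :
    ∃ q : α → ℝ, (∀ i ∈ s, q i ∈ Zring p ∧ 0 < q i ∧ q i < ε) ∧
      ∑ i ∈ s, q i * c i = ∑ i ∈ s, a i * c i := by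
  set y := ∑ i ∈ s, a i * c i with hy
  set M := ∑ i ∈ s, c i with hM
  have hM0 : 0 ≤ M := Finset.sum_nonneg hc
  set ε' := min ε (y / (M + 1)) with hε'
  have hε'0 : 0 < ε' := lt_min hε (by positivity)
  have hz : ∀ i, ∃ z ∈ Zring p, (0 - a i) / c i₀ < z ∧ z < (ε' - a i) / c i₀ := fun i =>
    exists_mem_Zring_between hp0 hp1 (by gcongr)
  choose z hzZ hz1 hz2 using hz
  have hq1 : ∀ i, 0 < a i + c i₀ * z i := fun i => by
    have := hz1 i; rw [div_lt_iff₀ hc₀] at this; linarith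
  have hq2 : ∀ i, a i + c i₀ * z i < ε' := fun i => by
    have := hz2 i; rw [lt_div_iff₀ hc₀] at this; linarith
  set t := s.erase i₀ with ht
  have hts : ∀ i ∈ t, i ∈ s := fun i hi => Finset.mem_of_mem_erase hi
  have hsplit : ∀ g : α → ℝ, ∑ i ∈ s, g i = g i₀ + ∑ i ∈ t, g i := fun g =>
    (Finset.add_sum_erase s g hi₀).symm
  set q₀ := a i₀ - ∑ i ∈ t, c i * z i with hq₀
  have hsum : q₀ * c i₀ + ∑ i ∈ t, (a i + c i₀ * z i) * c i = y := by
    rw [hy, hsplit, hq₀]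
    simp only [add_mul, Finset.sum_add_distrib, sub_mul, Finset.sum_mul]
    have : ∑ i ∈ t, c i * z i * c i₀ = ∑ i ∈ t, c i₀ * z i * c i :=
      Finset.sum_congr rfl fun i _ => by ring
    rw [this]; ring
  have hlt : ∑ i ∈ t, (a i + c i₀ * z i) * c i < y := by
    calc ∑ i ∈ t, (a i + c i₀ * z i) * c i ≤ ∑ i ∈ t, ε' * c i :=
          Finset.sum_le_sum fun i hi => mul_le_mul_of_nonneg_right (hq2 i).le (hc i (hts i hi))
      _ = ε' * ∑ i ∈ t, c i := by rw [Finset.mul_sum]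
      _ ≤ ε' * M := by rw [hM, hsplit]; gcongr; linarith
      _ < ε' * (M + 1) := by gcongr; linarith
      _ ≤ y / (M + 1) * (M + 1) := by gcongr; exact min_le_right _ _
      _ = y := by field_simp
  have hnn : 0 ≤ ∑ i ∈ t, (a i + c i₀ * z i) * c i :=
    Finset.sum_nonneg fun i hi => mul_nonneg (hq1 i).le (hc i (hts i hi))
  refine ⟨fun i => if i = i₀ then q₀ else a i + c i₀ * z i, fun i hi => ?_, ?_⟩
  · by_cases hii : i = i₀
    · simp only [hii, if_true]
      refine ⟨sub_mem (ha _ hi₀) (sum_mem fun i hi =>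
        mul_mem (hcZ i (hts i hi)) (hzZ i)), ?_, ?_⟩
      · by_contra! hle
        nlinarith
      · have : c i₀ * q₀ < c i₀ * ε := by linarith
        exact lt_of_mul_lt_mul_left this hc₀.le
    · simp only [hii, if_false]
      exact ⟨add_mem (ha i hi) (mul_mem (hcZ _ hi₀) (hzZ i)), hq1 i,
        (hq2 i).trans_le (min_le_left _ _)⟩
  · rw [hsplit]
    simp only [if_true]
    rw [← hsum]
    congr 1
    refine Finset.sum_congr rfl fun i hi => ?_
    rw [if_neg (Finset.ne_of_mem_erase hi)]

/-- The ring `Z[p]` is Noetherian, so ideals are finitely generated by given generators. -/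
lemma exists_finset_span {p : ℝ} (G : Set (Zring p)) :
    ∃ s : Finset (Zring p), (s : Set (Zring p)) ⊆ G ∧ Ideal.span (s : Set (Zring p)) =
      Ideal.span G := by
  have : IsNoetherianRing (Zring p) := is_noetherian_subring_closure {p} (finite_singleton p)
  have hfg : (Ideal.span G).FG := IsNoetherian.noetherian _
  obtain ⟨s, hs, hs'⟩ := (Submodule.fg_span_iff_fg_span_finset_subset G).1 hfg
  exact ⟨s, hs, hs'.symm⟩

namespace IFS
variable {d : ℕ} {S : IFS d} {lam : S.ι → ℕ} {r p : ℝ}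

lemma mu_mem_idealGroup (hp : ∀ F, S.IsIntSep F → S.mu.real F ∈ Zring p)
    {F : Set (EuclideanSpace ℝ (Fin d))} (hF : S.IsIntSep F) :
    S.mu.real F ∈ idealGroup (S.idealOf p) :=
  ⟨⟨_, hp F hF⟩, Ideal.subset_span ⟨F, hF, mu_real_of_subset hF.2.1⟩, rfl⟩

namespace IsReg
variable (h : S.IsReg lam r p)
include h

lemma mem_idealGroup_of_isIntSep {F : Set (EuclideanSpace ℝ (Fin d))} (hF : S.IsIntSep F) :
    S.mu.real F ∈ idealGroup (S.idealOf p) :=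
  mu_mem_idealGroup (fun F hF => by
    obtain ⟨t, ht, hs⟩ := hF.exists_sepIn
    exact h.mu_mem_Zring ht hs) hF

lemma exists_card_cuts (m : ℕ) : ∃ n, m ≤ (cuts h.lam_pos n).card := by
  obtain ⟨n, hn⟩ := exists_pow_lt_of_lt_one (show (0 : ℝ) < 1 / (m + 1) by positivity) h.p_lt
  refine ⟨n, ?_⟩
  have h1 := sum_cuts_pow h.sum_eq h.lam_pos n
  have h2 : ∑ u ∈ cuts h.lam_pos n, p ^ lev lam u ≤ (cuts h.lam_pos n).card * p ^ n := by
    rw [← nsmul_eq_mul]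
    exact Finset.sum_le_card_nsmul _ _ _ fun u hu =>
      pow_le_pow_of_le_one h.p_pos.le h.p_lt.le (mem_cuts.1 hu).le
  rw [h1] at h2
  have h3 : (0 : ℝ) < m + 1 := by positivity
  rw [lt_div_iff₀ h3] at hn
  by_contra! hlt
  have h4 : ((cuts h.lam_pos n).card : ℝ) ≤ m := by exact_mod_cast hlt.le
  have h5 : 0 < p ^ n := pow_pos h.p_pos n
  nlinarith

/-- Small positive elements of the ideal are measures of hereditarily separated sets. -/
lemma exists_hSep_mu_eq : ∃ σ > 0, ∀ y ∈ idealGroup (S.idealOf p), 0 < y → y < σ →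
    ∃ F, S.HSep lam r F ∧ S.mu.real F = y := by
  classical
  obtain ⟨s₀, hs₀, hspan⟩ := exists_finset_span
    {x : Zring p | ∃ F, S.IsIntSep F ∧ (x : ℝ) = S.natMeasure F}
  obtain ⟨F₁, hF₁, hne⟩ := h.exists_isIntSep
  obtain ⟨t, ht, hst⟩ := hF₁.exists_sepIn
  set i₀ : Zring p := ⟨S.mu.real F₁, h.mu_mem_Zring ht hst⟩ with hi₀
  have hi₀0 : 0 < (i₀ : ℝ) := h.mu_pos ht hst hne
  set s := insert i₀ s₀ with hs
  have hsG : ∀ c ∈ s, ∃ F, S.IsIntSep F ∧ S.mu.real F = c := by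
    intro c hc
    rcases Finset.mem_insert.1 hc with rfl | hc
    · exact ⟨F₁, hF₁, rfl⟩
    · obtain ⟨F, hF, hFc⟩ := hs₀ hc
      exact ⟨F, hF, by rw [mu_real_of_subset hF.2.1, hFc]⟩
  obtain ⟨n, hn⟩ := h.exists_card_cuts s.card
  obtain ⟨⟨w, hw⟩⟩ : Nonempty (s ↪ cuts h.lam_pos n) :=
    Function.Embedding.nonempty_of_card_le (by simpa using hn)
  have hwinj : Function.Injective fun c => (w c : List S.ι) := Subtype.val_injective.comp hw
  obtain ⟨Λ, hΛ0, hΛ⟩ := exists_lam_bound lam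
  refine ⟨(i₀ : ℝ) * p ^ (n + Λ), mul_pos hi₀0 (pow_pos h.p_pos _), fun y hy hy0 hyσ => ?_⟩
  obtain ⟨a, ha⟩ : ∃ a : Zring p → Zring p, y = ∑ c ∈ s, (a c : ℝ) * c := by
    obtain ⟨x, hx, rfl⟩ := hy
    have hx' : x ∈ Ideal.span (s : Set (Zring p)) := by
      have hx0 : x ∈ Ideal.span (s₀ : Set (Zring p)) := by rw [hspan]; exact hx
      exact Ideal.span_mono (Finset.coe_subset.2 (Finset.subset_insert _ _)) hx0
    obtain ⟨a, -, hax⟩ := Submodule.mem_span_finset.1 hx'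
    refine ⟨a, ?_⟩
    rw [← hax]
    simp
  obtain ⟨q, hq, hqs⟩ := exists_small_coeffs h.p_pos h.p_lt s (fun c => (c : ℝ))
    (fun c hc => by obtain ⟨F, -, hF⟩ := hsG c hc; simp only [← hF]; exact measureReal_nonneg)
    (fun c _ => c.2) (Finset.mem_insert_self _ _) hi₀0 (pow_pos h.p_pos (n + Λ))
    (fun c => (a c : ℝ)) (fun c _ => (a c).2) (by rwa [← ha]) (by rwa [← ha])
  choose F hF hFc using fun c : s => hsG c c.2
  have hlev : ∀ c : s, p ^ (n + Λ) ≤ p ^ lev lam (w c : List S.ι) := fun c =>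
    pow_le_pow_of_le_one h.p_pos.le h.p_lt.le ((mem_cuts.1 (w c).2).lt hΛ0 hΛ).le
  have hex : ∀ c : s, ∃ n, ∃ C ⊆ cuts h.lam_pos n,
      ∑ u ∈ C, p ^ lev lam u = q c / p ^ lev lam (w c : List S.ι) := fun c => by
    obtain ⟨h1, h2, h3⟩ := hq c c.2
    have hpos : 0 < p ^ lev lam (w c : List S.ι) := pow_pos h.p_pos _
    refine exists_subset_cuts h.p_pos h.sum_eq h.lam_pos h.gcd_eq ?_ (div_pos h2 hpos)
      ((div_lt_one hpos).2 (h3.trans_le (hlev c)))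
    rw [div_eq_mul_inv, ← inv_pow]
    exact mul_mem h1 (pow_mem h.inv_mem _)
  choose k C hC hCs using hex
  let G : s → Set (EuclideanSpace ℝ (Fin d)) := fun c => ⋃ v ∈ C c, S.word v '' F c
  have hG : ∀ c, S.HSep lam r (G c) := fun c =>
    h.hSep_biUnion _ fun v _ => h.hSep_image_word v (h.hSep_of_isIntSep (hF c))
  have hGm : ∀ c, S.mu.real (G c) = q c / p ^ lev lam (w c : List S.ι) * c := fun c => by
    simp only [G]
    rw [h.mu_biUnion (fun u hu => mem_cuts.1 (hC c hu)) (fun _ _ => (hF c).2.1)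
      (fun _ _ => (hF c).1), ← Finset.sum_mul, hCs, hFc]
  let H := Function.extend (fun c => (w c : List S.ι)) G fun _ => ∅
  have hH : ∀ c, H (w c) = G c := fun c => hwinj.extend_apply G _ c
  refine ⟨⋃ u ∈ (Finset.univ.image fun c => (w c : List S.ι)), S.word u '' H u,
    h.hSep_biUnion _ fun u hu => ?_, ?_⟩
  · obtain ⟨c, -, rfl⟩ := Finset.mem_image.1 hu
    rw [hH]
    exact h.hSep_image_word _ (hG c)
  · rw [h.mu_biUnion (k := n), Finset.sum_image fun _ _ _ _ hab => hwinj hab]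
    · rw [ha, ← hqs, ← Finset.sum_coe_sort s]
      refine Finset.sum_congr rfl fun c _ => ?_
      rw [hH, hGm]
      have hpos : p ^ lev lam (w c : List S.ι) ≠ 0 := (pow_pos h.p_pos _).ne'
      field_simp
    · intro u hu
      obtain ⟨c, -, rfl⟩ := Finset.mem_image.1 hu
      exact mem_cuts.1 (w c).2
    · intro u hu
      obtain ⟨c, -, rfl⟩ := Finset.mem_image.1 hu
      rw [hH]; exact (hG c).subset
    · intro u hu
      obtain ⟨c, -, rfl⟩ := Finset.mem_image.1 hu
      rw [hH]; exact h.isCompact_of_hSep (hG c)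

/-- There are interior separated sets whose measure is `1 - p` times an element of the ideal and
which exhaust the attractor up to any error. -/
lemma exists_good : ∃ O, S.OSCSet O ∧ ∀ θ > 0, ∃ B, S.HSep lam r B ∧ B ⊆ O ∧
    (∃ z ∈ idealGroup (S.idealOf p), S.mu.real B = (1 - p) * z) ∧
    S.mu.real (S.attractor \ B) ≤ θ := by
  classical
  obtain ⟨F, hF, hne⟩ := h.exists_isIntSep
  obtain ⟨O, hO, hFO⟩ := hF.2.2.2
  have hFH := h.hSep_of_isIntSep hF
  obtain ⟨t, ht, hst⟩ := hF.exists_sepIn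
  have hμF : 0 < S.mu.real F := h.mu_pos ht hst hne
  have hιne : Nonempty S.ι := by
    by_contra hc
    rw [not_nonempty_iff] at hc
    have := h.sum_eq
    simp at this
  obtain ⟨i₀⟩ := hιne
  have hi₀ : IsCut lam [i₀] 1 := by
    rw [isCut_cons, isCut_nil]; exact ⟨one_pos, Nat.sub_eq_zero_of_le (h.lam_pos i₀)⟩
  set C := (cuts h.lam_pos 1).erase [i₀] with hC
  set F₀ : Set (EuclideanSpace ℝ (Fin d)) := ⋃ u ∈ C, S.word u '' F with hF₀
  have hF₀H : S.HSep lam r F₀ := h.hSep_biUnion _ fun u _ => h.hSep_image_word u hFH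
  have hF₀O : F₀ ⊆ O := iUnion₂_subset fun u _ => (image_mono hFO).trans (IsSys.image_word_subset hO u)
  have hF₀μ : S.mu.real F₀ = (1 - p ^ lam i₀) * S.mu.real F := by
    rw [hF₀, h.mu_biUnion (k := 1) (fun u hu => mem_cuts.1 (Finset.mem_of_mem_erase hu))
      (fun _ _ => hF.2.1) (fun _ _ => hF.1), ← Finset.sum_mul]
    congr 1
    have := Finset.add_sum_erase (cuts h.lam_pos 1) (fun u => p ^ lev lam u) (mem_cuts.2 hi₀)
    rw [sum_cuts_pow h.sum_eq h.lam_pos 1] at this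
    simp only [lev_cons, lev_nil, add_zero] at this
    linarith
  have hc₀ : 0 < S.mu.real F₀ := by
    rw [hF₀μ]
    exact mul_pos (sub_pos.2 (pow_lt_one₀ h.p_pos.le h.p_lt (h.lam_pos i₀).ne')) hμF
  have hc₁ : S.mu.real F₀ ≤ 1 := by
    rw [← h.mu_attractor]; exact measureReal_mono hF₀H.subset
  obtain ⟨z₀, hz₀, hz₀F⟩ : ∃ z ∈ idealGroup (S.idealOf p), S.mu.real F₀ = (1 - p) * z := by
    refine ⟨(∑ i ∈ Finset.range (lam i₀), p ^ i) * S.mu.real F,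
      mul_mem_idealGroup (sum_mem fun i _ => pow_mem (mem_Zring_self p) i)
        (h.mem_idealGroup_of_isIntSep hF), ?_⟩
    rw [hF₀μ, ← mul_assoc, mul_neg_geom_sum]
  have hdiff : ∀ B, S.HSep lam r B → S.mu.real (S.attractor \ B) = 1 - S.mu.real B := by
    intro B hB
    rw [measureReal_sdiff hB.subset (h.isCompact_of_hSep hB).measurableSet, h.mu_attractor]
  have step : ∀ n : ℕ, ∃ B, S.HSep lam r B ∧ B ⊆ O ∧
      (∃ z ∈ idealGroup (S.idealOf p), S.mu.real B = (1 - p) * z) ∧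
      S.mu.real (S.attractor \ B) ≤ (1 - S.mu.real F₀) ^ n := by
    intro n
    induction n with
    | zero =>
      refine ⟨∅, hSep_empty, empty_subset _, ⟨0, zero_mem _, by simp⟩, ?_⟩
      simp [h.mu_attractor]
    | succ n ih =>
      obtain ⟨B, hB, hBO, ⟨z, hz, hzB⟩, hle⟩ := ih
      obtain ⟨t, ht, hBt⟩ := hB.exists_sepIn
      obtain ⟨k, hk⟩ := h.mu_eq_sum_of_sepIn ht hBt.compl
      obtain ⟨C, hC, hCE, hCs⟩ := hk k le_rfl
      set G : Set (EuclideanSpace ℝ (Fin d)) := ⋃ u ∈ C, S.word u '' F₀ with hG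
      have hGH : S.HSep lam r G := h.hSep_biUnion _ fun u _ => h.hSep_image_word u hF₀H
      have hGμ : S.mu.real G = S.mu.real (S.attractor \ B) * S.mu.real F₀ := by
        rw [hG, h.mu_biUnion (fun u hu => mem_cuts.1 (hC hu)) (fun _ _ => hF₀H.subset)
          (fun _ _ => h.isCompact_of_hSep hF₀H), ← Finset.sum_mul, hCs]
      have hdis : Disjoint B G := by
        rw [Set.disjoint_left]
        intro x hx hxG
        have : x ∈ S.attractor \ B := by
          rw [hCE]
          refine iUnion₂_mono (fun u _ => image_mono hF₀H.subset) hxG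
        exact this.2 hx
      have hBG : S.mu.real (B ∪ G) = S.mu.real B + S.mu.real G :=
        measureReal_union hdis (h.isCompact_of_hSep hGH).measurableSet (measure_ne_top _ _)
          (measure_ne_top _ _)
      refine ⟨B ∪ G, hSep_union h.r_pos hB hGH, union_subset hBO
        (iUnion₂_subset fun u _ => (image_mono hF₀O).trans (IsSys.image_word_subset hO u)),
        ⟨z + S.mu.real (S.attractor \ B) * z₀, add_mem hz (mul_mem_idealGroup
          (h.mu_mem_Zring ht hBt.compl) hz₀), ?_⟩, ?_⟩
      · rw [hBG, hGμ, hzB, hz₀F]; ring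
      · rw [hdiff _ (hSep_union h.r_pos hB hGH), hBG, hGμ, pow_succ, ← sub_sub, ← hdiff B hB]
        nlinarith
  refine ⟨O, hO, fun θ hθ => ?_⟩
  obtain ⟨n, hn⟩ := exists_pow_lt_of_lt_one hθ (show 1 - S.mu.real F₀ < 1 by linarith)
  obtain ⟨B, h1, h2, h3, h4⟩ := step n
  exact ⟨B, h1, h2, h3, h4.trans hn.le⟩

end IsReg
end IFS

end

section

namespace IFS
variable {d : ℕ} {S : IFS d} {lam : S.ι → ℕ} {r p : ℝ}

/-- The multiple by `a` of the natural measure, as a measure on the attractor. -/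
def subMu (S : IFS d) (a : ℝ) : Measure S.attractor :=
  ENNReal.ofReal a • S.mu.comap Subtype.val

namespace IsReg
variable (h : S.IsReg lam r p)
include h

lemma subMu_apply (a : ℝ) (A : Set S.attractor) :
    S.subMu a A = ENNReal.ofReal a * S.mu (Subtype.val '' A) := by
  rw [subMu, Measure.smul_apply, comap_subtype_coe_apply h.isCompact.measurableSet, smul_eq_mul]

lemma isFiniteMeasure_subMu (a : ℝ) : IsFiniteMeasure (S.subMu a) :=
  ⟨by rw [h.subMu_apply]; exact ENNReal.mul_lt_top ENNReal.ofReal_lt_top (measure_lt_top _ _)⟩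

lemma subMu_real {a : ℝ} (ha : 0 ≤ a) (A : Set S.attractor) :
    (S.subMu a).real A = a * S.mu.real (Subtype.val '' A) := by
  rw [measureReal_def, h.subMu_apply, ENNReal.toReal_mul, ENNReal.toReal_ofReal ha, measureReal_def]

/-- Separated sets of small diameter are unions of boundedly many cylinders of comparable level. -/
lemma exists_cuts_of_sepIn {ε : ℝ} (hε : 0 < ε) (R : ℝ) :
    ∃ K M : ℕ, ∀ k A, SepIn S.attractor (ε * r ^ k) A → ∀ x ∈ A, (∀ y ∈ A, dist y x ≤ R * r ^ k) →
      ∃ C ⊆ cuts h.lam_pos (k + K), C.Nonempty ∧ C.card ≤ M ∧ A = ⋃ u ∈ C, S.cyl u := by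
  classical
  obtain ⟨D, hD, hd⟩ := h.exists_diam
  obtain ⟨K, hK⟩ := exists_pow_lt_of_lt_one (div_pos hε hD) h.r_lt
  rw [lt_div_iff₀ hD] at hK
  obtain ⟨M, hMb⟩ := h.exists_cyl_bound (R * (r ^ K)⁻¹)
  refine ⟨K, M, fun k A hA x hx hR => ?_⟩
  set C := (cuts h.lam_pos (k + K)).filter fun u => S.cyl u ⊆ A with hC
  have hmem : ∀ y ∈ A, ∃ u ∈ C, y ∈ S.cyl u := by
    intro y hy
    obtain ⟨u, hu, hyu⟩ := h.exists_mem_cyl (k + K) (hA.1 hy)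
    refine ⟨u, Finset.mem_filter.2 ⟨mem_cuts.2 hu, fun z hz => ?_⟩, hyu⟩
    by_contra hzA
    have h1 := hA.2 y hy z (h.cyl_subset u hz) hzA
    have h2 := h.dist_le_of_mem_cyl hd hyu hz
    have h3 : r ^ lev lam u ≤ r ^ (k + K) := pow_le_pow_of_le_one h.r_pos.le h.r_lt.le hu.le
    have h4 := h.pow_pos k
    rw [pow_add] at h3
    nlinarith
  refine ⟨C, Finset.filter_subset _ _, ?_, ?_, ?_⟩
  · obtain ⟨u, hu, -⟩ := hmem x hx
    exact ⟨u, hu⟩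
  · refine hMb (k + K) x C (fun u hu => mem_cuts.1 (Finset.mem_filter.1 hu).1) fun u hu => ?_
    obtain ⟨y, hy⟩ := h.cyl_nonempty u
    refine ⟨y, hy, ?_⟩
    rw [pow_add, mul_comm (r ^ k), mul_assoc, inv_mul_cancel_left₀ (h.pow_pos K).ne']
    exact hR y ((Finset.mem_filter.1 hu).2 hy)
  · ext y
    simp only [mem_iUnion, exists_prop]
    exact ⟨hmem y, fun ⟨u, hu, hy⟩ => (Finset.mem_filter.1 hu).2 hy⟩

lemma exists_node_cuts {δ : ℝ} (hδ : 0 < δ) (hN : IsTree (sepNode S.attractor δ r))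
    (hM : IsMetricTree (sepNode S.attractor δ r) r δ 1) :
    ∃ K M : ℕ, ∀ k x, ∃ C ⊆ cuts h.lam_pos (k + K), C.Nonempty ∧ C.card ≤ M ∧
      Subtype.val '' sepNode S.attractor δ r k x = ⋃ u ∈ C, S.cyl u := by
  obtain ⟨K, M, hKM⟩ := h.exists_cuts_of_sepIn hδ 1
  refine ⟨K, M, fun k x => hKM k _ (sepIn_of_sat (hN.sat_node k x)) x ⟨x, hN.self k x, rfl⟩ ?_⟩
  rintro _ ⟨y, hy, rfl⟩
  rw [dist_comm]
  exact hM.dist_le k x y hy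

/-- The weights of nodes belong to a finite set. -/
lemma exists_weights (K M : ℕ) : ∃ W : Finset ℝ, (∀ w ∈ W, 0 < w) ∧
    ∀ k, ∀ C ⊆ cuts h.lam_pos (k + K), C.Nonempty → C.card ≤ M →
      ∃ w ∈ W, ∑ u ∈ C, p ^ lev lam u = p ^ k * w := by
  classical
  obtain ⟨Λ, hΛ0, hΛ⟩ := exists_lam_bound lam
  set V := (Finset.range (K + Λ)).image fun j => p ^ j with hV
  have hV0 : ∀ v ∈ V, 0 < v := by
    intro v hv
    obtain ⟨j, -, rfl⟩ := Finset.mem_image.1 hv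
    exact pow_pos h.p_pos j
  refine ⟨(finite_natCombs_le V hV0 M).toFinset.filter (0 < ·),
    fun w hw => (Finset.mem_filter.1 hw).2, fun k C hC hne hcard => ?_⟩
  have hlev : ∀ u ∈ C, k + K ≤ lev lam u ∧ lev lam u < k + K + Λ := fun u hu =>
    ⟨(mem_cuts.1 (hC hu)).le, (mem_cuts.1 (hC hu)).lt hΛ0 hΛ⟩
  have heq : ∑ u ∈ C, p ^ lev lam u = p ^ k * ∑ u ∈ C, p ^ (lev lam u - k) := by
    rw [Finset.mul_sum]
    refine Finset.sum_congr rfl fun u hu => ?_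
    rw [← pow_add]
    congr 1
    have := hlev u hu
    omega
  refine ⟨∑ u ∈ C, p ^ (lev lam u - k), Finset.mem_filter.2 ⟨?_, ?_⟩, heq⟩
  · rw [Set.Finite.mem_toFinset]
    refine ⟨⟨fun v => (C.filter fun u => p ^ (lev lam u - k) = v).card, ?_⟩, ?_⟩
    · rw [← Finset.sum_fiberwise_of_maps_to (s := C) (t := V)
        (g := fun u => p ^ (lev lam u - k)) (fun u hu => Finset.mem_image.2
          ⟨lev lam u - k, Finset.mem_range.2 (by have := hlev u hu; omega), rfl⟩)]
      refine Finset.sum_congr rfl fun v _ => ?_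
      rw [Finset.sum_congr rfl fun u hu => (Finset.mem_filter.1 hu).2, Finset.sum_const,
        nsmul_eq_mul]
    · calc ∑ u ∈ C, p ^ (lev lam u - k) ≤ ∑ u ∈ C, (1 : ℝ) :=
            Finset.sum_le_sum fun u _ => pow_le_one₀ h.p_pos.le h.p_lt.le
        _ = C.card := by simp
        _ ≤ M := by exact_mod_cast hcard
  · exact Finset.sum_pos (fun u _ => pow_pos h.p_pos _) hne

/-- The tree of separated sets of the attractor. -/
lemma exists_tree : ∃ δ > 0, IsTree (sepNode S.attractor δ r) ∧
    IsMetricTree (sepNode S.attractor δ r) r δ 1 := by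
  obtain ⟨δ, hδ, hs⟩ := h.exists_sepIn
  exact ⟨δ, hδ, isTree_sepNode h.isCompact hδ h.r_pos h.r_lt,
    isMetricTree_sepNode hδ h.r_pos h.r_lt hs⟩

lemma exists_base {δ : ℝ} (hδ : 0 < δ) (hN : IsTree (sepNode S.attractor δ r))
    (hM : IsMetricTree (sepNode S.attractor δ r) r δ 1) {a : ℝ} (ha : 0 < a) {I : AddSubgroup ℝ}
    (hI : ∀ y, y ∈ I ↔ ∃ z ∈ idealGroup (S.idealOf p), y = a * z) :
    ∃ W σ, Base (sepNode S.attractor δ r) p (S.subMu a).real I W σ := by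
  classical
  have := isCompact_iff_compactSpace.1 h.isCompact
  have := h.isFiniteMeasure_subMu a
  obtain ⟨K, M, hC⟩ := h.exists_node_cuts hδ hN hM
  obtain ⟨W, hW0, hW⟩ := h.exists_weights K M
  obtain ⟨σ, hσ, hrich⟩ := h.exists_hSep_mu_eq
  obtain ⟨Λ, hΛ0, hΛ⟩ := exists_lam_bound lam
  refine ⟨W.image (a * ·), a * (σ * p ^ (K + Λ)), ?_⟩
  refine ⟨hN, h.p_pos, h.p_lt, ?_, ?_, ?_, ?_, ?_, by have := h.p_pos; positivity, ?_⟩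
  · intro k A B hA hB hd
    exact measureReal_union hd (hM.isClosed hB).measurableSet (measure_ne_top _ _)
      (measure_ne_top _ _)
  · intro w hw
    obtain ⟨w', hw', rfl⟩ := Finset.mem_image.1 hw
    exact mul_pos ha (hW0 w' hw')
  · intro k x
    obtain ⟨C, hCc, hne, hcard, heq⟩ := hC k x
    obtain ⟨w, hw, hws⟩ := hW k C hCc hne hcard
    refine ⟨a * w, Finset.mem_image_of_mem _ hw, ?_⟩
    rw [h.subMu_real ha.le, heq, h.mu_biUnion_cyl fun u hu => mem_cuts.1 (hCc hu), hws]
    ring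
  · intro y hy
    obtain ⟨z, hz, rfl⟩ := (hI y).1 hy
    exact (hI _).2 ⟨p * z, mul_mem_idealGroup (mem_Zring_self p) hz, by ring⟩
  · intro y hy
    obtain ⟨z, hz, rfl⟩ := (hI y).1 hy
    exact (hI _).2 ⟨p⁻¹ * z, mul_mem_idealGroup h.inv_mem hz, by ring⟩
  · intro y hy hy0 hyσ
    obtain ⟨z, hz, rfl⟩ := (hI y).1 hy
    have hz0 : 0 < z := pos_of_mul_pos_right hy0 ha.le
    have hzσ : z < σ * p ^ (K + Λ) := lt_of_mul_lt_mul_left hyσ ha.le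
    have hex : ∀ j ∈ Finset.range (K + Λ), ∃ F, S.HSep lam r F ∧ S.mu.real F = (p ^ j)⁻¹ * z := by
      intro j hj
      have hpj : 0 < p ^ j := pow_pos h.p_pos j
      refine hrich _ (mul_mem_idealGroup (by rw [← inv_pow]; exact pow_mem h.inv_mem j) hz)
        (by positivity) ?_
      rw [inv_mul_lt_iff₀ hpj]
      refine hzσ.trans_le ?_
      rw [mul_comm]
      exact mul_le_mul_of_nonneg_right (pow_le_pow_of_le_one h.p_pos.le h.p_lt.le
        (Finset.mem_range.1 hj).le) hσ.le
    choose! F hF hFm using hex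
    have hFc : ∀ j ∈ Finset.range (K + Λ), ∃ c > 0, ∀ u,
      SepIn S.attractor (c * r ^ lev lam u) (S.word u '' F j) := fun j hj => hF j hj
    choose! c hc hcs using hFc
    obtain ⟨ε, hε, hεc⟩ := exists_pos_le_of_finset (Finset.range (K + Λ)) (t := fun j => c j * r ^ j)
      fun j hj => mul_pos (hc j hj) (h.pow_pos j)
    obtain ⟨K', hK'⟩ := exists_pow_lt_of_lt_one (div_pos hε hδ) h.r_lt
    rw [lt_div_iff₀ hδ] at hK'
    refine ⟨K', fun k x => ?_⟩
    obtain ⟨C, hCc, ⟨u, hu⟩, -, heq⟩ := hC k x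
    have hu1 := (mem_cuts.1 (hCc hu)).le
    have hu2 := (mem_cuts.1 (hCc hu)).lt hΛ0 hΛ
    obtain ⟨j, hj⟩ := Nat.exists_eq_add_of_le (show k ≤ lev lam u by omega)
    have hjm : j ∈ Finset.range (K + Λ) := Finset.mem_range.2 (by omega)
    have hFE : S.word u '' F j ⊆ S.cyl u := image_mono (hF j hjm).subset
    have hsub : S.word u '' F j ⊆ Subtype.val '' sepNode S.attractor δ r k x := by
      rw [heq]
      exact hFE.trans (subset_biUnion_of_mem (u := S.cyl) hu)
    refine ⟨Subtype.val ⁻¹' (S.word u '' F j), ?_, ?_, ?_⟩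
    · intro y hy
      obtain ⟨y', hy', he⟩ := hsub hy
      rwa [← Subtype.val_injective he]
    · refine sat_of_sepIn ?_ (hcs j hjm u)
      rw [hj, pow_add, pow_add]
      have h1 := hεc j hjm
      have h2 := h.pow_pos k
      nlinarith
    · rw [h.subMu_real ha.le, Subtype.image_preimage_coe,
        inter_eq_self_of_subset_right (hFE.trans (h.cyl_subset u)),
        h.mu_image_word u (hF j hjm).subset, hFm j hjm, hj, pow_add]
      have := (pow_pos h.p_pos j).ne'
      field_simp

lemma exists_goodParts {δ : ℝ} (hδ : 0 < δ) (hN : IsTree (sepNode S.attractor δ r))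
    (hM : IsMetricTree (sepNode S.attractor δ r) r δ 1) {a : ℝ} (ha : 0 < a) {I : AddSubgroup ℝ}
    (hI : ∀ y, y ∈ I ↔ ∃ z ∈ idealGroup (S.idealOf p), y = a * z) :
    ∃ L₀, ∀ L ≥ L₀, ∀ k x, ∃ R, IsGoodPart (hN.rescale L) (S.subMu a) (p ^ L) p I k
      (sepNode S.attractor δ r (L * k) x) R := by
  classical
  have hcpt := isCompact_iff_compactSpace.1 h.isCompact
  have hfin := h.isFiniteMeasure_subMu a
  obtain ⟨K, M, hC⟩ := h.exists_node_cuts hδ hN hM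
  obtain ⟨Λ, hΛ0, hΛ⟩ := exists_lam_bound lam
  obtain ⟨O, hO, hgood⟩ := h.exists_good
  set w := p ^ (K + Λ) with hw
  have hw0 : 0 < w := pow_pos h.p_pos _
  have hMpos : (0 : ℝ) < 2 * M + 1 := by positivity
  obtain ⟨B, hB, hBO, ⟨z, hz, hBz⟩, hBθ⟩ := hgood (min (w / (2 * M + 1)) (1 / 2))
    (lt_min (by positivity) (by norm_num))
  have hBne : B.Nonempty := by
    by_contra hne
    rw [not_nonempty_iff_eq_empty] at hne
    rw [hne, sdiff_empty, h.mu_attractor] at hBθ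
    have := hBθ.trans (min_le_right _ _)
    norm_num at this
  obtain ⟨c, hc, hcs⟩ := id hB
  obtain ⟨L₀, hL₀⟩ := exists_pow_lt_of_lt_one (show 0 < c * r ^ (K + Λ) / δ by
    have := h.pow_pos (K + Λ); positivity) h.r_lt
  rw [lt_div_iff₀ hδ] at hL₀
  refine ⟨L₀, fun L hL k x => ?_⟩
  have hLr : r ^ L * δ ≤ c * r ^ (K + Λ) :=
    (mul_le_mul_of_nonneg_right (pow_le_pow_of_le_one h.r_pos.le h.r_lt.le hL) hδ.le).trans hL₀.le
  obtain ⟨C, hCc, hCne, hcard, heq⟩ := hC (L * k) x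
  have hcut : ∀ u ∈ C, IsCut lam u (L * k + K) := fun u hu => mem_cuts.1 (hCc hu)
  set Y : Set (EuclideanSpace ℝ (Fin d)) := ⋃ u ∈ C, S.word u '' B with hY
  have hYc : Y ⊆ ⋃ u ∈ C, S.cyl u := iUnion₂_mono fun u _ => image_mono hB.subset
  have hYE : Y ⊆ S.attractor := hYc.trans (iUnion₂_subset fun u _ => h.cyl_subset u)
  have hYO : Y ⊆ O := iUnion₂_subset fun u _ => (image_mono hBO).trans (IsSys.image_word_subset hO u)
  have hYs : SepIn S.attractor (δ * r ^ (L * (k + 1))) Y := by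
    refine SepIn.biUnion fun u hu => (hcs u).mono ?_
    have h1 : r ^ (L * k + K + Λ) ≤ r ^ lev lam u :=
      pow_le_pow_of_le_one h.r_pos.le h.r_lt.le ((hcut u hu).lt hΛ0 hΛ).le
    rw [add_assoc, pow_add] at h1
    rw [mul_add, mul_one, pow_add]
    have h2 := h.pow_pos (L * k)
    calc δ * (r ^ (L * k) * r ^ L) = r ^ (L * k) * (r ^ L * δ) := by ring
      _ ≤ r ^ (L * k) * (c * r ^ (K + Λ)) := by gcongr
      _ = c * (r ^ (L * k) * r ^ (K + Λ)) := by ring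
      _ ≤ _ := by gcongr
  set R : Set S.attractor := Subtype.val ⁻¹' Y with hR
  have hRY : Subtype.val '' R = Y := by
    rw [hR, Subtype.image_preimage_coe, inter_eq_self_of_subset_right hYE]
  have hsub : R ⊆ sepNode S.attractor δ r (L * k) x := by
    intro y hy
    have : (y : EuclideanSpace ℝ (Fin d)) ∈ Subtype.val '' sepNode S.attractor δ r (L * k) x := by
      rw [heq]; exact hYc hy
    obtain ⟨y', hy', he⟩ := this
    rwa [← Subtype.val_injective he]
  have hsat : Sat (fun k => sepNode S.attractor δ r (L * k)) (k + 1) R := sat_of_sepIn le_rfl hYs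
  have hYμ : S.mu.real Y = (∑ u ∈ C, p ^ lev lam u) * S.mu.real B := by
    rw [hY, h.mu_biUnion hcut (fun _ _ => hB.subset) (fun _ _ => h.isCompact_of_hSep hB),
      Finset.sum_mul]
  refine ⟨R, hsub, hsat, ?_, ?_, ?_, ?_⟩
  · obtain ⟨u, hu⟩ := hCne
    obtain ⟨y, hy⟩ := hBne
    have : S.word u y ∈ Y := mem_iUnion₂.2 ⟨u, hu, y, hy, rfl⟩
    exact ⟨⟨_, hYE this⟩, this⟩
  · intro n D hDR hD
    have hDs := sepIn_of_sat hD
    have hDY : Subtype.val '' D ⊆ Y := by rw [← hRY]; exact image_mono hDR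
    rw [h.subMu_real ha.le]
    have hpos : 0 < δ * r ^ (L * n) := mul_pos hδ (h.pow_pos _)
    exact (hI _).2 ⟨_, h.mem_idealGroup_of_isIntSep ⟨hDs.isCompact h.isCompact hpos, hDs.1,
      hDs.compl.isCompact h.isCompact hpos, O, hO, hDY.trans hYO⟩, rfl⟩
  · refine ⟨a * ((∑ u ∈ C, p ^ lev lam u) * z), (hI _).2 ⟨_, mul_mem_idealGroup
      (sum_mem fun u _ => pow_mem (mem_Zring_self p) _) hz, rfl⟩, ?_⟩
    rw [h.subMu_real ha.le, hRY, hYμ, hBz]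
    ring
  · set c' := sepNode S.attractor δ r (L * k) x with hc'
    set N' : ℕ → S.attractor → Set S.attractor := fun k => sepNode S.attractor δ r (L * k) with hN'
    set hT : IsTree N' := hN.rescale L
    have hadd : SatAdd N' (S.subMu a).real := fun k A B hA hB hd =>
      measureReal_union hd (hM.isClosed (k := L * k) hB).measurableSet (measure_ne_top _ _)
        (measure_ne_top _ _)
    have hcsat : Sat N' (k + 1) (c' \ R) := hT.sat_diff
      (hT.sat_mono (Nat.le_succ k) (hT.sat_node k x)) hsat
    have hlow : ∀ e ∈ hT.cells (k + 1) (c' \ R), a * (p ^ (L * (k + 1)) * w) ≤ (S.subMu a).real e := by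
      intro e he
      obtain ⟨y, -, rfl⟩ := hT.mem_cells.1 he
      obtain ⟨C', hC', ⟨u, hu⟩, -, heq'⟩ := hC (L * (k + 1)) y
      rw [h.subMu_real ha.le, heq']
      refine mul_le_mul_of_nonneg_left ?_ ha.le
      calc p ^ (L * (k + 1)) * w = p ^ (L * (k + 1) + K + Λ) := by rw [hw, add_assoc, ← pow_add]
        _ ≤ p ^ lev lam u := pow_le_pow_of_le_one h.p_pos.le h.p_lt.le
            ((mem_cuts.1 (hC' hu)).lt hΛ0 hΛ).le
        _ = S.mu.real (S.cyl u) := (h.mu_cyl u).symm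
        _ ≤ _ := measureReal_mono (subset_biUnion_of_mem (u := S.cyl) hu) (measure_ne_top _ _)
    have hup : (S.subMu a).real (c' \ R) ≤ a * (p ^ (L * k) * M * (w / (2 * M + 1))) := by
      rw [h.subMu_real ha.le]
      refine mul_le_mul_of_nonneg_left ?_ ha.le
      have himg : Subtype.val '' (c' \ R) = (⋃ u ∈ C, S.cyl u) \ Y := by
        rw [image_sdiff Subtype.val_injective, heq, hRY]
      have hYm : MeasurableSet Y := (hYs.isCompact h.isCompact
        (mul_pos hδ (h.pow_pos _))).measurableSet
      rw [himg, measureReal_sdiff hYc hYm (measure_ne_top _ _), h.mu_biUnion_cyl hcut, hYμ]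
      have hBE : S.mu.real (S.attractor \ B) = 1 - S.mu.real B := by
        rw [measureReal_sdiff hB.subset (h.isCompact_of_hSep hB).measurableSet, h.mu_attractor]
      have hs : ∑ u ∈ C, p ^ lev lam u ≤ p ^ (L * k) * M := by
        calc ∑ u ∈ C, p ^ lev lam u ≤ ∑ u ∈ C, p ^ (L * k) := Finset.sum_le_sum fun u hu =>
              pow_le_pow_of_le_one h.p_pos.le h.p_lt.le ((Nat.le_add_right _ _).trans (hcut u hu).le)
          _ = p ^ (L * k) * C.card := by rw [Finset.sum_const, nsmul_eq_mul, mul_comm]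
          _ ≤ _ := mul_le_mul_of_nonneg_left (by exact_mod_cast hcard) (pow_pos h.p_pos _).le
      calc ∑ u ∈ C, p ^ lev lam u - (∑ u ∈ C, p ^ lev lam u) * S.mu.real B
          = (∑ u ∈ C, p ^ lev lam u) * (1 - S.mu.real B) := by ring
        _ ≤ p ^ (L * k) * M * (w / (2 * M + 1)) :=
          mul_le_mul hs (by rw [← hBE]; exact hBθ.trans (min_le_left _ _))
            (by rw [← hBE]; exact measureReal_nonneg)
            (mul_nonneg (pow_pos h.p_pos _).le (Nat.cast_nonneg _))
    have hsum := hadd.cells hT hcsat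
    have hge : ((hT.cells (k + 1) (c' \ R)).card : ℝ) * (a * (p ^ (L * (k + 1)) * w)) ≤
        (S.subMu a).real (c' \ R) := by
      rw [hsum, ← nsmul_eq_mul]
      exact Finset.card_nsmul_le_sum _ _ _ hlow
    have hle := hge.trans hup
    rw [mul_add, mul_one, pow_add] at hle
    have hpk : 0 < a * p ^ (L * k) * w := by have := pow_pos h.p_pos (L * k); positivity
    have h2 : (hT.cells (k + 1) (c' \ R)).card * p ^ L ≤ M / (2 * M + 1) := by
      refine le_of_mul_le_mul_left ?_ hpk
      calc _ = ((hT.cells (k + 1) (c' \ R)).card : ℝ) * (a * (p ^ (L * k) * p ^ L * w)) := by ring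
        _ ≤ _ := hle
        _ = _ := by ring
    refine h2.trans ?_
    rw [div_le_div_iff₀ hMpos two_pos]
    linarith

/-- The data needed to compare two attractors. -/
theorem exists_full {a : ℝ} (ha : 0 < a) {I : AddSubgroup ℝ}
    (hI : ∀ y, y ∈ I ↔ ∃ z ∈ idealGroup (S.idealOf p), y = a * z) :
    ∃ (N : ℕ → S.attractor → Set S.attractor) (δ : ℝ), IsMetricTree N r δ 1 ∧
      ∃ L₀, ∀ L ≥ L₀, 0 < L → ∃ n : ℕ, 0 < n ∧ ∀ β ∈ I, 0 < β → ∃ m W σ,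
        Full (fun k => N (L * k)) (p ^ L) m I W σ ∧ m univ = n * ((1 - p) * β) := by
  obtain ⟨δ, hδ, hN, hM⟩ := h.exists_tree
  have hcpt := isCompact_iff_compactSpace.1 h.isCompact
  have hfin := h.isFiniteMeasure_subMu a
  have hne : Nonempty S.attractor := h.nonempty.to_subtype
  obtain ⟨W, σ, hb⟩ := h.exists_base hδ hN hM ha hI
  obtain ⟨L₀, hL₀⟩ := h.exists_goodParts hδ hN hM ha hI
  refine ⟨_, δ, hM, L₀, fun L hL hL0 => ⟨((hb.rescale hL0).tree.cells 0 univ).card, ?_, ?_⟩⟩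
  · obtain ⟨x⟩ := hne
    exact Finset.card_pos.2 ⟨_, (hb.rescale hL0).tree.mem_cells.2 ⟨x, mem_univ x, rfl⟩⟩
  · intro β hβ hβ0
    exact exists_full_of_goodPart (hb.rescale hL0)
      (fun k x => (hM.isClosed (hN.sat_node (L * k) x)).measurableSet) h.p_pos h.p_lt hb.mul_p
      hb.mul_p_inv (hL₀ L hL) hβ hβ0

end IsReg
end IFS

end

section

/-- `f` is a bi-Lipschitz bijection between two sets. -/
structure IsBilip {X Y : Type*} [MetricSpace X] [MetricSpace Y] (f : X → Y) (L : ℝ) (E : Set X)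
    (E' : Set Y) : Prop where
  one_le : 1 ≤ L
  bij : BijOn f E E'
  le_dist : ∀ x ∈ E, ∀ y ∈ E, L⁻¹ * dist x y ≤ dist (f x) (f y)
  dist_le : ∀ x ∈ E, ∀ y ∈ E, dist (f x) (f y) ≤ L * dist x y

namespace IsBilip
variable {X Y : Type*} [MetricSpace X] [MetricSpace Y] {f : X → Y} {L : ℝ} {E : Set X} {E' : Set Y}
  (hf : IsBilip f L E E')
include hf

lemma pos : 0 < L := one_pos.trans_le hf.one_le

lemma sepIn_image {A : Set X} {t : ℝ} (hA : SepIn E t A) : SepIn E' (L⁻¹ * t) (f '' A) := by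
  refine ⟨(image_mono hA.1).trans hf.bij.image_eq.subset, ?_⟩
  rintro _ ⟨x, hx, rfl⟩ y hy hyA
  obtain ⟨z, hz, rfl⟩ := hf.bij.surjOn hy
  have hzA : z ∉ A := fun hzA => hyA (mem_image_of_mem f hzA)
  exact (mul_le_mul_of_nonneg_left (hA.2 x hx z hz hzA) (inv_pos.2 hf.pos).le).trans
    (hf.le_dist x (hA.1 hx) z hz)

lemma sepIn_preimage {B : Set Y} {t : ℝ} (hB : SepIn E' t B) :
    SepIn E (L⁻¹ * t) (E ∩ f ⁻¹' B) := by
  refine ⟨inter_subset_left, fun x hx y hy hyB => ?_⟩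
  have h1 := hB.2 (f x) hx.2 (f y) (hf.bij.mapsTo hy) fun hyB' => hyB ⟨hy, hyB'⟩
  rw [inv_mul_le_iff₀ hf.pos]
  exact h1.trans (hf.dist_le x hx.1 y hy)

lemma image_preimage {B : Set Y} (hB : B ⊆ E') : f '' (E ∩ f ⁻¹' B) = B := by
  ext y
  constructor
  · rintro ⟨x, hx, rfl⟩
    exact hx.2
  · intro hy
    obtain ⟨x, hx, rfl⟩ := hf.bij.surjOn (hB hy)
    exact ⟨x, ⟨hx, hy⟩, rfl⟩

lemma preimage_image {A : Set X} (hA : A ⊆ E) : E ∩ f ⁻¹' (f '' A) = A := by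
  ext x
  constructor
  · rintro ⟨hx, z, hz, hzx⟩
    rwa [← hf.bij.injOn (hA hz) hx hzx]
  · exact fun hx => ⟨hA hx, mem_image_of_mem f hx⟩

end IsBilip

namespace IFS.IsReg
variable {d d' : ℕ} {S : IFS d} {T : IFS d'} {lam : S.ι → ℕ} {lam' : T.ι → ℕ} {r p L : ℝ}
  {f : EuclideanSpace ℝ (Fin d) → EuclideanSpace ℝ (Fin d')}
  (h : S.IsReg lam r p) (h' : T.IsReg lam' r p) (hf : IsBilip f L S.attractor T.attractor)
include h h' hf

omit h in
lemma mu_image_diff {A B : Set (EuclideanSpace ℝ (Fin d))} {t t' : ℝ} (ht' : 0 < t')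
    (hA : SepIn S.attractor t A) (hB : SepIn S.attractor t' B) (hBA : B ⊆ A) :
    T.mu.real (f '' (A \ B)) = T.mu.real (f '' A) - T.mu.real (f '' B) := by
  have hB' := hf.sepIn_image hB
  rw [(hf.bij.injOn.mono hA.1).image_sdiff_subset hBA, measureReal_sdiff (image_mono hBA)
    (hB'.isCompact h'.isCompact (mul_pos (inv_pos.2 hf.pos) ht')).measurableSet (measure_ne_top _ _)]

/-- The images of cylinders have comparable measure. -/
lemma exists_mu_image_cyl_le : ∃ M : ℕ, ∀ u, T.mu.real (f '' S.cyl u) ≤ M * p ^ lev lam u := by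
  classical
  obtain ⟨D, hD, hd⟩ := h.exists_diam
  obtain ⟨M, hM⟩ := h'.exists_cyl_bound (L * D)
  refine ⟨M, fun u => ?_⟩
  obtain ⟨x, hx⟩ := h.cyl_nonempty u
  set C := (cuts h'.lam_pos (lev lam u)).filter fun v => (T.cyl v ∩ f '' S.cyl u).Nonempty with hC
  have hCc : ∀ v ∈ C, IsCut lam' v (lev lam u) := fun v hv =>
    mem_cuts.1 (Finset.mem_filter.1 hv).1
  have hcard : C.card ≤ M := by
    refine hM (lev lam u) (f x) C hCc fun v hv => ?_
    obtain ⟨_, hyv, y, hy, rfl⟩ := (Finset.mem_filter.1 hv).2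
    refine ⟨_, hyv, (hf.dist_le y (h.cyl_subset u hy) x (h.cyl_subset u hx)).trans ?_⟩
    rw [mul_assoc]
    exact mul_le_mul_of_nonneg_left (h.dist_le_of_mem_cyl hd hy hx) hf.pos.le
  have hsub : f '' S.cyl u ⊆ ⋃ v ∈ C, T.cyl v := by
    intro y hy
    obtain ⟨v, hv, hyv⟩ := h'.exists_mem_cyl (lev lam u)
      (hf.bij.image_eq.subset (image_mono (h.cyl_subset u) hy))
    exact mem_iUnion₂.2 ⟨v, Finset.mem_filter.2 ⟨mem_cuts.2 hv, y, hyv, hy⟩, hyv⟩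
  calc T.mu.real (f '' S.cyl u) ≤ T.mu.real (⋃ v ∈ C, T.cyl v) :=
        measureReal_mono hsub (measure_ne_top _ _)
    _ = ∑ v ∈ C, p ^ lev lam' v := h'.mu_biUnion_cyl hCc
    _ ≤ ∑ v ∈ C, p ^ lev lam u := Finset.sum_le_sum fun v hv =>
        pow_le_pow_of_le_one h.p_pos.le h.p_lt.le (hCc v hv).le
    _ = C.card * p ^ lev lam u := by rw [Finset.sum_const, nsmul_eq_mul]
    _ ≤ _ := mul_le_mul_of_nonneg_right (by exact_mod_cast hcard) (pow_pos h.p_pos _).le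

/-- The distortion of measure on the copies of an interior separated set attains a maximum. -/
lemma exists_max_ratio {F : Set (EuclideanSpace ℝ (Fin d))} (hF : S.HSep lam r F)
    (hne : F.Nonempty) : ∃ c u₀, 0 < c ∧
      (∀ u, T.mu.real (f '' (S.word u '' F)) ≤ c * S.mu.real (S.word u '' F)) ∧
      T.mu.real (f '' (S.word u₀ '' F)) = c * S.mu.real (S.word u₀ '' F) := by
  classical
  obtain ⟨D, hD, hd⟩ := h.exists_diam
  obtain ⟨t, ht, hFt⟩ := hF.exists_sepIn
  have hμF := h.mu_pos ht hFt hne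
  obtain ⟨c, hc, hcs⟩ := id hF
  obtain ⟨x, hx⟩ := hne
  obtain ⟨K, M, hKM⟩ := h'.exists_cuts_of_sepIn (mul_pos (inv_pos.2 hf.pos) hc) (L * D)
  obtain ⟨W, hW0, hW⟩ := h'.exists_weights K M
  have key : ∀ u, ∃ w ∈ W, T.mu.real (f '' (S.word u '' F)) = p ^ lev lam u * w := by
    intro u
    have hs := hf.sepIn_image (hcs u)
    rw [← mul_assoc] at hs
    obtain ⟨C, hC, hCne, hcard, heq⟩ := hKM (lev lam u) _ hs (f (S.word u x)) ⟨_, ⟨x, hx, rfl⟩, rfl⟩ (by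
      rintro _ ⟨_, ⟨y, hy, rfl⟩, rfl⟩
      refine (hf.dist_le _ (h.word_mem u (hF.subset hy)) _ (h.word_mem u (hF.subset hx))).trans ?_
      rw [mul_assoc]
      refine mul_le_mul_of_nonneg_left ?_ hf.pos.le
      rw [h.dist_word, mul_comm]
      exact mul_le_mul_of_nonneg_right (hd _ (hF.subset hy) _ (hF.subset hx)) (h.pow_pos _).le)
    obtain ⟨w, hw, hws⟩ := hW _ C hC hCne hcard
    exact ⟨w, hw, by rw [heq, h'.mu_biUnion_cyl fun v hv => mem_cuts.1 (hC hv), hws]⟩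
  obtain ⟨w, hw, hmax⟩ := (W.filter fun w => ∃ u, T.mu.real (f '' (S.word u '' F)) =
    p ^ lev lam u * w).exists_max_image id (by
      obtain ⟨w, hw, hwe⟩ := key []
      exact ⟨w, Finset.mem_filter.2 ⟨hw, [], hwe⟩⟩)
  obtain ⟨hwW, u₀, hu₀⟩ := Finset.mem_filter.1 hw
  refine ⟨w / S.mu.real F, u₀, div_pos (hW0 w hwW) hμF, fun u => ?_, ?_⟩
  · obtain ⟨w', hw', hwe⟩ := key u
    have : w' ≤ w := hmax w' (Finset.mem_filter.2 ⟨hw', u, hwe⟩)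
    rw [hwe, h.mu_image_word u hF.subset, mul_left_comm, div_mul_cancel₀ _ hμF.ne']
    exact mul_le_mul_of_nonneg_left this (pow_pos h.p_pos _).le
  · rw [hu₀, h.mu_image_word u₀ hF.subset, mul_left_comm, div_mul_cancel₀ _ hμF.ne']

/-- A bound for the distortion on the copies of a set extends to all separated sets. -/
lemma mu_image_le {F : Set (EuclideanSpace ℝ (Fin d))} (hF : S.HSep lam r F)
    (hne : F.Nonempty) {c : ℝ} (hc : 0 < c)
    (hle : ∀ u, T.mu.real (f '' (S.word u '' F)) ≤ c * S.mu.real (S.word u '' F))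
    {A : Set (EuclideanSpace ℝ (Fin d))} {t : ℝ} (ht : 0 < t) (hA : SepIn S.attractor t A) :
    T.mu.real (f '' A) ≤ c * S.mu.real A := by
  classical
  obtain ⟨M, hM⟩ := h.exists_mu_image_cyl_le h' hf
  obtain ⟨t₀, ht₀, hFt⟩ := hF.exists_sepIn
  have hμF := h.mu_pos ht₀ hFt hne
  have hμF1 : S.mu.real F ≤ 1 := by
    rw [← h.mu_attractor]; exact measureReal_mono hF.subset (measure_ne_top _ _)
  have bound : ∀ (A : Set (EuclideanSpace ℝ (Fin d))) (t : ℝ), 0 < t → SepIn S.attractor t A →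
      T.mu.real (f '' A) ≤ M * S.mu.real A := by
    intro A t ht hA
    obtain ⟨k, hk⟩ := h.mu_eq_sum_of_sepIn ht hA
    obtain ⟨C, -, hCA, hCs⟩ := hk k le_rfl
    calc T.mu.real (f '' A) = T.mu.real (⋃ u ∈ C, f '' S.cyl u) := by rw [hCA, image_iUnion₂]
      _ ≤ ∑ u ∈ C, T.mu.real (f '' S.cyl u) := measureReal_biUnion_finset_le _ _
      _ ≤ ∑ u ∈ C, M * p ^ lev lam u := Finset.sum_le_sum fun u _ => hM u
      _ = M * S.mu.real A := by rw [hCs, Finset.mul_sum]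
  have step : ∀ n : ℕ, ∃ (B : Set (EuclideanSpace ℝ (Fin d))) (s : ℝ), 0 < s ∧
      SepIn S.attractor s B ∧ S.mu.real B = (1 - S.mu.real F) ^ n * S.mu.real A ∧
      T.mu.real (f '' A) - c * S.mu.real A ≤ T.mu.real (f '' B) - c * S.mu.real B := by
    intro n
    induction n with
    | zero => exact ⟨A, t, ht, hA, by simp, le_rfl⟩
    | succ n ih =>
      obtain ⟨B, s, hs, hB, hBμ, hBle⟩ := ih
      obtain ⟨k, hk⟩ := h.mu_eq_sum_of_sepIn hs hB
      obtain ⟨C, hC, hCB, hCs⟩ := hk k le_rfl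
      set G : Set (EuclideanSpace ℝ (Fin d)) := ⋃ u ∈ C, S.word u '' F with hG
      have hGB : G ⊆ B := by
        rw [hCB]; exact iUnion₂_mono fun u _ => image_mono hF.subset
      obtain ⟨s', hs', hGs⟩ := (h.hSep_biUnion C (F := fun u => S.word u '' F)
        fun u _ => h.hSep_image_word u hF).exists_sepIn
      have hGμ : S.mu.real G = S.mu.real B * S.mu.real F := by
        rw [hG, h.mu_biUnion (fun u hu => mem_cuts.1 (hC hu)) (fun _ _ => hF.subset)
          (fun _ _ => h.isCompact_of_hSep hF), hCs, Finset.sum_mul]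
      have hGle : T.mu.real (f '' G) ≤ c * S.mu.real G := by
        calc T.mu.real (f '' G) = T.mu.real (⋃ u ∈ C, f '' (S.word u '' F)) := by
              rw [hG, image_iUnion₂]
          _ ≤ ∑ u ∈ C, T.mu.real (f '' (S.word u '' F)) := measureReal_biUnion_finset_le _ _
          _ ≤ ∑ u ∈ C, c * (p ^ lev lam u * S.mu.real F) := Finset.sum_le_sum fun u _ => by
              rw [← h.mu_image_word u hF.subset]; exact hle u
          _ = c * S.mu.real G := by rw [hGμ, hCs, ← Finset.mul_sum, Finset.sum_mul]
      have hdiff : S.mu.real (B \ G) = S.mu.real B - S.mu.real G :=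
        measureReal_sdiff hGB (hGs.isCompact h.isCompact hs').measurableSet (measure_ne_top _ _)
      refine ⟨B \ G, min s s', lt_min hs hs',
        (hB.mono (min_le_left _ _)).diff (hGs.mono (min_le_right _ _)), ?_, ?_⟩
      · rw [hdiff, hGμ, hBμ]; ring
      · rw [h'.mu_image_diff hf hs' hB hGs hGB, hdiff]
        linarith
  have hlim : Filter.Tendsto (fun n : ℕ => M * ((1 - S.mu.real F) ^ n * S.mu.real A)) Filter.atTop
      (nhds (M * (0 * S.mu.real A))) :=
    ((tendsto_pow_atTop_nhds_zero_of_lt_one (by linarith) (by linarith)).mul_const _).const_mul _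
  have hfin : ∀ n : ℕ, T.mu.real (f '' A) - c * S.mu.real A ≤
      M * ((1 - S.mu.real F) ^ n * S.mu.real A) := fun n => by
    obtain ⟨B, s, hs, hB, hBμ, hBle⟩ := step n
    rw [← hBμ]
    have h1 := bound B s hs hB
    have h2 : 0 ≤ c * S.mu.real B := mul_nonneg hc.le measureReal_nonneg
    linarith
  have := ge_of_tendsto' hlim hfin
  rw [zero_mul, mul_zero] at this
  linarith

/-- A bi-Lipschitz bijection scales the measure by a constant on a small piece. -/
lemma exists_scaling : ∃ (F : Set (EuclideanSpace ℝ (Fin d))) (u : List S.ι) (c : ℝ), 0 < c ∧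
    S.IsIntSep F ∧ F.Nonempty ∧ ∀ A ⊆ S.word u '' F, ∀ t > 0, SepIn S.attractor t A →
      T.mu.real (f '' A) = c * S.mu.real A := by
  obtain ⟨F, hF, hne⟩ := h.exists_isIntSep
  have hFH := h.hSep_of_isIntSep hF
  obtain ⟨c, u, hc, hle, heq⟩ := h.exists_max_ratio h' hf hFH hne
  refine ⟨F, u, c, hc, hF, hne, fun A hAG t ht hA => ?_⟩
  obtain ⟨s, hs, hG⟩ := (h.hSep_image_word u hFH).exists_sepIn
  have h1 := h.mu_image_le h' hf hFH hne hc hle ht hA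
  have h2 := h.mu_image_le h' hf hFH hne hc hle (lt_min ht hs)
    ((hG.mono (min_le_right t s)).diff (hA.mono (min_le_left t s)))
  rw [h'.mu_image_diff hf ht hG hA hAG, measureReal_sdiff hAG
    (hA.isCompact h.isCompact ht).measurableSet (measure_ne_top _ _), heq] at h2
  linarith

omit h' hf in
lemma exists_cyl_subset {A : Set (EuclideanSpace ℝ (Fin d))} {t : ℝ} (ht : 0 < t)
    (hA : SepIn S.attractor t A) (hne : A.Nonempty) : ∃ u, S.cyl u ⊆ A := by
  obtain ⟨k, hk⟩ := h.cyl_subset_of_sepIn ht hA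
  obtain ⟨x, hx⟩ := hne
  obtain ⟨u, hu, hxu⟩ := h.exists_mem_cyl k (hA.1 hx)
  exact ⟨u, hk k le_rfl u hu ⟨x, hxu, hx⟩⟩

omit h h' hf in
/-- Membership in the ideal can be tested up to powers of `p`. -/
lemma mem_of_pow_mul_mem {d : ℕ} {S : IFS d} {lam : S.ι → ℕ} (h : S.IsReg lam r p)
    {J : Ideal (Zring p)} {n : ℕ} {x : ℝ}
    (hx : p ^ n * x ∈ idealGroup J) : x ∈ idealGroup J := by
  have := mul_mem_idealGroup (pow_mem h.inv_mem n) hx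
  rwa [← mul_assoc, inv_pow, inv_mul_cancel₀ (pow_pos h.p_pos n).ne', one_mul] at this

omit h h' hf in
lemma idealGroup_idealOf_induction {d : ℕ} {S : IFS d} {J : Ideal (Zring p)} {c : ℝ}
    (hc : ∀ F, S.IsIntSep F → c * S.mu.real F ∈ idealGroup J) {x : ℝ}
    (hx : x ∈ idealGroup (S.idealOf p)) : c * x ∈ idealGroup J := by
  obtain ⟨x, hx, rfl⟩ := hx
  have hx' : x ∈ Submodule.span (Zring p)
      {x : Zring p | ∃ F, S.IsIntSep F ∧ (x : ℝ) = S.natMeasure F} := hx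
  change c * (x : ℝ) ∈ idealGroup J
  refine Submodule.span_induction (p := fun (x : Zring p) _ => c * (x : ℝ) ∈ idealGroup J)
    ?_ ?_ ?_ ?_ hx'
  · rintro x ⟨F, hF, hFx⟩
    rw [hFx, ← mu_real_of_subset hF.2.1]
    exact hc F hF
  · simp
  · intro x y _ _ hx hy
    rw [Subring.coe_add, mul_add]
    exact add_mem hx hy
  · intro a x _ hx
    rw [smul_eq_mul, Subring.coe_mul, mul_left_comm]
    exact mul_mem_idealGroup a.2 hx

theorem sameIdealClass : SameIdealClass (S.idealOf p) (T.idealOf p) := by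
  obtain ⟨F, u, c, hc, hF, hne, hscale⟩ := h.exists_scaling h' hf
  have hLi : 0 < L⁻¹ := inv_pos.2 hf.pos
  obtain ⟨s, hs, hGs⟩ := (h.hSep_image_word u (h.hSep_of_isIntSep hF)).exists_sepIn
  have hfG := hf.sepIn_image hGs
  have hGne : (S.word u '' F).Nonempty := hne.image _
  have hGpos := h.mu_pos hs hGs hGne
  have hfGpos := h'.mu_pos (mul_pos hLi hs) hfG (hGne.image f)
  obtain ⟨v, hv⟩ := h'.exists_cyl_subset (mul_pos hLi hs) hfG (hGne.image f)
  have hpre : ∀ B ⊆ f '' (S.word u '' F), S.attractor ∩ f ⁻¹' B ⊆ (S.word u '' F) := fun B hB => by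
    rw [← hf.preimage_image hGs.1]
    exact inter_subset_inter_right _ (preimage_mono hB)
  have h1 : ∀ x ∈ idealGroup (S.idealOf p), c * x ∈ idealGroup (T.idealOf p) := by
    obtain ⟨F', hF', hne'⟩ := h'.exists_isIntSep
    have hsub : T.word v '' F' ⊆ f '' (S.word u '' F) := (image_mono hF'.2.1).trans hv
    obtain ⟨s', hs', hHs⟩ := (h'.hSep_image_word v (h'.hSep_of_isIntSep hF')).exists_sepIn
    have hA := hf.sepIn_preimage hHs
    obtain ⟨w, hw⟩ := h.exists_cyl_subset (mul_pos hLi hs') hA (by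
      obtain ⟨y, hy⟩ := hne'.image (T.word v)
      obtain ⟨x, hx, rfl⟩ := hf.bij.surjOn (hHs.1 hy)
      exact ⟨x, hx, hy⟩)
    refine fun x hx => idealGroup_idealOf_induction (fun F₁ hF₁ => ?_) hx
    obtain ⟨s₁, hs₁, hF₁s⟩ := (h.hSep_image_word w (h.hSep_of_isIntSep hF₁)).exists_sepIn
    have hF₁sub : S.word w '' F₁ ⊆ S.attractor ∩ f ⁻¹' (T.word v '' F') :=
      (image_mono hF₁.2.1).trans hw
    obtain ⟨D, hD, hDe⟩ := h'.mu_mem_of_subset_image_word hF' (u := v)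
      (D := f '' (S.word w '' F₁)) (by
        rintro _ ⟨x, hx, rfl⟩
        exact (hF₁sub hx).2) (mul_pos hLi hs₁) (hf.sepIn_image hF₁s)
    rw [hscale _ (hF₁sub.trans (hpre _ hsub)) s₁ hs₁ hF₁s, h.mu_image_word w hF₁.2.1] at hDe
    refine h.mem_of_pow_mul_mem (n := lev lam w) ?_
    rw [mul_left_comm, hDe]
    exact mul_mem_idealGroup (pow_mem (mem_Zring_self p) _) (h'.mem_idealGroup_of_isIntSep hD)
  have h2 : ∀ y ∈ idealGroup (T.idealOf p), c⁻¹ * y ∈ idealGroup (S.idealOf p) := by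
    refine fun y hy => idealGroup_idealOf_induction (fun F₁ hF₁ => ?_) hy
    obtain ⟨s₁, hs₁, hF₁s⟩ := (h'.hSep_image_word v (h'.hSep_of_isIntSep hF₁)).exists_sepIn
    have hsub : T.word v '' F₁ ⊆ f '' (S.word u '' F) := (image_mono hF₁.2.1).trans hv
    have hA := hf.sepIn_preimage hF₁s
    obtain ⟨D, hD, hDe⟩ := h.mu_mem_of_subset_image_word hF (u := u) (hpre _ hsub)
      (mul_pos hLi hs₁) hA
    have heq := hscale _ (hpre _ hsub) _ (mul_pos hLi hs₁) hA
    rw [hf.image_preimage hF₁s.1, h'.mu_image_word v hF₁.2.1, hDe] at heq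
    refine h.mem_of_pow_mul_mem (n := lev lam' v) ?_
    rw [mul_left_comm, heq, inv_mul_cancel_left₀ hc.ne']
    exact mul_mem_idealGroup (pow_mem (mem_Zring_self p) _) (h.mem_idealGroup_of_isIntSep hD)
  have hcG := hscale (S.word u '' F) subset_rfl s hs hGs
  refine ⟨⟨_, h'.mu_mem_Zring (mul_pos hLi hs) hfG⟩, ⟨_, h.mu_mem_Zring hs hGs⟩, ?_, ?_, ?_⟩
  · exact fun h0 => hfGpos.ne' (congrArg Subtype.val h0)
  · exact fun h0 => hGpos.ne' (congrArg Subtype.val h0)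
  · ext y
    simp only [mem_smul_set, smul_eq_mul, hcG]
    constructor
    · rintro ⟨x, hx, rfl⟩
      exact ⟨c * x, h1 x hx, by ring⟩
    · rintro ⟨x, hx, rfl⟩
      exact ⟨c⁻¹ * x, h2 x hx, by field_simp⟩

end IFS.IsReg

end

section

lemma LipEquiv.of_subtype {X Y : Type*} [MetricSpace X] [MetricSpace Y] [Nonempty Y] {A : Set X}
    {B : Set Y} {f : A → B} {L : ℝ} (hL : 1 ≤ L) (hf : Function.Bijective f)
    (hd : ∀ x y, L⁻¹ * dist x y ≤ dist (f x) (f y) ∧ dist (f x) (f y) ≤ L * dist x y) :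
    LipEquiv A B := by
  classical
  obtain ⟨y₀⟩ := ‹Nonempty Y›
  obtain ⟨g, heq⟩ : ∃ g : X → Y, ∀ x (hx : x ∈ A), g x = f ⟨x, hx⟩ :=
    ⟨fun x => if h : x ∈ A then f ⟨x, h⟩ else y₀, fun x hx => dif_pos hx⟩
  refine ⟨g, L, hL, ⟨fun x hx => ?_, ?_, ?_⟩, ?_⟩
  · rw [heq x hx]
    exact (f ⟨x, hx⟩).2
  · intro x hx y hy hxy
    rw [heq x hx, heq y hy] at hxy
    exact congrArg Subtype.val (hf.1 (Subtype.ext hxy))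
  · intro y hy
    obtain ⟨⟨x, hx⟩, hxy⟩ := hf.2 ⟨y, hy⟩
    exact ⟨x, hx, by rw [heq x hx, hxy]⟩
  · intro x hx y hy
    rw [heq x hx, heq y hy]
    exact hd ⟨x, hx⟩ ⟨y, hy⟩

lemma IsBilip.of_lipEquiv {X Y : Type*} [MetricSpace X] [MetricSpace Y] {A : Set X} {B : Set Y}
    (h : LipEquiv A B) : ∃ f L, IsBilip (X := X) (Y := Y) f L A B := by
  obtain ⟨f, L, hL, hf, hd⟩ := h
  exact ⟨f, L, hL, hf, fun x hx y hy => (hd x hx y hy).1, fun x hx y hy => (hd x hx y hy).2⟩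

lemma mem_smul_idealSet_iff_abs {R : Subring ℝ} {J : Ideal R} {a y : ℝ} :
    y ∈ a • idealSet J ↔ ∃ z ∈ idealGroup J, y = |a| * z := by
  rw [mem_smul_set]
  constructor
  · rintro ⟨z, hz, rfl⟩
    rcases abs_choice a with h | h
    · exact ⟨z, hz, by rw [h, smul_eq_mul]⟩
    · exact ⟨-z, (idealGroup J).neg_mem hz, by rw [h, smul_eq_mul, neg_mul_neg]⟩
  · rintro ⟨z, hz, rfl⟩
    rcases abs_choice a with h | h
    · exact ⟨z, hz, by rw [h, smul_eq_mul]⟩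
    · exact ⟨-z, (idealGroup J).neg_mem hz, by rw [h, smul_eq_mul, mul_neg, neg_mul]⟩

namespace IFS.IsReg
variable {d d' : ℕ} {S : IFS d} {T : IFS d'} {lam : S.ι → ℕ} {lam' : T.ι → ℕ} {r p : ℝ}

theorem lipEquiv (h : S.IsReg lam r p) (h' : T.IsReg lam' r p)
    (hI : SameIdealClass (S.idealOf p) (T.idealOf p)) : LipEquiv S.attractor T.attractor := by
  obtain ⟨a, b, ha, hb, hab⟩ := hI
  have ha' : 0 < |(a : ℝ)| := abs_pos.2 fun h0 => ha (Subtype.ext h0)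
  have hb' : 0 < |(b : ℝ)| := abs_pos.2 fun h0 => hb (Subtype.ext h0)
  set I : AddSubgroup ℝ := (idealGroup (S.idealOf p)).map (AddMonoidHom.mulLeft |(a : ℝ)|) with hIdef
  have hIS : ∀ y, y ∈ I ↔ ∃ z ∈ idealGroup (S.idealOf p), y = |(a : ℝ)| * z := fun y => by
    simp [hIdef, AddSubgroup.mem_map, eq_comm]
  have hIT : ∀ y, y ∈ I ↔ ∃ z ∈ idealGroup (T.idealOf p), y = |(b : ℝ)| * z := fun y => by
    rw [hIS, ← mem_smul_idealSet_iff_abs, hab, mem_smul_idealSet_iff_abs]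
  obtain ⟨N, δ, hN, L₀, hL₀⟩ := h.exists_full ha' hIS
  obtain ⟨N', δ', hN', L₀', hL₀'⟩ := h'.exists_full hb' hIT
  set L := max L₀ L₀' + 1 with hLdef
  have hLpos : 0 < L := Nat.succ_pos _
  obtain ⟨n, hn, hfull⟩ := hL₀ L (by omega) hLpos
  obtain ⟨n', hn', hfull'⟩ := hL₀' L (by omega) hLpos
  obtain ⟨z, hz, hz0⟩ : ∃ z ∈ I, 0 < z := by
    obtain ⟨F, hF, hne⟩ := h.exists_isIntSep
    obtain ⟨t, ht, hFt⟩ := (h.hSep_of_isIntSep hF).exists_sepIn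
    exact ⟨_, (hIS _).2 ⟨_, h.mem_idealGroup_of_isIntSep hF, rfl⟩,
      mul_pos ha' (h.mu_pos ht hFt hne)⟩
  obtain ⟨m, W, σ, hb1, hm⟩ := hfull (n' • z) (nsmul_mem hz n') (nsmul_pos hz0 hn'.ne')
  obtain ⟨m', W', σ', hb2, hm'⟩ := hfull' (n • z) (nsmul_mem hz n) (nsmul_pos hz0 hn.ne')
  have := isCompact_iff_compactSpace.1 h.isCompact
  have := isCompact_iff_compactSpace.1 h'.isCompact
  have := h.nonempty.to_subtype
  have := h'.nonempty.to_subtype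
  obtain ⟨f, M, hM, hf, hd⟩ := exists_bilipschitz hb1 hb2 (hN.rescale hLpos) (hN'.rescale hLpos) (by
    rw [hm, hm', nsmul_eq_mul, nsmul_eq_mul]
    ring)
  exact LipEquiv.of_subtype hM hf hd

end IFS.IsReg

end

/-- **Theorem.** For `S, T ∈ TOEC(p, r)`, the self-similar sets `E_S` and `E_T` are
Lipschitz equivalent iff the ideals `I_S` and `I_T` lie in the same ideal class of `ℤ[p]`. -/
theorem lipEquiv_iff_sameIdealClass {d d' : ℕ} (p r : ℝ)
    (hp0 : 0 < p) (hp1 : p < 1) (hr0 : 0 < r) (hr1 : r < 1)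
    (S : IFS d) (T : IFS d') (hS : S.MemTOECpr p r) (hT : T.MemTOECpr p r) :
    LipEquiv S.attractor T.attractor ↔ SameIdealClass (S.idealOf p) (T.idealOf p) := by
  obtain ⟨lam, h⟩ := hS.isReg hp0 hp1
  obtain ⟨lam', h'⟩ := hT.isReg hp0 hp1
  refine ⟨fun he => ?_, h.lipEquiv h'⟩
  obtain ⟨f, L, hf⟩ := IsBilip.of_lipEquiv he
  exact h.sameIdealClass h' hf

end
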